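/- For every n ≥ 9, every planar graph on n vertices that contains no induced copy of P_5 has at most ⌊11n/4⌋ − 4 edges. -/

import Mathlib

open SimpleGraph

/-- `G` contains a subdivision of `H`, i.e. `H` is a topological minor of `G`:
there are branch vertices given by an injection `f` and, for each edge of `H`,
a path in `G` between the corresponding branch vertices, such that these paths
are internally disjoint from each other and from the branch vertices. -/
def ContainsSubdivision {W V : Type*} (H : SimpleGraph W) (G : SimpleGraph V) : Prop :=
  ∃ (f : W ↪ V) (p : ∀ ⦃a b : W⦄, H.Adj a b → G.Walk (f a) (f b)),
    (∀ ⦃a b : W⦄ (h : H.Adj a b), (p h).IsPath) ∧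
    (∀ ⦃a b : W⦄ (h : H.Adj a b) (w : W), f w ∈ (p h).support → w = a ∨ w = b) ∧
    (∀ ⦃a b c d : W⦄ (h₁ : H.Adj a b) (h₂ : H.Adj c d), s(a, b) ≠ s(c, d) →
      ∀ x, x ∈ (p h₁).support → x ∈ (p h₂).support →
        (x = f a ∨ x = f b) ∧ (x = f c ∨ x = f d))

/-- A graph is planar iff it contains no subdivision of `K₅` or of `K₃,₃`
(Kuratowski's characterization). -/
def IsPlanar {V : Type*} (G : SimpleGraph V) : Prop :=
  ¬ ContainsSubdivision (completeGraph (Fin 5)) G ∧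
  ¬ ContainsSubdivision (completeBipartiteGraph (Fin 3) (Fin 3)) G

/-- `G` contains an induced copy of `F`. -/
def ContainsInduced {W V : Type*} (F : SimpleGraph W) (G : SimpleGraph V) : Prop :=
  ∃ s : Set V, Nonempty (F ≃g G.induce s)

namespace PlanarP5

open scoped Classical
open Finset

variable {V : Type*}

/-- `A` is nonempty and induces a connected subgraph of `G`. -/
def Cn (G : SimpleGraph V) (A : Finset V) : Prop :=
  A.Nonempty ∧ ∀ t ⊆ A, t.Nonempty → (∀ x ∈ t, ∀ y ∈ A, G.Adj x y → y ∈ t) → t = A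

/-- Some edge of `G` joins `A` and `B`. -/
def Tc (G : SimpleGraph V) (A B : Finset V) : Prop := ∃ x ∈ A, ∃ y ∈ B, G.Adj x y

theorem Tc.symm {G : SimpleGraph V} {A B : Finset V} (h : Tc G A B) : Tc G B A := by
  obtain ⟨x, hx, y, hy, h⟩ := h
  exact ⟨y, hy, x, hx, h.symm⟩

theorem tc_of_adj {G : SimpleGraph V} {A B : Finset V} {x y : V} (h : G.Adj x y) (hx : x ∈ A)
    (hy : y ∈ B) : Tc G A B := ⟨x, hx, y, hy, h⟩

theorem cn_singleton (G : SimpleGraph V) (a : V) : Cn G {a} := by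
  refine ⟨by simp, fun t ht hne _ => ?_⟩
  rcases Finset.subset_singleton_iff.1 ht with h | h
  · simp [h] at hne
  · exact h

theorem Cn.mono {G G' : SimpleGraph V} (hG : G ≤ G') {A : Finset V} (h : Cn G A) : Cn G' A :=
  ⟨h.1, fun t ht hne hc => h.2 t ht hne fun x hx y hy hxy => hc x hx y hy (hG hxy)⟩

theorem Cn.exists_adj {G : SimpleGraph V} {A t : Finset V} (h : Cn G A) (ht : t ⊆ A)
    (hne : t.Nonempty) (hA : t ≠ A) : ∃ x ∈ t, ∃ y ∈ A, y ∉ t ∧ G.Adj x y := by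
  by_contra! hc
  refine hA (h.2 t ht hne fun x hx y hy hxy => ?_)
  by_contra hyt
  exact hc x hx y hy hyt hxy

theorem Cn.union {G : SimpleGraph V} {A B : Finset V} (hA : Cn G A) (hB : Cn G B)
    (h : Tc G A B ∨ ¬ Disjoint A B) : Cn G (A ∪ B) := by
  have key : ∀ A B : Finset V, Cn G A → Cn G B → (Tc G A B ∨ ¬ Disjoint A B) →
      ∀ t ⊆ A ∪ B, (t ∩ A).Nonempty → (∀ x ∈ t, ∀ y ∈ A ∪ B, G.Adj x y → y ∈ t) →
      t = A ∪ B := by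
    intro A B hA hB h t ht hne hc
    have h1 : t ∩ A = A := hA.2 _ inter_subset_right hne fun x hx y hy hxy =>
      mem_inter.2 ⟨hc x (mem_inter.1 hx).1 y (mem_union_left _ hy) hxy, hy⟩
    have hAt : A ⊆ t := by rw [← h1]; exact inter_subset_left
    have hne' : (t ∩ B).Nonempty := by
      rcases h with ⟨x, hx, y, hy, hxy⟩ | h
      · exact ⟨y, mem_inter.2 ⟨hc x (hAt hx) y (mem_union_right _ hy) hxy, hy⟩⟩
      · obtain ⟨x, hx, hx'⟩ := Finset.not_disjoint_iff.1 h
        exact ⟨x, mem_inter.2 ⟨hAt hx, hx'⟩⟩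
    have h2 : t ∩ B = B := hB.2 _ inter_subset_right hne' fun x hx y hy hxy =>
      mem_inter.2 ⟨hc x (mem_inter.1 hx).1 y (mem_union_right _ hy) hxy, hy⟩
    have hBt : B ⊆ t := by rw [← h2]; exact inter_subset_left
    exact subset_antisymm ht (union_subset hAt hBt)
  refine ⟨hA.1.mono subset_union_left, fun t ht hne hc => ?_⟩
  obtain ⟨x, hx⟩ := hne
  rcases mem_union.1 (ht hx) with hxA | hxB
  · exact key A B hA hB h t ht ⟨x, mem_inter.2 ⟨hx, hxA⟩⟩ hc
  · rw [union_comm] at ht hc ⊢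
    exact key B A hB hA (h.imp Tc.symm fun h h' => h h'.symm) t ht
      ⟨x, mem_inter.2 ⟨hx, hxB⟩⟩ hc

theorem cn_pair {G : SimpleGraph V} {a b : V} (h : G.Adj a b) : Cn G {a, b} := by
  have := (cn_singleton G a).union (cn_singleton G b) (Or.inl (tc_of_adj h (by simp) (by simp)))
  rwa [← Finset.insert_eq] at this

theorem Cn.insert {G : SimpleGraph V} {A : Finset V} {a x : V} (hA : Cn G A) (hx : x ∈ A)
    (h : G.Adj a x) : Cn G (insert a A) := by
  have := (cn_singleton G a).union hA (Or.inl (tc_of_adj h (by simp) hx))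
  rwa [← Finset.insert_eq] at this

/-- The component of a vertex in the subgraph induced on `S`. -/
theorem exists_comp (G : SimpleGraph V) {S : Finset V} {x : V} (hx : x ∈ S) :
    ∃ C ⊆ S, x ∈ C ∧ Cn G C ∧ ∀ u ∈ C, ∀ v ∈ S, G.Adj u v → v ∈ C := by
  let r : V → V → Prop := fun a b => G.Adj a b ∧ b ∈ S
  let C := S.filter (fun y => Relation.ReflTransGen r x y)
  have hcl : ∀ u ∈ C, ∀ v ∈ S, G.Adj u v → v ∈ C := fun u hu v hv huv =>
    mem_filter.2 ⟨hv, (mem_filter.1 hu).2.tail ⟨huv, hv⟩⟩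
  have hxC : x ∈ C := mem_filter.2 ⟨hx, .refl⟩
  refine ⟨C, filter_subset _ _, hxC, ⟨⟨x, hxC⟩, fun t ht hne hc => ?_⟩, hcl⟩
  have hreach : ∀ y, Relation.ReflTransGen r x y → (x ∈ t → y ∈ t) ∧ (y ∈ t → x ∈ t) := by
    intro y hy
    induction hy with
    | refl => exact ⟨id, id⟩
    | @tail b c hb hbc ih =>
      have hcC : c ∈ C := mem_filter.2 ⟨hbc.2, hb.tail hbc⟩
      have hbC : b ∈ C := by
        rcases Relation.ReflTransGen.cases_tail hb with h | ⟨d, _, hd⟩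
        · rw [h]; exact hxC
        · exact mem_filter.2 ⟨hd.2, hb⟩
      exact ⟨fun h => hc b (ih.1 h) c hcC hbc.1, fun h => ih.2 (hc c h b hbC hbc.1.symm)⟩
  obtain ⟨y, hy⟩ := hne
  have hxt : x ∈ t := (hreach y (mem_filter.1 (ht hy)).2).2 hy
  exact subset_antisymm ht fun z hz => (hreach z (mem_filter.1 hz).2).1 hxt

/-- A branch-set model of `H` inside the subgraph of `G` induced on `S`. -/
def Model {W : Type*} (H : SimpleGraph W) (G : SimpleGraph V) (S : Finset V) : Prop :=
  ∃ β : W → Finset V, (∀ w, β w ⊆ S ∧ Cn G (β w)) ∧ (∀ w w', w ≠ w' → Disjoint (β w) (β w')) ∧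
    ∀ w w', H.Adj w w' → Tc G (β w) (β w')

theorem Model.mono {W : Type*} {H : SimpleGraph W} {G G' : SimpleGraph V} {S S' : Finset V}
    (h : Model H G S) (hG : G ≤ G') (hS : S ⊆ S') : Model H G' S' := by
  obtain ⟨β, h1, h2, h3⟩ := h
  refine ⟨β, fun w => ⟨(h1 w).1.trans hS, (h1 w).2.mono hG⟩, h2, fun w w' hw => ?_⟩
  obtain ⟨x, hx, y, hy, hxy⟩ := h3 w w' hw
  exact ⟨x, hx, y, hy, hG hxy⟩

/-- Contraction of the set `R` into the vertex `a`. -/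
def con (G : SimpleGraph V) (a : V) (R : Finset V) : SimpleGraph V where
  Adj x y := x ≠ y ∧ (G.Adj x y ∨ (x = a ∧ ∃ r ∈ R, G.Adj r y) ∨ (y = a ∧ ∃ r ∈ R, G.Adj x r))
  symm := ⟨by
    rintro x y ⟨h, h' | ⟨h', r, hr, h''⟩ | ⟨h', r, hr, h''⟩⟩
    · exact ⟨h.symm, Or.inl h'.symm⟩
    · exact ⟨h.symm, Or.inr (Or.inr ⟨h', r, hr, h''.symm⟩)⟩
    · exact ⟨h.symm, Or.inr (Or.inl ⟨h', r, hr, h''.symm⟩)⟩⟩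
  loopless := ⟨fun x h => h.1 rfl⟩

theorem le_con (G : SimpleGraph V) (a : V) (R : Finset V) : G ≤ con G a R :=
  fun _ _ h => ⟨h.ne, Or.inl h⟩

theorem Model.of_con {W : Type*} {H : SimpleGraph W} {G : SimpleGraph V} {S R : Finset V} {a : V}
    (hR : R ⊆ S) (haR : a ∉ R) (hc : Cn G (Insert.insert a R))
    (h : Model H (con G a R) (S \ R)) : Model H G S := by
  obtain ⟨β, h1, h2, h3⟩ := h
  let γ : W → Finset V := fun w => if a ∈ β w then β w ∪ R else β w
  have hβγ : ∀ w, β w ⊆ γ w := fun w => by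
    by_cases h : a ∈ β w <;> simp [γ, h]
  have hβR : ∀ w, Disjoint (β w) R := fun w =>
    Finset.disjoint_left.2 fun x hx hxR => (mem_sdiff.1 ((h1 w).1 hx)).2 hxR
  refine ⟨γ, fun w => ⟨?_, ?_⟩, ?_, ?_⟩
  · intro x hx
    by_cases ha : a ∈ β w
    · simp only [γ, ha, if_true, mem_union] at hx
      rcases hx with hx | hx
      · exact (mem_sdiff.1 ((h1 w).1 hx)).1
      · exact hR hx
    · simp only [γ, ha, if_false] at hx
      exact (mem_sdiff.1 ((h1 w).1 hx)).1
  · by_cases ha : a ∈ β w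
    · simp only [γ, ha, if_true]
      refine ⟨⟨a, by simp [ha]⟩, fun t ht hne hcl => ?_⟩
      have haRsub : Insert.insert a R ⊆ β w ∪ R := by
        intro x hx
        rcases mem_insert.1 hx with rfl | hx
        · simp [ha]
        · simp [hx]
      have h5 : (t ∩ Insert.insert a R).Nonempty → Insert.insert a R ⊆ t := by
        intro hne
        have := hc.2 _ inter_subset_right hne fun x hx y hy hxy =>
          mem_inter.2 ⟨hcl x (mem_inter.1 hx).1 y (haRsub hy) hxy, hy⟩
        rw [← this]; exact inter_subset_left
      have h6 : (t ∩ β w).Nonempty := by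
        obtain ⟨x, hx⟩ := hne
        rcases mem_union.1 (ht hx) with hx' | hx'
        · exact ⟨x, mem_inter.2 ⟨hx, hx'⟩⟩
        · exact ⟨a, mem_inter.2 ⟨h5 ⟨x, mem_inter.2 ⟨hx, by simp [hx']⟩⟩ (by simp), ha⟩⟩
      have h7 : t ∩ β w = β w := by
        refine (h1 w).2.2 _ inter_subset_right h6 fun x hx y hy hxy => ?_
        refine mem_inter.2 ⟨?_, hy⟩
        have hxt := (mem_inter.1 hx).1
        rcases hxy with ⟨hne, hxy | ⟨rfl, r, hr, hxy⟩ | ⟨rfl, r, hr, hxy⟩⟩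
        · exact hcl x hxt y (by simp [hy]) hxy
        · have := h5 ⟨x, mem_inter.2 ⟨hxt, by simp⟩⟩
          exact hcl r (this (by simp [hr])) y (by simp [hy]) hxy
        · have hrt := hcl x hxt r (by simp [hr]) hxy
          exact h5 ⟨r, mem_inter.2 ⟨hrt, by simp [hr]⟩⟩ (by simp)
      have h8 : β w ⊆ t := by rw [← h7]; exact inter_subset_left
      have h9 := h5 ⟨a, mem_inter.2 ⟨h8 ha, by simp⟩⟩
      exact subset_antisymm ht (union_subset h8 ((subset_insert _ _).trans h9))
    · simp only [γ, ha, if_false]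
      refine ⟨(h1 w).2.1, fun t ht hne hcl => (h1 w).2.2 t ht hne fun x hx y hy hxy => ?_⟩
      rcases hxy with ⟨_, hxy | ⟨rfl, _⟩ | ⟨rfl, _⟩⟩
      · exact hcl x hx y hy hxy
      · exact absurd (ht hx) ha
      · exact absurd hy ha
  · intro w w' hw
    have := h2 w w' hw
    by_cases ha : a ∈ β w <;> by_cases ha' : a ∈ β w'
    · exact absurd ha' (Finset.disjoint_left.1 this ha)
    · simp only [γ, ha, ha', if_true, if_false]
      exact disjoint_union_left.2 ⟨this, (hβR w').symm⟩
    · simp only [γ, ha, ha', if_true, if_false]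
      exact disjoint_union_right.2 ⟨this, hβR w⟩
    · simpa only [γ, ha, ha', if_false]
  · intro w w' hw
    obtain ⟨x, hx, y, hy, hxy⟩ := h3 w w' hw
    rcases hxy with ⟨_, hxy | ⟨rfl, r, hr, hxy⟩ | ⟨rfl, r, hr, hxy⟩⟩
    · exact ⟨x, hβγ w hx, y, hβγ w' hy, hxy⟩
    · exact ⟨r, by simp [γ, hx, hr], y, hβγ w' hy, hxy⟩
    · exact ⟨x, hβγ w hx, r, by simp [γ, hy, hr], hxy⟩

end PlanarP5

namespace PlanarP5

open scoped Classical
open Finset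

variable {V : Type*} {G : SimpleGraph V} {S : Finset V}

/-- The subgraph of `G` induced on `S` has no induced path on five vertices. -/
def NoP5 (G : SimpleGraph V) (S : Finset V) : Prop :=
  ∀ x₀ ∈ S, ∀ x₁ ∈ S, ∀ x₂ ∈ S, ∀ x₃ ∈ S, ∀ x₄ ∈ S,
    G.Adj x₀ x₁ → G.Adj x₁ x₂ → G.Adj x₂ x₃ → G.Adj x₃ x₄ → ¬ G.Adj x₀ x₂ → ¬ G.Adj x₀ x₃ →
    ¬ G.Adj x₀ x₄ → ¬ G.Adj x₁ x₃ → ¬ G.Adj x₁ x₄ → ¬ G.Adj x₂ x₄ → False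

theorem NoP5.bag_end (h : NoP5 G S) {Z : Finset V} (hZ : Z ⊆ S) {x₁ x₂ x₃ x₄ : V}
    (h1 : x₁ ∈ S) (h2 : x₂ ∈ S) (h3 : x₃ ∈ S) (h4 : x₄ ∈ S)
    (e01 : ∃ z ∈ Z, G.Adj z x₁) (e12 : G.Adj x₁ x₂) (e23 : G.Adj x₂ x₃) (e34 : G.Adj x₃ x₄)
    (n02 : ∀ z ∈ Z, ¬ G.Adj z x₂) (n03 : ∀ z ∈ Z, ¬ G.Adj z x₃) (n04 : ∀ z ∈ Z, ¬ G.Adj z x₄)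
    (n13 : ¬ G.Adj x₁ x₃) (n14 : ¬ G.Adj x₁ x₄) (n24 : ¬ G.Adj x₂ x₄) : False := by
  obtain ⟨z, hz, hz1⟩ := e01
  exact h z (hZ hz) x₁ h1 x₂ h2 x₃ h3 x₄ h4 hz1 e12 e23 e34 (n02 z hz) (n03 z hz) (n04 z hz)
    n13 n14 n24

theorem NoP5.bag_second (h : NoP5 G S) {Z : Finset V} (hZ : Z ⊆ S) (hc : Cn G Z)
    {x₀ x₂ x₃ x₄ : V} (h0 : x₀ ∈ S) (h2 : x₂ ∈ S) (h3 : x₃ ∈ S) (h4 : x₄ ∈ S)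
    (e01 : ∃ z ∈ Z, G.Adj z x₀) (e12 : ∃ z ∈ Z, G.Adj z x₂) (e23 : G.Adj x₂ x₃)
    (e34 : G.Adj x₃ x₄) (n02 : ¬ G.Adj x₀ x₂) (n03 : ¬ G.Adj x₀ x₃) (n04 : ¬ G.Adj x₀ x₄)
    (n13 : ∀ z ∈ Z, ¬ G.Adj z x₃) (n14 : ∀ z ∈ Z, ¬ G.Adj z x₄) (n24 : ¬ G.Adj x₂ x₄) :
    False := by
  obtain ⟨z, hz, hz0⟩ := e01
  obtain ⟨w, hw, hw2⟩ := e12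
  by_cases hz2 : G.Adj z x₂
  · exact h x₀ h0 z (hZ hz) x₂ h2 x₃ h3 x₄ h4 hz0.symm hz2 e23 e34 n02 n03 n04 (n13 z hz)
      (n14 z hz) n24
  · obtain ⟨b, hb, b', hb', hb't, hbb'⟩ := hc.exists_adj (filter_subset (G.Adj · x₂) Z)
      ⟨w, by simp [hw, hw2]⟩ (fun hh => hz2 (by rw [← hh] at hz; exact (mem_filter.1 hz).2))
    obtain ⟨hb, hb2⟩ := mem_filter.1 hb
    have hb'2 : ¬ G.Adj b' x₂ := fun hh => hb't (mem_filter.2 ⟨hb', hh⟩)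
    exact h b' (hZ hb') b (hZ hb) x₂ h2 x₃ h3 x₄ h4 hbb'.symm hb2 e23 e34 hb'2 (n13 _ hb')
      (n14 _ hb') (n13 _ hb) (n14 _ hb) n24

theorem NoP5.bag_middle (h : NoP5 G S) {Z : Finset V} (hZ : Z ⊆ S) (hc : Cn G Z)
    {x₀ x₁ x₃ x₄ : V} (h0 : x₀ ∈ S) (h1 : x₁ ∈ S) (h3 : x₃ ∈ S) (h4 : x₄ ∈ S)
    (e01 : G.Adj x₀ x₁) (e12 : ∃ z ∈ Z, G.Adj z x₁) (e23 : ∃ z ∈ Z, G.Adj z x₃)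
    (e34 : G.Adj x₃ x₄) (n02 : ∀ z ∈ Z, ¬ G.Adj z x₀) (n03 : ¬ G.Adj x₀ x₃)
    (n04 : ¬ G.Adj x₀ x₄) (n13 : ¬ G.Adj x₁ x₃) (n14 : ¬ G.Adj x₁ x₄)
    (n24 : ∀ z ∈ Z, ¬ G.Adj z x₄) : False := by
  obtain ⟨z, hz, hz1⟩ := e12
  obtain ⟨w, hw, hw3⟩ := e23
  have hA : ∀ z ∈ Z, G.Adj z x₁ → ¬ G.Adj z x₃ := fun z hz hz1 hz3 =>
    h x₀ h0 x₁ h1 z (hZ hz) x₃ h3 x₄ h4 e01 hz1.symm hz3 e34 (fun hh => n02 z hz hh.symm) n03 n04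
      n13 n14 (n24 z hz)
  have hAB : ∀ b ∈ Z, ∀ c ∈ Z, G.Adj b x₃ → G.Adj c x₁ → ¬ G.Adj b c :=
    fun b hb c hc' hb3 hc1 hbc => h x₄ h4 x₃ h3 b (hZ hb) c (hZ hc') x₁ h1 e34.symm hb3.symm hbc hc1
      (fun hh => n24 b hb hh.symm) (fun hh => n24 c hc' hh.symm) (fun hh => n14 hh.symm)
      (fun hh => hA c hc' hc1 hh.symm) (fun hh => n13 hh.symm) (fun hh => hA b hb hh hb3)
  obtain ⟨c, hct, d, hd, hdt, hcd⟩ := hc.exists_adj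
    (filter_subset (fun u => G.Adj u x₃ ∨ ∃ b ∈ Z, G.Adj b x₃ ∧ G.Adj b u) Z)
    ⟨w, by simp [hw, hw3]⟩ (fun hh => by
      rw [← hh] at hz
      obtain ⟨hz, h3 | ⟨b, hb, hb3, hbz⟩⟩ := mem_filter.1 hz
      · exact hA z hz hz1 h3
      · exact hAB b hb z hz hb3 hz1 hbz)
  obtain ⟨hc', hc3⟩ := mem_filter.1 hct
  have hd1 : ¬ G.Adj d x₃ := fun hh => hdt (mem_filter.2 ⟨hd, Or.inl hh⟩)
  have hd2 : ∀ b ∈ Z, G.Adj b x₃ → ¬ G.Adj b d := fun b hb hb3 hh =>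
    hdt (mem_filter.2 ⟨hd, Or.inr ⟨b, hb, hb3, hh⟩⟩)
  by_cases hcx : G.Adj c x₃
  · exact hd2 c hc' hcx hcd
  obtain ⟨b, hb, hb3, hbc⟩ := hc3.resolve_left hcx
  exact h x₄ h4 x₃ h3 b (hZ hb) c (hZ hc') d (hZ hd) e34.symm hb3.symm hbc hcd
    (fun hh => n24 b hb hh.symm) (fun hh => n24 c hc' hh.symm) (fun hh => n24 d hd hh.symm)
    (fun hh => hcx hh.symm) (fun hh => hd1 hh.symm) (hd2 b hb hb3)

theorem NoP5.mono {S' : Finset V} (h : NoP5 G S) (hS : S' ⊆ S) : NoP5 G S' :=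
  fun _ h0 _ h1 _ h2 _ h3 _ h4 => h _ (hS h0) _ (hS h1) _ (hS h2) _ (hS h3) _ (hS h4)

theorem con_adj_of_ne {a x y : V} {R : Finset V} (hx : x ≠ a) (hy : y ≠ a) :
    (con G a R).Adj x y ↔ G.Adj x y := by
  constructor
  · rintro ⟨_, h | ⟨h, _⟩ | ⟨h, _⟩⟩
    exacts [h, absurd h hx, absurd h hy]
  · exact fun h => ⟨h.ne, Or.inl h⟩

theorem con_adj_left {a y : V} {R : Finset V} (hy : y ≠ a) :
    (con G a R).Adj a y ↔ ∃ z ∈ insert a R, G.Adj z y := by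
  constructor
  · rintro ⟨_, h | ⟨_, r, hr, h⟩ | ⟨h, _⟩⟩
    exacts [⟨a, by simp, h⟩, ⟨r, by simp [hr], h⟩, absurd h hy]
  · rintro ⟨z, hz, h⟩
    rcases mem_insert.1 hz with rfl | hz
    exacts [⟨hy.symm, Or.inl h⟩, ⟨hy.symm, Or.inr (Or.inl ⟨rfl, z, hz, h⟩)⟩]

theorem NoP5.con {a : V} {R : Finset V} (h : NoP5 G S) (haS : a ∈ S) (hR : R ⊆ S)
    (hc : Cn G (insert a R)) : NoP5 (con G a R) (S \ R) := by
  have hZ : insert a R ⊆ S := insert_subset haS hR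
  have h' : NoP5 G (S \ R) := h.mono sdiff_subset
  intro x₀ h0 x₁ h1 x₂ h2 x₃ h3 x₄ h4 e01 e12 e23 e34 n02 n03 n04 n13 n14 n24
  have d01 := e01.ne
  have d12 := e12.ne
  have d23 := e23.ne
  have d34 := e34.ne
  have d02 : x₀ ≠ x₂ := by rintro rfl; exact n03 e23
  have d03 : x₀ ≠ x₃ := by rintro rfl; exact n04 e34
  have d04 : x₀ ≠ x₄ := by rintro rfl; exact n03 e34.symm
  have d13 : x₁ ≠ x₃ := by rintro rfl; exact n14 e34
  have d14 : x₁ ≠ x₄ := by rintro rfl; exact n04 e01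
  have d24 : x₂ ≠ x₄ := by rintro rfl; exact n14 e12
  have s0 := (mem_sdiff.1 h0).1
  have s1 := (mem_sdiff.1 h1).1
  have s2 := (mem_sdiff.1 h2).1
  have s3 := (mem_sdiff.1 h3).1
  have s4 := (mem_sdiff.1 h4).1
  have push : ∀ {y : V}, y ≠ a → ¬ (PlanarP5.con G a R).Adj a y → ∀ z ∈ insert a R, ¬ G.Adj z y :=
    fun hy hn z hz hh => hn ((con_adj_left hy).2 ⟨z, hz, hh⟩)
  have pos : ∀ {y : V}, y ≠ a → (PlanarP5.con G a R).Adj a y → ∃ z ∈ insert a R, G.Adj z y :=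
    fun hy hn => (con_adj_left hy).1 hn
  have neg : ∀ {x y : V}, ¬ (PlanarP5.con G a R).Adj x y → ¬ G.Adj x y :=
    fun hn hh => hn (le_con G a R hh)
  have old : ∀ {x y : V}, x ≠ a → y ≠ a → (PlanarP5.con G a R).Adj x y → G.Adj x y :=
    fun hx hy hn => (con_adj_of_ne hx hy).1 hn
  by_cases a0 : x₀ = a
  · subst a0
    exact h.bag_end hZ s1 s2 s3 s4 (pos d01.symm e01) (old d01.symm d02.symm e12)
      (old d02.symm d03.symm e23) (old d03.symm d04.symm e34) (push d02.symm n02)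
      (push d03.symm n03) (push d04.symm n04) (neg n13) (neg n14) (neg n24)
  by_cases a4 : x₄ = a
  · subst a4
    exact h.bag_end hZ s3 s2 s1 s0 (pos d34 e34.symm) (old d34 d24 e23.symm)
      (old d24 d14 e12.symm) (old d14 d04 e01.symm) (push d24 fun hh => n24 hh.symm)
      (push d14 fun hh => n14 hh.symm) (push d04 fun hh => n04 hh.symm) (fun hh => neg n13 hh.symm)
      (fun hh => neg n03 hh.symm) (fun hh => neg n02 hh.symm)
  by_cases a1 : x₁ = a
  · subst a1
    exact h.bag_second hZ hc s0 s2 s3 s4 (pos d01 e01.symm) (pos d12.symm e12)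
      (old d12.symm d13.symm e23) (old d13.symm d14.symm e34) (neg n02) (neg n03) (neg n04)
      (push d13.symm n13) (push d14.symm n14) (neg n24)
  by_cases a3 : x₃ = a
  · subst a3
    exact h.bag_second hZ hc s4 s2 s1 s0 (pos d34.symm e34) (pos d23 e23.symm)
      (old d23 d13 e12.symm) (old d13 d03 e01.symm) (fun hh => neg n24 hh.symm)
      (fun hh => neg n14 hh.symm) (fun hh => neg n04 hh.symm) (push d13 fun hh => n13 hh.symm)
      (push d03 fun hh => n03 hh.symm) (fun hh => neg n02 hh.symm)
  by_cases a2 : x₂ = a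
  · subst a2
    exact h.bag_middle hZ hc s0 s1 s3 s4 (old d02 d12 e01) (pos d12 e12.symm) (pos d23.symm e23)
      (old d23.symm d24.symm e34) (push d02 fun hh => n02 hh.symm) (neg n03) (neg n04) (neg n13)
      (neg n14) (push d24.symm n24)
  exact h' _ h0 _ h1 _ h2 _ h3 _ h4 (old a0 a1 e01) (old a1 a2 e12) (old a2 a3 e23) (old a3 a4 e34)
    (neg n02) (neg n03) (neg n04) (neg n13) (neg n14) (neg n24)

/-- The subgraph of `G` induced on `S` has neither a `K₅` minor nor a `K₃,₃` minor. -/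
structure Pl (G : SimpleGraph V) (S : Finset V) : Prop where
  k5 : ¬ Model (completeGraph (Fin 5)) G S
  k33 : ¬ Model (completeBipartiteGraph (Fin 3) (Fin 3)) G S

theorem Pl.mono {G' : SimpleGraph V} {S' : Finset V} (h : Pl G S) (hG : G' ≤ G) (hS : S' ⊆ S) :
    Pl G' S' := ⟨fun hh => h.k5 (hh.mono hG hS), fun hh => h.k33 (hh.mono hG hS)⟩

theorem Pl.con {a : V} {R : Finset V} (h : Pl G S) (hR : R ⊆ S) (ha : a ∉ R)
    (hc : Cn G (insert a R)) : Pl (con G a R) (S \ R) :=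
  ⟨fun hh => h.k5 (hh.of_con hR ha hc), fun hh => h.k33 (hh.of_con hR ha hc)⟩

theorem Pl.no_k5 (h : Pl G S) (A₁ A₂ A₃ A₄ A₅ : Finset V)
    (s : A₁ ⊆ S ∧ A₂ ⊆ S ∧ A₃ ⊆ S ∧ A₄ ⊆ S ∧ A₅ ⊆ S)
    (c : Cn G A₁ ∧ Cn G A₂ ∧ Cn G A₃ ∧ Cn G A₄ ∧ Cn G A₅)
    (d : Disjoint A₁ A₂ ∧ Disjoint A₁ A₃ ∧ Disjoint A₁ A₄ ∧ Disjoint A₁ A₅ ∧ Disjoint A₂ A₃ ∧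
      Disjoint A₂ A₄ ∧ Disjoint A₂ A₅ ∧ Disjoint A₃ A₄ ∧ Disjoint A₃ A₅ ∧ Disjoint A₄ A₅)
    (t : Tc G A₁ A₂ ∧ Tc G A₁ A₃ ∧ Tc G A₁ A₄ ∧ Tc G A₁ A₅ ∧ Tc G A₂ A₃ ∧
      Tc G A₂ A₄ ∧ Tc G A₂ A₅ ∧ Tc G A₃ A₄ ∧ Tc G A₃ A₅ ∧ Tc G A₄ A₅) : False := by
  obtain ⟨s1, s2, s3, s4, s5⟩ := s
  obtain ⟨c1, c2, c3, c4, c5⟩ := c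
  obtain ⟨d12, d13, d14, d15, d23, d24, d25, d34, d35, d45⟩ := d
  obtain ⟨t12, t13, t14, t15, t23, t24, t25, t34, t35, t45⟩ := t
  refine h.k5 ⟨![A₁, A₂, A₃, A₄, A₅], fun w => ?_, fun w w' hw => ?_, fun w w' hw => ?_⟩
  · fin_cases w <;> exact ⟨by assumption, by assumption⟩
  · fin_cases w <;> fin_cases w' <;>
      first | exact absurd rfl hw | assumption | (apply Disjoint.symm; assumption)
  · fin_cases w <;> fin_cases w' <;>
      first | exact absurd rfl hw.ne | assumption | (apply Tc.symm; assumption)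

theorem model_k33 (A₁ A₂ A₃ B₁ B₂ B₃ : Finset V)
    (s : A₁ ⊆ S ∧ A₂ ⊆ S ∧ A₃ ⊆ S ∧ B₁ ⊆ S ∧ B₂ ⊆ S ∧ B₃ ⊆ S)
    (c : Cn G A₁ ∧ Cn G A₂ ∧ Cn G A₃ ∧ Cn G B₁ ∧ Cn G B₂ ∧ Cn G B₃)
    (da : Disjoint A₁ A₂ ∧ Disjoint A₁ A₃ ∧ Disjoint A₂ A₃)
    (db : Disjoint B₁ B₂ ∧ Disjoint B₁ B₃ ∧ Disjoint B₂ B₃)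
    (d : Disjoint A₁ B₁ ∧ Disjoint A₁ B₂ ∧ Disjoint A₁ B₃ ∧ Disjoint A₂ B₁ ∧ Disjoint A₂ B₂ ∧
      Disjoint A₂ B₃ ∧ Disjoint A₃ B₁ ∧ Disjoint A₃ B₂ ∧ Disjoint A₃ B₃)
    (t : Tc G A₁ B₁ ∧ Tc G A₁ B₂ ∧ Tc G A₁ B₃ ∧ Tc G A₂ B₁ ∧ Tc G A₂ B₂ ∧
      Tc G A₂ B₃ ∧ Tc G A₃ B₁ ∧ Tc G A₃ B₂ ∧ Tc G A₃ B₃) :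
    Model (completeBipartiteGraph (Fin 3) (Fin 3)) G S := by
  obtain ⟨s1, s2, s3, s4, s5, s6⟩ := s
  obtain ⟨c1, c2, c3, c4, c5, c6⟩ := c
  obtain ⟨d12, d13, d23⟩ := da
  obtain ⟨e12, e13, e23⟩ := db
  obtain ⟨f11, f12, f13, f21, f22, f23, f31, f32, f33⟩ := d
  obtain ⟨t11, t12, t13, t21, t22, t23, t31, t32, t33⟩ := t
  refine ⟨Sum.elim ![A₁, A₂, A₃] ![B₁, B₂, B₃], fun w => ?_, fun w w' hw => ?_,
    fun w w' hw => ?_⟩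
  · rcases w with w | w <;> fin_cases w <;> exact ⟨by assumption, by assumption⟩
  · rcases w with w | w <;> rcases w' with w' | w' <;> fin_cases w <;> fin_cases w' <;>
      first | exact absurd rfl hw | assumption | (apply Disjoint.symm; assumption)
  · rcases w with w | w <;> rcases w' with w' | w'
    · simp [completeBipartiteGraph] at hw
    · fin_cases w <;> fin_cases w' <;> assumption
    · fin_cases w <;> fin_cases w' <;> (apply Tc.symm; assumption)
    · simp [completeBipartiteGraph] at hw

theorem Pl.no_k33 (h : Pl G S) (A₁ A₂ A₃ B₁ B₂ B₃ : Finset V)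
    (s : A₁ ⊆ S ∧ A₂ ⊆ S ∧ A₃ ⊆ S ∧ B₁ ⊆ S ∧ B₂ ⊆ S ∧ B₃ ⊆ S)
    (c : Cn G A₁ ∧ Cn G A₂ ∧ Cn G A₃ ∧ Cn G B₁ ∧ Cn G B₂ ∧ Cn G B₃)
    (da : Disjoint A₁ A₂ ∧ Disjoint A₁ A₃ ∧ Disjoint A₂ A₃)
    (db : Disjoint B₁ B₂ ∧ Disjoint B₁ B₃ ∧ Disjoint B₂ B₃)
    (d : Disjoint A₁ B₁ ∧ Disjoint A₁ B₂ ∧ Disjoint A₁ B₃ ∧ Disjoint A₂ B₁ ∧ Disjoint A₂ B₂ ∧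
      Disjoint A₂ B₃ ∧ Disjoint A₃ B₁ ∧ Disjoint A₃ B₂ ∧ Disjoint A₃ B₃)
    (t : Tc G A₁ B₁ ∧ Tc G A₁ B₂ ∧ Tc G A₁ B₃ ∧ Tc G A₂ B₁ ∧ Tc G A₂ B₂ ∧
      Tc G A₂ B₃ ∧ Tc G A₃ B₁ ∧ Tc G A₃ B₂ ∧ Tc G A₃ B₃) : False :=
  h.k33 (model_k33 A₁ A₂ A₃ B₁ B₂ B₃ s c da db d t)

theorem Pl.no_k33_vertices (h : Pl G S) {a₁ a₂ a₃ b₁ b₂ b₃ : V}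
    (s : a₁ ∈ S ∧ a₂ ∈ S ∧ a₃ ∈ S ∧ b₁ ∈ S ∧ b₂ ∈ S ∧ b₃ ∈ S)
    (da : a₁ ≠ a₂ ∧ a₁ ≠ a₃ ∧ a₂ ≠ a₃) (db : b₁ ≠ b₂ ∧ b₁ ≠ b₃ ∧ b₂ ≠ b₃)
    (t : G.Adj a₁ b₁ ∧ G.Adj a₁ b₂ ∧ G.Adj a₁ b₃ ∧ G.Adj a₂ b₁ ∧ G.Adj a₂ b₂ ∧
      G.Adj a₂ b₃ ∧ G.Adj a₃ b₁ ∧ G.Adj a₃ b₂ ∧ G.Adj a₃ b₃) : False := by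
  obtain ⟨t11, t12, t13, t21, t22, t23, t31, t32, t33⟩ := t
  refine h.no_k33 {a₁} {a₂} {a₃} {b₁} {b₂} {b₃} (by simpa using s)
    (by simp [cn_singleton]) (by simpa [eq_comm] using da) (by simpa [eq_comm] using db) ?_ ?_
  · simp only [Finset.disjoint_singleton]
    exact ⟨t11.ne, t12.ne, t13.ne, t21.ne, t22.ne, t23.ne, t31.ne, t32.ne, t33.ne⟩
  · simp [Tc, *]

end PlanarP5

namespace PlanarP5

open scoped Classical
open Finset

variable {V : Type*} {G : SimpleGraph V} {S X Y Z : Finset V}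

/-- The neighbours of `a` inside `S`. -/
noncomputable def nb (G : SimpleGraph V) (S : Finset V) (a : V) : Finset V := S.filter (G.Adj a)

/-- The number of edges between `X` and `Y` (counted from the side of `X`). -/
noncomputable def ebt (G : SimpleGraph V) (X Y : Finset V) : ℕ := ∑ x ∈ X, #(nb G Y x)

/-- The number of edges of the subgraph induced on `S`. -/
noncomputable def ecard (G : SimpleGraph V) (S : Finset V) : ℕ := ebt G S S / 2

theorem mem_nb {a x : V} : x ∈ nb G S a ↔ x ∈ S ∧ G.Adj a x := mem_filter

theorem nb_subset (a : V) : nb G S a ⊆ S := filter_subset _ _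

theorem nb_mono (h : X ⊆ Y) (a : V) : nb G X a ⊆ nb G Y a := filter_subset_filter _ h

theorem nb_insert_of_adj {a x : V} (h : G.Adj a x) : nb G (insert x S) a = insert x (nb G S a) := by
  simp [nb, filter_insert, h]

theorem nb_insert_of_not_adj {a x : V} (h : ¬ G.Adj a x) : nb G (insert x S) a = nb G S a := by
  simp [nb, filter_insert, h]

theorem ebt_comm (X Y : Finset V) : ebt G X Y = ebt G Y X := by
  unfold ebt nb
  simp only [card_filter]
  rw [sum_comm]
  simp only [G.adj_comm]

theorem ebt_union_left (h : Disjoint X Y) : ebt G (X ∪ Y) Z = ebt G X Z + ebt G Y Z :=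
  sum_union h

theorem ebt_union_right (h : Disjoint X Y) : ebt G Z (X ∪ Y) = ebt G Z X + ebt G Z Y := by
  rw [ebt_comm, ebt_union_left h, ebt_comm X, ebt_comm Y]

theorem ebt_singleton_left (a : V) : ebt G {a} Y = #(nb G Y a) := by simp [ebt]

theorem ebt_singleton_right (a : V) : ebt G Y {a} = #(nb G Y a) := by
  rw [ebt_comm, ebt_singleton_left]

theorem ebt_insert_left {a : V} (h : a ∉ X) : ebt G (insert a X) Y = #(nb G Y a) + ebt G X Y :=
  sum_insert h

theorem ebt_insert_right {a : V} (h : a ∉ X) : ebt G Y (insert a X) = #(nb G Y a) + ebt G Y X := by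
  rw [ebt_comm, ebt_insert_left h, ebt_comm X]

theorem ebt_eq_zero (h : ∀ x ∈ X, ∀ y ∈ Y, ¬ G.Adj x y) : ebt G X Y = 0 := by
  refine sum_eq_zero fun x hx => ?_
  simp only [nb, card_eq_zero, filter_eq_empty_iff]
  exact fun y hy => h x hx y hy

theorem two_mul_ecard (G : SimpleGraph V) (S : Finset V) : 2 * ecard G S = ebt G S S := by
  suffices h : 2 ∣ ebt G S S from Nat.mul_div_cancel' h
  induction S using Finset.induction_on with
  | empty => simp [ebt]
  | insert a S ha ih =>
    rw [ebt_insert_left ha, ebt_insert_right ha, nb_insert_of_not_adj (by simp)]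
    omega

theorem sum_card_nb (G : SimpleGraph V) (S : Finset V) : ∑ x ∈ S, #(nb G S x) = 2 * ecard G S :=
  (two_mul_ecard G S).symm

theorem ecard_union (h : Disjoint X Y) : ecard G (X ∪ Y) = ecard G X + ecard G Y + ebt G X Y := by
  have h1 := two_mul_ecard G (X ∪ Y)
  rw [ebt_union_left h, ebt_union_right h, ebt_union_right h, ebt_comm Y X, ← two_mul_ecard,
    ← two_mul_ecard] at h1
  omega

theorem ecard_singleton (a : V) : ecard G {a} = 0 := by
  have := two_mul_ecard G {a}
  rw [ebt_eq_zero (by simp)] at this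
  omega

theorem ecard_insert {a : V} (h : a ∉ S) : ecard G (insert a S) = ecard G S + #(nb G S a) := by
  rw [insert_eq, ecard_union (by simpa using h), ecard_singleton, ebt_singleton_left]
  omega

theorem ecard_sdiff (h : X ⊆ S) : ecard G S = ecard G X + ecard G (S \ X) + ebt G X (S \ X) := by
  conv_lhs => rw [← union_sdiff_of_subset h]
  exact ecard_union disjoint_sdiff

theorem ecard_erase {a : V} (h : a ∈ S) : ecard G S = ecard G (S.erase a) + #(nb G S a) := by
  conv_lhs => rw [← insert_erase h]
  rw [ecard_insert (by simp)]
  conv_rhs => rw [← insert_erase h, nb_insert_of_not_adj (by simp)]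
  simp

theorem nb_congr {G' : SimpleGraph V} {a : V} (h : ∀ y ∈ S, G.Adj a y ↔ G'.Adj a y) :
    nb G S a = nb G' S a := filter_congr h

theorem ecard_congr {G' : SimpleGraph V} (h : ∀ x ∈ S, ∀ y ∈ S, G.Adj x y ↔ G'.Adj x y) :
    ecard G S = ecard G' S := by
  unfold ecard ebt
  rw [sum_congr rfl fun x hx => by rw [nb_congr (h x hx)]]

theorem ecard_le_of_le {G' : SimpleGraph V} (h : ∀ x ∈ S, ∀ y ∈ S, G.Adj x y → G'.Adj x y) :
    ecard G S ≤ ecard G' S := by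
  refine Nat.div_le_div_right (sum_le_sum fun x hx => card_le_card fun y hy => ?_)
  have := mem_nb.1 hy
  exact mem_nb.2 ⟨this.1, h x hx y this.1 this.2⟩

theorem two_mul_ecard_le (G : SimpleGraph V) (S : Finset V) : 2 * ecard G S ≤ #S * (#S - 1) := by
  rw [two_mul_ecard]
  refine (sum_le_card_nsmul _ _ (#S - 1) fun x hx => ?_).trans (by simp)
  rw [← card_erase_of_mem hx]
  exact card_le_card fun y hy => mem_erase.2 ⟨(mem_nb.1 hy).2.ne', (mem_nb.1 hy).1⟩

theorem nb_con {a : V} {R : Finset V} (haS : a ∉ S) :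
    nb (con G a R) S a = S.filter (fun y => ∃ z ∈ insert a R, G.Adj z y) :=
  filter_congr fun y hy => con_adj_left (by rintro rfl; exact haS hy)

theorem ecard_con {a : V} {R : Finset V} (haS : a ∉ S) :
    ecard (con G a R) (insert a S) =
      ecard G S + #(S.filter (fun y => ∃ z ∈ insert a R, G.Adj z y)) := by
  rw [ecard_insert haS, nb_con haS]
  congr 1
  exact ecard_congr fun x hx y hy => con_adj_of_ne (by rintro rfl; exact haS hx)
    (by rintro rfl; exact haS hy)

/-- Common neighbours of `a` and `b` inside `S`. -/
noncomputable def cnb (G : SimpleGraph V) (S : Finset V) (a b : V) : Finset V :=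
  nb G S a ∩ nb G S b

theorem mem_cnb {a b x : V} : x ∈ cnb G S a b ↔ x ∈ S ∧ G.Adj a x ∧ G.Adj b x := by
  simp only [cnb, mem_inter, mem_nb]; tauto

theorem cnb_comm (a b : V) : cnb G S a b = cnb G S b a := inter_comm _ _

theorem ecard_con_edge {a b : V} (ha : a ∈ S) (hb : b ∈ S) (hab : G.Adj a b) :
    ecard (con G a {b}) (S \ {b}) + 1 + #(cnb G S a b) = ecard G S := by
  obtain ⟨T, haT, hbT, rfl⟩ : ∃ T, a ∉ T ∧ b ∉ T ∧ S = insert b (insert a T) :=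
    ⟨(S.erase b).erase a, by simp, by simp, by
      rw [insert_erase (mem_erase.2 ⟨hab.ne, ha⟩), insert_erase hb]⟩
  have h1 : insert b (insert a T) \ {b} = insert a T := by
    ext x
    simp only [mem_sdiff, mem_insert, mem_singleton]
    constructor
    · tauto
    · rintro (rfl | h)
      · exact ⟨by tauto, hab.ne⟩
      · exact ⟨by tauto, by rintro rfl; exact hbT h⟩
  have h2 : T.filter (fun y => ∃ z ∈ insert a ({b} : Finset V), G.Adj z y) =
      nb G T a ∪ nb G T b := by
    ext x; simp [mem_nb]; tauto
  have h3 : cnb G (insert b (insert a T)) a b = nb G T a ∩ nb G T b := by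
    ext x
    simp only [mem_cnb, mem_insert, mem_inter, mem_nb]
    constructor
    · rintro ⟨rfl | rfl | h, h1, h2⟩
      · exact absurd h2 (G.irrefl)
      · exact absurd h1 (G.irrefl)
      · tauto
    · tauto
  rw [h1, ecard_con haT, h2, h3, ecard_insert (by simp [hab.ne', hbT]), ecard_insert haT,
    nb_insert_of_adj hab.symm, card_insert_of_notMem (fun h => haT (nb_subset _ h))]
  have := card_union_add_card_inter (nb G T a) (nb G T b)
  omega

theorem card_common_nb_con {a b : V} (ha : a ∈ S) (hb : b ∈ S) : #(S \ {b}) + 1 = #S := by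
  rw [card_sdiff_of_subset (by simpa using hb), card_singleton]
  have := card_pos.2 ⟨a, ha⟩
  omega

theorem ecard_deleteEdge {a b : V} (ha : a ∈ S) (hb : b ∈ S) (hab : G.Adj a b) :
    ecard (G.deleteEdges {s(a, b)}) S + 1 = ecard G S := by
  obtain ⟨T, haT, hbT, rfl⟩ : ∃ T, a ∉ T ∧ b ∉ T ∧ S = insert b (insert a T) :=
    ⟨(S.erase b).erase a, by simp, by simp, by
      rw [insert_erase (mem_erase.2 ⟨hab.ne, ha⟩), insert_erase hb]⟩
  have hbT' : b ∉ insert a T := by simp [hab.ne', hbT]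
  have hadj : ∀ x, ∀ y ∈ T, (G.deleteEdges {s(a, b)}).Adj x y ↔ G.Adj x y := by
    intro x y hy
    have h1 : y ≠ a := by rintro rfl; exact haT hy
    have h2 : y ≠ b := by rintro rfl; exact hbT hy
    simp [SimpleGraph.deleteEdges_adj, h1, h2]
  rw [ecard_insert hbT', ecard_insert haT, ecard_insert hbT', ecard_insert haT,
    nb_insert_of_adj hab.symm, nb_insert_of_not_adj (by simp),
    card_insert_of_notMem (fun h => haT (nb_subset _ h)), nb_congr (hadj b), nb_congr (hadj a),
    ecard_congr fun x _ => hadj x]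
  omega

end PlanarP5

namespace PlanarP5

open scoped Classical
open Finset

variable {V : Type*} {G : SimpleGraph V} {S : Finset V}

theorem exists_le_ecard_eq {k : ℕ} (h : k ≤ ecard G S) : ∃ G' ≤ G, ecard G' S = k := by
  obtain ⟨d, hd⟩ := Nat.exists_eq_add_of_le h
  induction d generalizing G with
  | zero => exact ⟨G, le_rfl, hd⟩
  | succ d ih =>
    have h1 := two_mul_ecard G S
    obtain ⟨x, hx, hx'⟩ := exists_ne_zero_of_sum_ne_zero (show ebt G S S ≠ 0 by omega)
    obtain ⟨y, hy⟩ := card_pos.1 (Nat.pos_of_ne_zero hx')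
    have h2 := ecard_deleteEdge hx (mem_nb.1 hy).1 (mem_nb.1 hy).2
    obtain ⟨G', h3, h4⟩ := @ih (G.deleteEdges {s(x, y)}) (by omega) (by omega)
    exact ⟨G', h3.trans (SimpleGraph.deleteEdges_le _), h4⟩

theorem Pl.no_k5_vertices (h : Pl G S) {a b c d f : V}
    (s : a ∈ S ∧ b ∈ S ∧ c ∈ S ∧ d ∈ S ∧ f ∈ S)
    (t : G.Adj a b ∧ G.Adj a c ∧ G.Adj a d ∧ G.Adj a f ∧ G.Adj b c ∧ G.Adj b d ∧ G.Adj b f ∧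
      G.Adj c d ∧ G.Adj c f ∧ G.Adj d f) : False := by
  obtain ⟨t12, t13, t14, t15, t23, t24, t25, t34, t35, t45⟩ := t
  refine h.no_k5 {a} {b} {c} {d} {f} (by simpa using s) (by simp [cn_singleton]) ?_
    (by simp [Tc, *])
  simp only [Finset.disjoint_singleton]
  exact ⟨t12.ne, t13.ne, t14.ne, t15.ne, t23.ne, t24.ne, t25.ne, t34.ne, t35.ne, t45.ne⟩

theorem Pl.no_k4_nb (h : Pl G S) {v : V} (hv : v ∈ S) {N : Finset V} (hN : N ⊆ nb G S v)
    (hc : 4 ≤ #N) : ∃ a ∈ N, ∃ b ∈ N, a ≠ b ∧ ¬ G.Adj a b := by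
  by_contra! hall
  obtain ⟨T, hTN, hT⟩ := exists_subset_card_eq hc
  obtain ⟨a, T', ha, rfl, hT'⟩ := card_eq_succ.1 hT
  obtain ⟨b, c, d, hbc, hbd, hcd, rfl⟩ := card_eq_three.1 hT'
  simp only [mem_insert, mem_singleton, not_or] at ha
  have haN := hTN (show a ∈ _ by simp)
  have hbN := hTN (show b ∈ _ by simp)
  have hcN := hTN (show c ∈ _ by simp)
  have hdN := hTN (show d ∈ _ by simp)
  have ha' := mem_nb.1 (hN haN)
  have hb' := mem_nb.1 (hN hbN)
  have hc' := mem_nb.1 (hN hcN)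
  have hd' := mem_nb.1 (hN hdN)
  exact h.no_k5_vertices ⟨hv, ha'.1, hb'.1, hc'.1, hd'.1⟩
    ⟨ha'.2, hb'.2, hc'.2, hd'.2, hall _ haN _ hbN ha.1, hall _ haN _ hcN ha.2.1,
      hall _ haN _ hdN ha.2.2, hall _ hbN _ hcN hbc, hall _ hbN _ hdN hbd, hall _ hcN _ hdN hcd⟩

theorem Pl.exists_card_cnb_le_two (h : Pl G S) {v : V} (hv : v ∈ S) (h0 : (nb G S v).Nonempty)
    (h5 : #(nb G S v) ≤ 5) : ∃ u ∈ nb G S v, #(cnb G S v u) ≤ 2 := by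
  by_contra! hall
  set N := nb G S v with hN
  have hcn : ∀ u ∈ N, cnb G S v u = nb G N u := fun u hu => by
    ext x; simp only [mem_cnb, mem_nb, hN]; tauto
  have hdeg : ∀ u ∈ N, 3 ≤ #(nb G N u) := fun u hu => by rw [← hcn u hu]; exact hall u hu
  have hsub : ∀ u ∈ N, ∀ w ∈ N, u ≠ w → ¬ G.Adj u w → nb G N u ⊆ (N.erase u).erase w := by
    intro u _ w _ _ huw x hx
    have := mem_nb.1 hx
    exact mem_erase.2 ⟨by rintro rfl; exact huw this.2, mem_erase.2 ⟨this.2.ne', this.1⟩⟩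
  have hcard : ∀ u ∈ N, ∀ w ∈ N, u ≠ w → #((N.erase u).erase w) = #N - 2 := by
    intro u hu w hw huw
    rw [card_erase_of_mem (mem_erase.2 ⟨huw.symm, hw⟩), card_erase_of_mem hu]
    omega
  obtain ⟨u₀, hu₀⟩ := h0
  have h4 : 4 ≤ #N := by
    have : nb G N u₀ ⊆ N.erase u₀ := fun x hx =>
      mem_erase.2 ⟨(mem_nb.1 hx).2.ne', (mem_nb.1 hx).1⟩
    have := card_le_card this
    rw [card_erase_of_mem hu₀] at this
    have := hdeg u₀ hu₀
    omega
  obtain ⟨a, ha, b, hb, hab, hnab⟩ := h.no_k4_nb hv subset_rfl h4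
  have key : ∀ u ∈ N, ∀ w ∈ N, u ≠ w → ¬ G.Adj u w → nb G N u = (N.erase u).erase w := by
    intro u hu w hw huw hn
    refine eq_of_subset_of_card_le (hsub u hu w hw huw hn) ?_
    have := hdeg u hu
    have := hcard u hu w hw huw
    omega
  have hN5 : #((N.erase a).erase b) = 3 := by
    have h1 := hdeg a ha
    rw [key a ha b hb hab hnab] at h1
    have := hcard a ha b hb hab
    omega
  obtain ⟨x, y, z, hxy, hxz, hyz, hxyz⟩ := card_eq_three.1 hN5
  have hAa : ∀ u ∈ ({x, y, z} : Finset V), u ∈ N ∧ G.Adj a u ∧ G.Adj b u := by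
    intro u hu
    rw [← hxyz] at hu
    have h1 := hu
    rw [← key a ha b hb hab hnab] at h1
    rw [erase_right_comm, ← key b hb a ha hab.symm (fun hh => hnab hh.symm)] at hu
    exact ⟨(mem_nb.1 hu).1, (mem_nb.1 h1).2, (mem_nb.1 hu).2⟩
  have fin : ∀ p ∈ ({x, y, z} : Finset V), ∀ q ∈ ({x, y, z} : Finset V),
      ∀ r ∈ ({x, y, z} : Finset V), p ≠ q → p ≠ r → G.Adj q r → False := by
    clear hyz hxz hxy
    generalize ({x, y, z} : Finset V) = M at hAa
    intro x hx y hy z hz hxy hxz hyz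
    obtain ⟨hxN, hax, hbx⟩ := hAa x hx
    obtain ⟨hyN, hay, hby⟩ := hAa y hy
    obtain ⟨hzN, haz, hbz⟩ := hAa z hz
    have hvx := mem_nb.1 hxN
    have hvy := mem_nb.1 hyN
    have hvz := mem_nb.1 hzN
    have hva := mem_nb.1 ha
    have hvb := mem_nb.1 hb
    refine h.no_k5 {v} {a, x} {b} {y} {z} ?_ ?_ ?_ ?_
    · simp [insert_subset_iff, *]
    · simp [cn_singleton, cn_pair hax]
    · have e1 := hva.2.ne; have e2 := hvx.2.ne; have e3 := hvb.2.ne; have e4 := hvy.2.ne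
      have e5 := hvz.2.ne; have e6 := hbx.ne; have e7 := hay.ne; have e8 := haz.ne
      have e9 := hby.ne; have e10 := hbz.ne; have e11 := hyz.ne
      simp only [disjoint_singleton_left, disjoint_singleton_right, mem_insert, mem_singleton]
      tauto
    · have := hbx.symm
      refine ⟨?_, ?_, ?_, ?_, ?_, ?_, ?_, ?_, ?_, ?_⟩ <;> simp [Tc, *]
  have hxN := (hAa x (by simp)).1
  by_cases h1 : G.Adj x y
  · exact fin z (by simp) x (by simp) y (by simp) hxz.symm hyz.symm h1
  by_cases h2 : G.Adj x z
  · exact fin y (by simp) x (by simp) z (by simp) hxy.symm hyz h2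
  have h3 := hsub x hxN y (hAa y (by simp)).1 hxy h1
  have h4 := key x hxN z (hAa z (by simp)).1 hxz h2
  have h5 : y ∈ nb G N x := by
    rw [h4]; exact mem_erase.2 ⟨hyz, mem_erase.2 ⟨hxy.symm, (hAa y (by simp)).1⟩⟩
  exact h1 (mem_nb.1 h5).2

/-- The Euler bound. -/
theorem Pl.ecard_le (h : Pl G S) (h3 : 3 ≤ #S) : ecard G S + 6 ≤ 3 * #S := by
  induction hn : #S using Nat.strong_induction_on generalizing G S with
  | _ n ih =>
  subst hn
  rcases Nat.eq_or_lt_of_le h3 with h3' | h4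
  · have := two_mul_ecard_le G S
    rw [← h3'] at this ⊢
    omega
  by_contra hlt
  obtain ⟨G', hG', he⟩ := exists_le_ecard_eq (G := G) (S := S) (k := 3 * #S - 5) (by omega)
  have h' : Pl G' S := h.mono hG' subset_rfl
  have hdeg : ∀ v ∈ S, 4 ≤ #(nb G' S v) := by
    intro v hv
    have h1 := card_erase_of_mem hv
    have h2 := ih _ (by omega) (h'.mono le_rfl (erase_subset v S)) (by omega) rfl
    have h3 := ecard_erase (G := G') hv
    omega
  obtain ⟨v, hv, hv5⟩ : ∃ v ∈ S, #(nb G' S v) ≤ 5 := by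
    by_contra! hall
    have h1 := sum_le_sum (fun v hv => Nat.succ_le_of_lt (hall v hv))
    rw [sum_card_nb] at h1
    simp at h1
    omega
  obtain ⟨u, hu, hu2⟩ := h'.exists_card_cnb_le_two hv
    (card_pos.1 (by have := hdeg v hv; omega)) hv5
  obtain ⟨huS, hvu⟩ := mem_nb.1 hu
  have h1 := ecard_con_edge hv huS hvu
  have h2 := card_common_nb_con hv huS
  have h3 := ih _ (by omega) (h'.con (a := v) (R := {u}) (by simpa using huS)
    (by simpa using hvu.ne) (cn_pair hvu)) (by omega) rfl
  omega

end PlanarP5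

namespace PlanarP5

open scoped Classical
open Finset

variable {V : Type*} {G : SimpleGraph V} {S X Y Z T : Finset V}

/-- The class of graphs under consideration. -/
structure Kl (G : SimpleGraph V) (S : Finset V) : Prop where
  pl : Pl G S
  p5 : NoP5 G S

theorem Kl.mono (h : Kl G S) (hX : X ⊆ S) : Kl G X := ⟨h.pl.mono le_rfl hX, h.p5.mono hX⟩

theorem Kl.con {a : V} {R : Finset V} (h : Kl G S) (ha : a ∈ S) (hR : R ⊆ S) (haR : a ∉ R)
    (hc : Cn G (insert a R)) : Kl (con G a R) (S \ R) :=
  ⟨h.pl.con hR haR hc, h.p5.con ha hR hc⟩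

/-- A counterexample to `4 e ≤ 11 n - 16` with the least number of vertices. -/
structure Ctr (G : SimpleGraph V) (S : Finset V) : Prop where
  kl : Kl G S
  two : 2 ≤ #S
  big : 11 * #S < 4 * ecard G S + 16
  min : ∀ (G' : SimpleGraph V) (T : Finset V), Kl G' T → 2 ≤ #T → #T < #S →
    4 * ecard G' T + 16 ≤ 11 * #T

/-- `X` is a component of `G[S \ T]`. -/
structure Sd (G : SimpleGraph V) (S T X : Finset V) : Prop where
  sub : X ⊆ S \ T
  cn : Cn G X
  closed : ∀ u ∈ X, ∀ v ∈ S \ T, G.Adj u v → v ∈ X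

theorem exists_sd {x : V} (hx : x ∈ S \ T) : ∃ X, Sd G S T X ∧ x ∈ X := by
  obtain ⟨C, h1, h2, h3, h4⟩ := exists_comp G hx
  exact ⟨C, ⟨h1, h3, h4⟩, h2⟩

theorem Sd.subS (h : Sd G S T X) : X ⊆ S := h.sub.trans sdiff_subset

theorem Sd.not_mem (h : Sd G S T X) {x : V} (hx : x ∈ X) : x ∉ T := (mem_sdiff.1 (h.sub hx)).2

theorem Sd.disj (h : Sd G S T X) : Disjoint X T := disjoint_left.2 fun _ hx => h.not_mem hx

theorem Sd.eq_or_disjoint (hX : Sd G S T X) (hY : Sd G S T Y) : X = Y ∨ Disjoint X Y := by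
  by_cases hd : Disjoint X Y
  · exact Or.inr hd
  refine Or.inl ?_
  have hne : (X ∩ Y).Nonempty := by rwa [nonempty_iff_ne_empty, Ne, ← disjoint_iff_inter_eq_empty]
  have h1 := hX.cn.2 (X ∩ Y) inter_subset_left hne fun x hx y hy hxy =>
    mem_inter.2 ⟨hy, hY.closed x (mem_inter.1 hx).2 y (hX.sub hy) hxy⟩
  have h2 := hY.cn.2 (X ∩ Y) inter_subset_right hne fun x hx y hy hxy =>
    mem_inter.2 ⟨hX.closed x (mem_inter.1 hx).1 y (hY.sub hy) hxy, hy⟩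
  exact h1.symm.trans h2

theorem Sd.anti (hX : Sd G S T X) (hY : Y ⊆ S \ T) (hd : Disjoint X Y) :
    ∀ x ∈ X, ∀ y ∈ Y, ¬ G.Adj x y := fun x hx y hy hxy =>
  disjoint_left.1 hd (hX.closed x hx y (hY hy) hxy) hy

/-- `a` is adjacent to every vertex of `X`. -/
def Dm (G : SimpleGraph V) (a : V) (X : Finset V) : Prop := ∀ x ∈ X, G.Adj a x

theorem Dm.nb_eq {a : V} (h : Dm G a X) : nb G X a = X := filter_true_of_mem h

theorem Cn.exists_adj_not_dm {a x : V} (hc : Cn G X) (hx : x ∈ X) (hax : G.Adj a x)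
    (hd : ¬ Dm G a X) : ∃ u ∈ X, ∃ v ∈ X, G.Adj u v ∧ G.Adj a u ∧ ¬ G.Adj a v := by
  obtain ⟨u, hu, v, hv, hv', huv⟩ := hc.exists_adj (nb_subset (G := G) a) ⟨x, mem_nb.2 ⟨hx, hax⟩⟩
    (fun hh => hd fun y hy => by rw [← hh] at hy; exact (mem_nb.1 hy).2)
  exact ⟨u, (mem_nb.1 hu).1, v, hv, huv, (mem_nb.1 hu).2, fun hh => hv' (mem_nb.2 ⟨hv, hh⟩)⟩

theorem NoP5.dm_or_dm (h : NoP5 G S) (hX : X ⊆ S) (hY : Y ⊆ S) (cX : Cn G X) (cY : Cn G Y)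
    (hXY : ∀ x ∈ X, ∀ y ∈ Y, ¬ G.Adj x y) {a : V} (ha : a ∈ S) (haX : ∃ x ∈ X, G.Adj a x)
    (haY : ∃ y ∈ Y, G.Adj a y) : Dm G a X ∨ Dm G a Y := by
  by_contra! hcon
  obtain ⟨x, hx, hax⟩ := haX
  obtain ⟨y, hy, hay⟩ := haY
  obtain ⟨u, hu, u', hu', huu, hau, hau'⟩ := cX.exists_adj_not_dm hx hax hcon.1
  obtain ⟨v, hv, v', hv', hvv, hav, hav'⟩ := cY.exists_adj_not_dm hy hay hcon.2
  exact h u' (hX hu') u (hX hu) a ha v (hY hv) v' (hY hv') huu.symm hau.symm hav hvv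
    (fun hh => hau' hh.symm) (hXY _ hu' _ hv) (hXY _ hu' _ hv') (hXY _ hu _ hv) (hXY _ hu _ hv')
    hav'

theorem NoP5.card_le_four (h : NoP5 G X) (hc : Cn G X) (hdeg : ∀ x ∈ X, #(nb G X x) ≤ 2)
    (he : ecard G X + 1 ≤ #X) : #X ≤ 4 := by
  by_contra! h5
  obtain ⟨x₀, h0, hd0⟩ : ∃ x ∈ X, #(nb G X x) ≤ 1 := by
    by_contra! hall
    have h1 := sum_le_sum (fun v hv => Nat.succ_le_of_lt (hall v hv))
    rw [sum_card_nb] at h1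
    simp at h1
    omega
  have hne : ∀ t : Finset V, #t ≤ 4 → t ≠ X := by rintro t ht rfl; omega
  have two : ∀ {x u v w : V}, x ∈ X → u ∈ X → v ∈ X → w ∈ X → G.Adj x u → G.Adj x v → u ≠ v →
      G.Adj x w → w = u ∨ w = v := by
    intro x u v w hx hu hv hw hxu hxv huv hxw
    by_contra! hww
    have h1 : ({u, v, w} : Finset V) ⊆ nb G X x := by
      simp [insert_subset_iff, mem_nb, *]
    have h2 := card_le_card h1
    rw [card_eq_three.2 ⟨u, v, w, huv, hww.1.symm, hww.2.symm, rfl⟩] at h2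
    have := hdeg x hx
    omega
  obtain ⟨u, hu, x₁, h1, hn1, e01⟩ := hc.exists_adj (t := {x₀}) (by simpa using h0) (by simp)
    (hne _ (by simp))
  obtain rfl := mem_singleton.1 hu
  clear hu
  have one : ∀ w ∈ X, G.Adj u w → w = x₁ := fun w hw huw =>
    card_le_one.1 hd0 w (mem_nb.2 ⟨hw, huw⟩) x₁ (mem_nb.2 ⟨h1, e01⟩)
  obtain ⟨v, hv, x₂, h2, hn2, e12⟩ := hc.exists_adj (t := {u, x₁})
    (by simp [insert_subset_iff, *]) (by simp) (hne _ (card_le_two.trans (by omega)))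
  simp only [mem_insert, mem_singleton, not_or] at hv hn2
  obtain rfl : v = x₁ := by
    rcases hv with rfl | rfl
    · exact absurd (one _ h2 e12) hn2.2
    · rfl
  obtain ⟨w, hw, x₃, h3, hn3, e23⟩ := hc.exists_adj (t := {u, v, x₂})
    (by simp [insert_subset_iff, *]) (by simp) (hne _ (card_le_three.trans (by omega)))
  simp only [mem_insert, mem_singleton, not_or] at hw hn3
  obtain rfl : w = x₂ := by
    rcases hw with rfl | rfl | rfl
    · exact absurd (one _ h3 e23) hn3.2.1
    · rcases two h1 h0 h2 h3 e01.symm e12 (Ne.symm hn2.1) e23 with h | h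
      exacts [absurd h hn3.1, absurd h hn3.2.2]
    · rfl
  obtain ⟨z, hz, x₄, h4, hn4, e34⟩ := hc.exists_adj (t := {u, v, w, x₃})
    (by simp [insert_subset_iff, *]) (by simp) (hne _ Finset.card_le_four)
  simp only [mem_insert, mem_singleton, not_or] at hz hn4
  have n14 : ¬ G.Adj v x₄ := fun hh => by
    rcases two h1 h0 h2 h4 e01.symm e12 (Ne.symm hn2.1) hh with h | h
    exacts [hn4.1 h, hn4.2.2.1 h]
  have n24 : ¬ G.Adj w x₄ := fun hh => by
    rcases two h2 h1 h3 h4 e12.symm e23 (Ne.symm hn3.2.1) hh with h | h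
    exacts [hn4.2.1 h, hn4.2.2.2 h]
  have n04 : ¬ G.Adj u x₄ := fun hh => hn4.2.1 (one _ h4 hh)
  obtain rfl : z = x₃ := by
    rcases hz with rfl | rfl | rfl | rfl
    exacts [absurd e34 n04, absurd e34 n14, absurd e34 n24, rfl]
  refine h u h0 v h1 w h2 z h3 x₄ h4 e01 e12 e23 e34 (fun hh => hn2.2 (one _ h2 hh))
    (fun hh => hn3.2.1 (one _ h3 hh)) n04 (fun hh => ?_) n14 n24
  rcases two h1 h0 h2 h3 e01.symm e12 (Ne.symm hn2.1) hh with h | h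
  exacts [hn3.1 h, hn3.2.2 h]

/-- If two adjacent vertices dominate a set `X`, then `G[X]` is a linear forest. -/
theorem Pl.card_nb_le_two (h : Pl G S) {a b : V} (ha : a ∈ S) (hb : b ∈ S) (hab : G.Adj a b)
    (hX : X ⊆ S) (dX : Dm G a X) (dX' : Dm G b X) : ∀ x ∈ X, #(nb G X x) ≤ 2 := by
  intro x hx
  by_contra! h3
  obtain ⟨N, hN, hN3⟩ := exists_subset_card_eq (show 3 ≤ #(nb G X x) from h3)
  obtain ⟨u, v, w, huv, huw, hvw, rfl⟩ := card_eq_three.1 hN3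
  have hu := mem_nb.1 (hN (show u ∈ _ by simp))
  have hv := mem_nb.1 (hN (show v ∈ _ by simp))
  have hw := mem_nb.1 (hN (show w ∈ _ by simp))
  exact h.no_k33_vertices ⟨ha, hb, hX hx, hX hu.1, hX hv.1, hX hw.1⟩
    ⟨hab.ne, (dX x hx).ne, (dX' x hx).ne⟩ ⟨huv, huw, hvw⟩
    ⟨dX _ hu.1, dX _ hv.1, dX _ hw.1, dX' _ hu.1, dX' _ hv.1, dX' _ hw.1, hu.2, hv.2, hw.2⟩

theorem Pl.ecard_add_one_le (h : Pl G S) {a b : V} (ha : a ∈ S) (hb : b ∈ S) (hab : G.Adj a b)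
    (hX : X ⊆ S) (hne : X.Nonempty) (dX : Dm G a X) (dX' : Dm G b X) : ecard G X + 1 ≤ #X := by
  have haX : a ∉ X := fun hh => (dX a hh).ne rfl
  have hbX : b ∉ X := fun hh => (dX' b hh).ne rfl
  have haX' : a ∉ insert b X := by simp [haX, hab.ne]
  have h1 := h.mono (le_refl G) (show insert a (insert b X) ⊆ S by simp [insert_subset_iff, *])
  have h2 := card_pos.2 hne
  have h3 := h1.ecard_le (by rw [card_insert_of_notMem haX', card_insert_of_notMem hbX]; omega)
  rw [ecard_insert haX', ecard_insert hbX, card_insert_of_notMem haX', card_insert_of_notMem hbX,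
    nb_insert_of_adj hab, card_insert_of_notMem (fun hh => hbX (nb_subset _ hh)), dX.nb_eq,
    dX'.nb_eq] at h3
  omega

theorem Kl.card_le_four (h : Kl G S) {a b : V} (ha : a ∈ S) (hb : b ∈ S) (hab : G.Adj a b)
    (hX : X ⊆ S) (hc : Cn G X) (dX : Dm G a X) (dX' : Dm G b X) : #X ≤ 4 :=
  (h.p5.mono hX).card_le_four hc (h.pl.card_nb_le_two ha hb hab hX dX dX')
    (h.pl.ecard_add_one_le ha hb hab hX hc.1 dX dX')

namespace Ctr

theorem nine (h : Ctr G S) : 9 ≤ #S := by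
  by_contra! hlt
  have h1 := h.two
  have h2 := h.big
  rcases Nat.eq_or_lt_of_le h1 with h3 | h3
  · have := two_mul_ecard_le G S
    rw [← h3] at this h2
    omega
  · have := h.kl.pl.ecard_le h3
    omega

theorem del (h : Ctr G S) (hX : X ⊆ S) (hne : X.Nonempty) (hc : #X + 2 ≤ #S) :
    11 * #X < 4 * (ecard G X + ebt G X (S \ X)) := by
  have h1 := ecard_sdiff (G := G) hX
  have h2 := card_sdiff_add_card_eq_card hX
  have h3 := card_pos.2 hne
  have h4 := h.min G (S \ X) (h.kl.mono sdiff_subset) (by omega) (by omega)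
  have := h.big
  omega

theorem three_le (h : Ctr G S) {v : V} (hv : v ∈ S) : 3 ≤ #(nb G S v) := by
  have h1 := h.del (X := {v}) (by simpa using hv) (by simp) (by have := h.nine; simp; omega)
  rw [ecard_singleton, ebt_singleton_left] at h1
  have := card_le_card (nb_mono (G := G) (sdiff_subset (s := S) (t := {v})) v)
  simp at h1
  omega

theorem two_le_cnb (h : Ctr G S) {a b : V} (ha : a ∈ S) (hb : b ∈ S) (hab : G.Adj a b) :
    2 ≤ #(cnb G S a b) := by
  have h1 := ecard_con_edge ha hb hab
  have h2 := card_common_nb_con ha hb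
  have h3 := h.min _ _ (h.kl.con ha (R := {b}) (by simpa using hb) (by simpa using hab.ne)
    (cn_pair hab)) (by have := h.nine; omega) (by omega)
  have := h.big
  omega

end Ctr

end PlanarP5

namespace PlanarP5

open scoped Classical
open Finset

variable {V : Type*} {G : SimpleGraph V} {S X Y Z T : Finset V}

theorem ecard_add_one_le {G' : SimpleGraph V} {W : Finset V} {a b : V}
    (hG : ∀ x ∈ W, ∀ y ∈ W, G.Adj x y → G'.Adj x y) (ha : a ∈ W) (hb : b ∈ W) (hab : G'.Adj a b)
    (hn : ¬ G.Adj a b) : ecard G W + 1 ≤ ecard G' W := by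
  rw [← ecard_deleteEdge ha hb hab]
  refine Nat.succ_le_succ (ecard_le_of_le fun x hx y hy hxy => ?_)
  rw [SimpleGraph.deleteEdges_adj]
  refine ⟨hG x hx y hy hxy, fun hh => ?_⟩
  rcases Sym2.eq_iff.1 (Set.mem_singleton_iff.1 hh) with ⟨rfl, rfl⟩ | ⟨rfl, rfl⟩
  exacts [hn hxy, hn hxy.symm]

theorem ecard_union_union (h1 : Disjoint T X) (h2 : Disjoint T Y) (h3 : Disjoint X Y)
    (h : ∀ x ∈ X, ∀ y ∈ Y, ¬ G.Adj x y) :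
    ecard G (T ∪ X ∪ Y) + ecard G T = ecard G (T ∪ X) + ecard G (T ∪ Y) := by
  rw [ecard_union (disjoint_union_left.2 ⟨h2, h3⟩), ecard_union h1, ecard_union h2,
    ebt_union_left h1, ebt_eq_zero h]
  omega

theorem Sd.nb_eq (h : Sd G S T X) (hT : T ⊆ S) {x : V} (hx : x ∈ X) :
    nb G (S \ X) x = nb G T x := by
  ext y
  simp only [mem_nb, mem_sdiff]
  constructor
  · rintro ⟨⟨h1, h2⟩, h3⟩
    refine ⟨?_, h3⟩
    by_contra hy
    exact h2 (h.closed x hx y (mem_sdiff.2 ⟨h1, hy⟩) h3)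
  · rintro ⟨h1, h2⟩
    exact ⟨⟨hT h1, fun hy => h.not_mem hy h1⟩, h2⟩

theorem Sd.ebt_eq (h : Sd G S T X) (hT : T ⊆ S) : ebt G X (S \ X) = ebt G X T :=
  sum_congr rfl fun _ hx => by rw [h.nb_eq hT hx]

theorem cn_erase {q : V} (hX : Cn G X) (hq : q ∈ X) (hne : (X.erase q).Nonempty)
    (hcl : ∀ u ∈ X, ∀ v ∈ X, G.Adj q u → G.Adj q v → u ≠ v → G.Adj u v) : Cn G (X.erase q) := by
  refine ⟨hne, fun t ht htne hc => ?_⟩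
  by_cases hqt : ∃ u ∈ t, G.Adj q u
  · obtain ⟨u, hu, hqu⟩ := hqt
    have h1 := hX.2 (insert q t) (insert_subset hq (ht.trans (erase_subset _ _))) (by simp) (by
      intro x hx y hy hxy
      by_cases hyq : y = q
      · simp [hyq]
      rcases mem_insert.1 hx with rfl | hx
      · by_cases hyu : u = y
        · subst hyu; simp [hu]
        · exact mem_insert_of_mem (hc u hu y (mem_erase.2 ⟨hyq, hy⟩)
            (hcl u (mem_of_mem_erase (ht hu)) y hy hqu hxy hyu))
      · exact mem_insert_of_mem (hc x hx y (mem_erase.2 ⟨hyq, hy⟩) hxy))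
    rw [← h1, erase_insert (fun hh => by simpa using ht hh)]
  · have h1 := hX.2 t (ht.trans (erase_subset _ _)) htne (by
      intro x hx y hy hxy
      refine hc x hx y (mem_erase.2 ⟨?_, hy⟩) hxy
      rintro rfl
      exact hqt ⟨x, hx, hxy.symm⟩)
    exact absurd (ht (h1.symm ▸ hq)) (by simp)

namespace Ctr

theorem no_dm_pair (h : Ctr G S) {a b : V} (ha : a ∈ S) (hb : b ∈ S) (hab : G.Adj a b)
    (hX : Sd G S {a, b} X) (dX : Dm G a X) (dX' : Dm G b X) : False := by
  have hT : ({a, b} : Finset V) ⊆ S := by simp [insert_subset_iff, *]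
  have h1 := h.kl.card_le_four ha hb hab hX.subS hX.cn dX dX'
  have h2 := h.kl.pl.ecard_add_one_le ha hb hab hX.subS hX.cn.1 dX dX'
  have h3 := h.nine
  have h4 := h.del hX.subS hX.cn.1 (by omega)
  rw [hX.ebt_eq hT, ebt_insert_right (by simpa using hab.ne), ebt_singleton_right, dX.nb_eq,
    dX'.nb_eq] at h4
  omega

theorem cut_one (h : Ctr G S) {a : V} (ha : a ∈ S) (hX : X ⊆ S \ {a}) (hne : X.Nonempty)
    (hcl : ∀ u ∈ X, ∀ v ∈ S \ {a}, G.Adj u v → v ∈ X) (hY : ((S \ {a}) \ X).Nonempty) : False := by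
  have hd : Disjoint {a} X := disjoint_left.2 fun x hx hx' => (mem_sdiff.1 (hX hx')).2 hx
  have hd' : Disjoint {a} ((S \ {a}) \ X) := disjoint_left.2 fun x hx hx' =>
    (mem_sdiff.1 (mem_sdiff.1 hx').1).2 hx
  have h1 := ecard_union_union (G := G) hd hd' disjoint_sdiff fun x hx y hy hxy =>
    (mem_sdiff.1 hy).2 (hcl x hx y (mem_sdiff.1 hy).1 hxy)
  have h2 : {a} ∪ X ∪ (S \ {a}) \ X = S := by
    rw [union_assoc, union_sdiff_of_subset hX, union_sdiff_of_subset (by simpa using ha)]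
  have h3 := card_union_of_disjoint hd
  have h4 := card_union_of_disjoint hd'
  have h5 := congrArg card h2
  rw [card_union_of_disjoint (disjoint_union_left.2 ⟨hd', disjoint_sdiff⟩)] at h5
  have h6 := card_pos.2 hne
  have h7 := card_pos.2 hY
  rw [h2] at h1
  simp only [card_singleton] at h3 h4
  have haS : {a} ⊆ S := by simpa using ha
  have h8 := h.min G _ (h.kl.mono (union_subset haS (hX.trans sdiff_subset))) (by omega) (by omega)
  have h9 := h.min G ({a} ∪ (S \ {a}) \ X)
    (h.kl.mono (union_subset haS (sdiff_subset.trans sdiff_subset))) (by omega) (by omega)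
  have := h.big
  omega

theorem cut_zero (h : Ctr G S) (hX : X ⊆ S) (hne : X.Nonempty)
    (hcl : ∀ u ∈ X, ∀ v ∈ S, G.Adj u v → v ∈ X) (hY : (S \ X).Nonempty) : False := by
  obtain ⟨y, hy⟩ := hY
  obtain ⟨hyS, hyX⟩ := mem_sdiff.1 hy
  refine h.cut_one hyS (X := X) (fun x hx => mem_sdiff.2 ⟨hX hx, ?_⟩) hne
    (fun u hu v hv huv => hcl u hu v (mem_sdiff.1 hv).1 huv) ?_
  · rw [mem_singleton]; rintro rfl; exact hyX hx
  · obtain ⟨z, hz⟩ := card_pos.1 (lt_of_lt_of_le (by norm_num) (h.three_le hyS))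
    obtain ⟨hzS, hyz⟩ := mem_nb.1 hz
    exact ⟨z, mem_sdiff.2 ⟨mem_sdiff.2 ⟨hzS, by simpa using hyz.ne'⟩,
      fun hzX => hyX (hcl z hzX y hyS hyz.symm)⟩⟩

theorem attach_two (h : Ctr G S) {a b : V} (ha : a ∈ S) (hb : b ∈ S) (hab : a ≠ b)
    (hX : Sd G S {a, b} X) : ∃ x ∈ X, G.Adj a x := by
  by_contra! hn
  refine h.cut_one hb (fun x hx => mem_sdiff.2 ⟨hX.subS hx, fun hh => hX.not_mem hx (by simp_all)⟩)
    hX.cn.1 (fun u hu v hv huv => ?_) ⟨a, mem_sdiff.2 ⟨mem_sdiff.2 ⟨ha, by simpa using hab⟩,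
      fun hh => hX.not_mem hh (by simp)⟩⟩
  obtain ⟨hv, hvb⟩ := mem_sdiff.1 hv
  refine hX.closed u hu v (mem_sdiff.2 ⟨hv, ?_⟩) huv
  rw [mem_singleton] at hvb
  simp only [mem_insert, mem_singleton, not_or]
  exact ⟨by rintro rfl; exact hn u hu huv.symm, hvb⟩

theorem con_into (h : Ctr G S) {W R : Finset V} {a b : V} (hW : W ⊆ S) (hR : R ⊆ S)
    (hWR : Disjoint W R) (ha : a ∈ W) (hb : b ∈ W) (hab : a ≠ b) (hn : ¬ G.Adj a b) (cR : Cn G R)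
    (haR : ∃ r ∈ R, G.Adj a r) (hbR : ∃ r ∈ R, G.Adj b r) :
    4 * ecard G W + 20 ≤ 11 * #W := by
  obtain ⟨r, hr, har⟩ := haR
  obtain ⟨r', hr', hbr⟩ := hbR
  have haR : a ∉ R := disjoint_left.1 hWR ha
  have h1 : (W ∪ R) \ R = W := by
    rw [union_sdiff_right, sdiff_eq_self_of_disjoint hWR]
  have h2 := (h.kl.mono (union_subset hW hR)).con (mem_union_left _ ha) subset_union_right haR
    (cR.insert hr har)
  rw [h1] at h2
  have h3 : 2 ≤ #W := by
    rw [← card_pair hab]; exact card_le_card (by simp [insert_subset_iff, *])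
  have h4 : #W < #S := by
    have := card_le_card (union_subset hW hR)
    rw [card_union_of_disjoint hWR] at this
    have := card_pos.2 cR.1
    omega
  have h5 := h.min _ _ h2 h3 h4
  have h6 : ecard G W + 1 ≤ ecard (con G a R) W := ecard_add_one_le
    (fun x _ y _ hxy => le_con _ _ _ hxy) ha hb ((con_adj_left hab.symm).2
      ⟨r', by simp [hr'], hbr.symm⟩) hn
  omega

theorem cut_two_of_not_adj (h : Ctr G S) {a b : V} (ha : a ∈ S) (hb : b ∈ S) (hab : a ≠ b)
    (hn : ¬ G.Adj a b) (hX : Sd G S {a, b} X) (hY : Sd G S {a, b} Y) (hXY : Disjoint X Y) :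
    False := by
  have hT : ({a, b} : Finset V) ⊆ S := by simp [insert_subset_iff, *]
  set W := (S \ {a, b}) \ X with hW
  have hYW : Y ⊆ W := fun y hy => mem_sdiff.2 ⟨hY.sub hy, fun hh => disjoint_left.1 hXY hh hy⟩
  have hd' : Disjoint {a, b} W := disjoint_left.2 fun x hx hx' =>
    (mem_sdiff.1 (mem_sdiff.1 hx').1).2 hx
  have hWS : W ⊆ S := sdiff_subset.trans sdiff_subset
  have h1 := ecard_union_union hX.disj.symm hd' disjoint_sdiff (hX.anti sdiff_subset disjoint_sdiff)
  have h2 : {a, b} ∪ X ∪ W = S := by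
    rw [union_assoc, union_sdiff_of_subset hX.sub, union_sdiff_of_subset hT]
  have h3 := card_union_of_disjoint hX.disj.symm
  have h4 := card_union_of_disjoint hd'
  have h5 := congrArg card h2
  rw [card_union_of_disjoint (disjoint_union_left.2 ⟨hd', disjoint_sdiff⟩)] at h5
  rw [h2] at h1
  have hatt : ∀ Z, Sd G S {a, b} Z → (∃ x ∈ Z, G.Adj a x) ∧ ∃ x ∈ Z, G.Adj b x := fun Z hZ =>
    ⟨h.attach_two ha hb hab hZ, h.attach_two hb ha hab.symm (by rwa [pair_comm])⟩
  have h6 := h.con_into (W := {a, b} ∪ W) (R := X) (union_subset hT hWS) hX.subS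
    (disjoint_union_left.2 ⟨hX.disj.symm, disjoint_sdiff.symm⟩) (by simp) (by simp) hab hn hX.cn
    (hatt X hX).1 (hatt X hX).2
  have h7 := h.con_into (W := {a, b} ∪ X) (R := Y) (union_subset hT hX.subS) hY.subS
    (disjoint_union_left.2 ⟨hY.disj.symm, hXY⟩) (by simp) (by simp) hab hn hY.cn
    (hatt Y hY).1 (hatt Y hY).2
  have h8 := h.big
  rw [card_pair hab] at *
  omega

end Ctr

end PlanarP5

namespace PlanarP5

open scoped Classical
open Finset

variable {V : Type*} {G : SimpleGraph V} {S X Y Z T : Finset V}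

namespace Ctr

theorem side_le_five (h : Ctr G S) {a b : V} (ha : a ∈ S) (hb : b ∈ S) (hab : G.Adj a b)
    (hX : Sd G S {a, b} X) (hY : Sd G S {a, b} Y) (hXY : Disjoint X Y) (dX : Dm G a X)
    (hbX : ∃ x ∈ X, G.Adj b x) (hbY : ∃ y ∈ Y, G.Adj b y) : #X ≤ 5 := by
  obtain ⟨z, hz, hbz⟩ := hbY
  have hzS := hY.subS hz
  have hzX : ∀ x ∈ X, ¬ G.Adj z x := fun x hx hh => hX.anti hY.sub hXY x hx z hz hh.symm
  have XS : ∀ {x}, x ∈ X → x ∈ S := fun hx => hX.subS hx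
  have haX : a ∉ X := fun hh => hX.not_mem hh (by simp)
  have hbX' : b ∉ X := fun hh => hX.not_mem hh (by simp)
  set P := nb G X b with hP
  have hPX : P ⊆ X := nb_subset b
  have hPne : P.Nonempty := by
    obtain ⟨x, hx, hbx⟩ := hbX
    exact ⟨x, mem_nb.2 ⟨hx, hbx⟩⟩
  have hPb : ∀ {p}, p ∈ P → G.Adj b p := fun hp => (mem_nb.1 hp).2
  have hQb : ∀ {q}, q ∈ X \ P → ¬ G.Adj b q := fun hq hh =>
    (mem_sdiff.1 hq).2 (mem_nb.2 ⟨(mem_sdiff.1 hq).1, hh⟩)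
  have QX : ∀ {q}, q ∈ X \ P → q ∈ X := fun hq => (mem_sdiff.1 hq).1
  have hstep : ∀ p ∈ P, ∀ q ∈ X \ P, ∀ q' ∈ X \ P, G.Adj p q → G.Adj q q' → G.Adj p q' := by
    intro p hp q hq q' hq' hpq hqq
    by_contra hn
    exact h.kl.p5 z hzS b hb p (XS (hPX hp)) q (XS (QX hq)) q' (XS (QX hq')) hbz.symm (hPb hp) hpq
      hqq (hzX _ (hPX hp)) (hzX _ (QX hq)) (hzX _ (QX hq')) (hQb hq) (hQb hq') hn
  have hnbq : ∀ {q v}, q ∈ X \ P → v ∈ S → G.Adj q v → v ≠ a → v ∈ X := by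
    intro q v hq hv hqv hva
    refine hX.closed q (QX hq) v (mem_sdiff.2 ⟨hv, ?_⟩) hqv
    simp only [mem_insert, mem_singleton, not_or]
    exact ⟨hva, by rintro rfl; exact hQb hq hqv.symm⟩
  have hind : ∀ q ∈ X \ P, ∀ q' ∈ X \ P, ¬ G.Adj q q' := by
    intro q hq q' hq' hqq
    obtain ⟨C, hCQ, hqC, hCc, hCcl⟩ := exists_comp G hq
    have hsame : C.filter (fun u => ∀ p ∈ P, G.Adj p u ↔ G.Adj p q) = C := by
      refine hCc.2 _ (filter_subset _ _) ⟨q, by simp [hqC]⟩ fun x hx y hy hxy => ?_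
      obtain ⟨hx, hxp⟩ := mem_filter.1 hx
      refine mem_filter.2 ⟨hy, fun p hp => ?_⟩
      rw [← hxp p hp]
      exact ⟨fun hh => hstep p hp y (hCQ hy) x (hCQ hx) hh hxy.symm,
        fun hh => hstep p hp x (hCQ hx) y (hCQ hy) hh hxy⟩
    have hsame' : ∀ u ∈ C, ∀ p ∈ P, G.Adj p u ↔ G.Adj p q := fun u hu => by
      rw [← hsame] at hu; exact (mem_filter.1 hu).2
    obtain ⟨c, hc, p, hpX, hpC, hcp⟩ := hX.cn.exists_adj (fun x hx => QX (hCQ hx)) hCc.1 (by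
      rintro rfl
      obtain ⟨p, hp⟩ := hPne
      exact (mem_sdiff.1 (hCQ (hPX hp))).2 hp)
    have hpP : p ∈ P := by
      by_contra hpP
      exact hpC (hCcl c hc p (mem_sdiff.2 ⟨hpX, hpP⟩) hcp)
    have hpC' : Dm G p C := fun u hu => (hsame' u hu p hpP).2 ((hsame' c hc p hpP).1 hcp.symm)
    have hq'C := hCcl q hqC q' hq' hqq
    by_cases hp' : ∃ p' ∈ P, p' ≠ p ∧ G.Adj p' q
    · obtain ⟨p', hp'P, hpp', hp'q⟩ := hp'
      exact h.kl.pl.no_k33_vertices (a₁ := p) (a₂ := p') (a₃ := a) (b₁ := q) (b₂ := q') (b₃ := b)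
        ⟨XS hpX, XS (hPX hp'P), ha, XS (QX hq), XS (QX hq'), hb⟩
        ⟨hpp'.symm, by rintro rfl; exact haX hpX, by rintro rfl; exact haX (hPX hp'P)⟩
        ⟨hqq.ne, by rintro rfl; exact hbX' (QX hq), by rintro rfl; exact hbX' (QX hq')⟩
        ⟨hpC' q hqC, hpC' q' hq'C, (hPb hpP).symm, hp'q, (hsame' q' hq'C p' hp'P).2 hp'q,
          (hPb hp'P).symm, dX _ (QX hq), dX _ (QX hq'), hab⟩
    · push Not at hp'
      refine h.no_dm_pair (X := C) ha (XS hpX) (dX p hpX) ⟨fun u hu => ?_, hCc, ?_⟩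
        (fun u hu => dX u (QX (hCQ hu))) hpC'
      · refine mem_sdiff.2 ⟨XS (QX (hCQ hu)), ?_⟩
        simp only [mem_insert, mem_singleton, not_or]
        exact ⟨by rintro rfl; exact haX (QX (hCQ hu)), by rintro rfl; exact hpC hu⟩
      · intro u hu v hv huv
        simp only [mem_sdiff, mem_insert, mem_singleton, not_or] at hv
        have hvX := hnbq (hCQ hu) hv.1 huv hv.2.1
        refine hCcl u hu v (mem_sdiff.2 ⟨hvX, fun hvP => ?_⟩) huv
        exact hp' v hvP hv.2.2 ((hsame' u hu v hvP).1 huv.symm)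
  have hqP : ∀ {q v}, q ∈ X \ P → v ∈ S → G.Adj q v → v ≠ a → v ∈ P := by
    intro q v hq hv hqv hva
    have h1 := hnbq hq hv hqv hva
    by_contra hvP
    exact hind q hq v (mem_sdiff.2 ⟨h1, hvP⟩) hqv
  have hpair : ∀ q ∈ X \ P, ∃ p p', p ≠ p' ∧ nb G P q = {p, p'} ∧ G.Adj p p' := by
    intro q hq
    have h1 : nb G S q = insert a (nb G P q) := by
      ext v
      simp only [mem_insert, mem_nb]
      constructor
      · rintro ⟨hv, hqv⟩
        by_cases hva : v = a
        · exact Or.inl hva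
        · exact Or.inr ⟨hqP hq hv hqv hva, hqv⟩
      · rintro (rfl | ⟨hv, hqv⟩)
        exacts [⟨ha, (dX q (QX hq)).symm⟩, ⟨XS (hPX hv), hqv⟩]
    have h2 : a ∉ nb G P q := fun hh => haX (hPX (nb_subset _ hh))
    have h3 := h.three_le (XS (QX hq))
    rw [h1, card_insert_of_notMem h2] at h3
    have h4 : #(nb G P q) = 2 := by
      by_contra hne
      obtain ⟨N, hN, hN3⟩ := exists_subset_card_eq (show 3 ≤ #(nb G P q) by omega)
      obtain ⟨u, v, w, huv, huw, hvw, rfl⟩ := card_eq_three.1 hN3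
      have hu := mem_nb.1 (hN (show u ∈ _ by simp))
      have hv := mem_nb.1 (hN (show v ∈ _ by simp))
      have hw := mem_nb.1 (hN (show w ∈ _ by simp))
      exact h.kl.pl.no_k33_vertices (a₁ := q) (a₂ := b) (a₃ := a)
        ⟨XS (QX hq), hb, ha, XS (hPX hu.1), XS (hPX hv.1), XS (hPX hw.1)⟩
        ⟨by rintro rfl; exact hbX' (QX hq), by rintro rfl; exact haX (QX hq), hab.ne'⟩
        ⟨huv, huw, hvw⟩ ⟨hu.2, hv.2, hw.2, hPb hu.1, hPb hv.1, hPb hw.1, dX _ (hPX hu.1),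
          dX _ (hPX hv.1), dX _ (hPX hw.1)⟩
    obtain ⟨p, p', hpp, hpe⟩ := card_eq_two.1 h4
    refine ⟨p, p', hpp, hpe, ?_⟩
    have hp := mem_nb.1 (show p ∈ nb G P q by simp [hpe])
    have h5 := h.two_le_cnb (XS (QX hq)) (XS (hPX hp.1)) hp.2
    by_contra hn
    have h6 : cnb G S q p ⊆ {a} := by
      intro v hv
      obtain ⟨hvS, hqv, hpv⟩ := mem_cnb.1 hv
      by_contra hva
      have h7 : v ∈ nb G P q := mem_nb.2 ⟨hqP hq hvS hqv (by simpa using hva), hqv⟩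
      simp only [hpe, mem_insert, mem_singleton] at h7
      rcases h7 with rfl | rfl
      exacts [hpv.ne rfl, hn hpv]
    have := card_le_card h6
    simp at this
    omega
  have hQ1 : #(X \ P) ≤ 1 := by
    rw [card_le_one]
    intro q hq q' hq'
    by_contra hne
    obtain ⟨p, p', hpp, hpe, hpadj⟩ := hpair q hq
    obtain ⟨s, s', hss, hse, hsadj⟩ := hpair q' hq'
    have mp : ∀ {v}, v ∈ nb G P q → v ∈ P ∧ G.Adj q v := fun hv => mem_nb.1 hv
    have ms : ∀ {v}, v ∈ nb G P q' → v ∈ P ∧ G.Adj q' v := fun hv => mem_nb.1 hv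
    obtain ⟨hp, hqp⟩ := mp (show p ∈ _ by simp [hpe])
    obtain ⟨hp', hqp'⟩ := mp (show p' ∈ _ by simp [hpe])
    obtain ⟨hs, hqs⟩ := ms (show s ∈ _ by simp [hse])
    obtain ⟨hs', hqs'⟩ := ms (show s' ∈ _ by simp [hse])
    by_cases hsub : nb G P q ⊆ nb G P q'
    · refine h.kl.pl.no_k33_vertices (a₁ := p) (a₂ := p') (a₃ := a) (b₁ := q) (b₂ := q') (b₃ := b)
        ⟨XS (hPX hp), XS (hPX hp'), ha, XS (QX hq), XS (QX hq'), hb⟩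
        ⟨hpp, by rintro rfl; exact haX (hPX hp), by rintro rfl; exact haX (hPX hp')⟩
        ⟨hne, by rintro rfl; exact hbX' (QX hq), by rintro rfl; exact hbX' (QX hq')⟩
        ⟨hqp.symm, (ms (hsub (by simp [hpe]))).2.symm, (hPb hp).symm, hqp'.symm,
          (ms (hsub (by simp [hpe]))).2.symm, (hPb hp').symm, dX _ (QX hq), dX _ (QX hq'), hab⟩
    · obtain ⟨r, hr, hr'⟩ := not_subset.1 hsub
      obtain ⟨hrP, hqr⟩ := mp hr
      have hq'r : ¬ G.Adj q' r := fun hh => hr' (mem_nb.2 ⟨hrP, hh⟩)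
      have key : ∀ s ∈ nb G P q', G.Adj r s := by
        intro s hs
        obtain ⟨hsP, hqs⟩ := ms hs
        by_cases hqs' : G.Adj q s
        · have h1 : s ∈ nb G P q := mem_nb.2 ⟨hsP, hqs'⟩
          have h2 : r ≠ s := by rintro rfl; exact hq'r hqs
          simp only [hpe, mem_insert, mem_singleton] at hr h1
          rcases hr with rfl | rfl <;> rcases h1 with rfl | rfl
          exacts [absurd rfl h2, hpadj, hpadj.symm, absurd rfl h2]
        · by_contra hn
          exact h.kl.p5 q (XS (QX hq)) r (XS (hPX hrP)) b hb s (XS (hPX hsP)) q' (XS (QX hq')) hqr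
            (hPb hrP).symm (hPb hsP) hqs.symm (fun hh => hQb hq hh.symm) hqs' (hind q hq q' hq') hn
            (fun hh => hq'r hh.symm) (hQb hq')
      exact h.kl.pl.no_k5_vertices ⟨ha, hb, XS (hPX hrP), XS (hPX hs), XS (hPX hs')⟩
        ⟨hab, dX _ (hPX hrP), dX _ (hPX hs), dX _ (hPX hs'), hPb hrP, hPb hs, hPb hs',
          key s (by simp [hse]), key s' (by simp [hse]), hsadj⟩
  have hPc : Cn G P := by
    rcases (X \ P).eq_empty_or_nonempty with h0 | ⟨q, hq⟩
    · rw [sdiff_eq_empty_iff_subset] at h0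
      rw [subset_antisymm hPX h0]
      exact hX.cn
    · have h1 : P = X.erase q := by
        have h2 : X \ P = {q} := eq_singleton_iff_unique_mem.2 ⟨hq, fun x hx =>
          card_le_one.1 hQ1 x hx q hq⟩
        rw [← sdiff_singleton_eq_erase, ← h2, Finset.sdiff_sdiff_eq_self hPX]
      have h3 : ∀ u ∈ X, G.Adj q u → u ∈ nb G P q := fun u hu hqu => mem_nb.2
        ⟨hqP hq (XS hu) hqu (by rintro rfl; exact haX hu), hqu⟩
      rw [h1]
      refine cn_erase hX.cn (QX hq) (h1 ▸ hPne) fun u hu v hv hqu hqv huv => ?_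
      obtain ⟨p, p', hpp, hpe, hpadj⟩ := hpair q hq
      have hu := h3 u hu hqu
      have hv := h3 v hv hqv
      simp only [hpe, mem_insert, mem_singleton] at hu hv
      rcases hu with rfl | rfl <;> rcases hv with rfl | rfl
      exacts [absurd rfl huv, hpadj, hpadj.symm, absurd rfl huv]
  have h4 := h.kl.card_le_four ha hb hab (hPX.trans hX.subS) hPc (fun x hx => dX x (hPX hx))
    (fun x hx => hPb hx)
  have := card_sdiff_add_card_eq_card hPX
  omega

theorem cut_two_of_adj (h : Ctr G S) {a b : V} (ha : a ∈ S) (hb : b ∈ S) (hab : G.Adj a b)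
    (hX : Sd G S {a, b} X) (hY : Sd G S {a, b} Y) (hXY : Disjoint X Y) : False := by
  have hT : ({a, b} : Finset V) ⊆ S := by simp [insert_subset_iff, *]
  have hata : ∀ {Z}, Sd G S {a, b} Z → (∃ x ∈ Z, G.Adj a x) := fun hZ =>
    h.attach_two ha hb hab.ne hZ
  have hatb : ∀ {Z}, Sd G S {a, b} Z → (∃ x ∈ Z, G.Adj b x) := fun hZ =>
    h.attach_two hb ha hab.ne' (by rwa [pair_comm])
  have da : ∀ {X Y}, Sd G S {a, b} X → Sd G S {a, b} Y → Disjoint X Y → Dm G a X ∨ Dm G a Y :=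
    fun hX hY hXY => h.kl.p5.dm_or_dm hX.subS hY.subS hX.cn hY.cn (hX.anti hY.sub hXY) ha
      (hata hX) (hata hY)
  have db : ∀ {X Y}, Sd G S {a, b} X → Sd G S {a, b} Y → Disjoint X Y → Dm G b X ∨ Dm G b Y :=
    fun hX hY hXY => h.kl.p5.dm_or_dm hX.subS hY.subS hX.cn hY.cn (hX.anti hY.sub hXY) hb
      (hatb hX) (hatb hY)
  have hno : ∀ {Z}, Sd G S {a, b} Z → Dm G a Z → Dm G b Z → False := fun hZ d1 d2 =>
    h.no_dm_pair ha hb hab hZ d1 d2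
  have hsize : #X ≤ 5 ∧ #Y ≤ 5 := by
    have main : ∀ {X Y}, Sd G S {a, b} X → Sd G S {a, b} Y → Disjoint X Y → Dm G a X → Dm G b Y →
        #X ≤ 5 ∧ #Y ≤ 5 := by
      intro X Y hX hY hXY d1 d2
      refine ⟨h.side_le_five ha hb hab hX hY hXY d1 (hatb hX) (hatb hY),
        h.side_le_five (a := b) (b := a) hb ha hab.symm (by rwa [pair_comm]) (X := Y) (Y := X)
          (by rwa [pair_comm]) hXY.symm d2 (hata hY) (hata hX)⟩
    rcases da hX hY hXY with d1 | d1 <;> rcases db hX hY hXY with d2 | d2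
    · exact (hno hX d1 d2).elim
    · exact main hX hY hXY d1 d2
    · exact (main hY hX hXY.symm d1 d2).symm
    · exact (hno hY d1 d2).elim
  have hall : X ∪ Y = S \ {a, b} := by
    refine subset_antisymm (union_subset hX.sub hY.sub) fun z hz => ?_
    by_contra hzn
    obtain ⟨Z, hZ, hzZ⟩ := exists_sd (G := G) hz
    have hXZ := (hX.eq_or_disjoint hZ).resolve_left (by rintro rfl; simp [hzZ] at hzn)
    have hYZ := (hY.eq_or_disjoint hZ).resolve_left (by rintro rfl; simp [hzZ] at hzn)
    have nX := @hno X hX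
    have nY := @hno Y hY
    have nZ := @hno Z hZ
    have := da hX hY hXY
    have := da hX hZ hXZ
    have := da hY hZ hYZ
    have := db hX hY hXY
    have := db hX hZ hXZ
    have := db hY hZ hYZ
    tauto
  have h1 := ecard_union_union hX.disj.symm hY.disj.symm hXY (hX.anti hY.sub hXY)
  have h2 : {a, b} ∪ X ∪ Y = S := by rw [union_assoc, hall, union_sdiff_of_subset hT]
  have h3 := card_union_of_disjoint hX.disj.symm
  have h4 := card_union_of_disjoint hY.disj.symm
  have h5 := congrArg card h2
  rw [card_union_of_disjoint (disjoint_union_left.2 ⟨hY.disj.symm, hXY⟩)] at h5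
  rw [h2] at h1
  have h6 : ecard G {a, b} = 1 := by
    rw [ecard_insert (by simpa using hab.ne), ecard_singleton, nb, filter_singleton, if_pos hab]
    simp
  rw [card_pair hab.ne] at h3 h4
  have h7 := card_pos.2 hX.cn.1
  have h8 := card_pos.2 hY.cn.1
  have h9 := (h.kl.pl.mono (le_refl G) (union_subset hT hX.subS)).ecard_le (by omega)
  have h10 := (h.kl.pl.mono (le_refl G) (union_subset hT hY.subS)).ecard_le (by omega)
  have := h.big
  omega

/-- A minimal counterexample is 3-connected. -/
theorem eq_sdiff (h : Ctr G S) (hT : T ⊆ S) (hT2 : #T ≤ 2) (hX : Sd G S T X) : X = S \ T := by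
  by_contra hne
  obtain ⟨y, hy, hyX⟩ := not_subset.1 fun hh => hne (subset_antisymm hX.sub hh)
  obtain ⟨Y, hY, hyY⟩ := exists_sd (G := G) hy
  have hXY := (hX.eq_or_disjoint hY).resolve_left (by rintro rfl; exact hyX hyY)
  interval_cases hc : #T
  · obtain rfl := card_eq_zero.1 hc
    exact h.cut_zero hX.subS hX.cn.1 (fun u hu v hv huv => hX.closed u hu v (by simpa using hv) huv)
      ⟨y, by simpa [hyX] using hy⟩
  · obtain ⟨a, rfl⟩ := card_eq_one.1 hc
    exact h.cut_one (by simpa using hT) hX.sub hX.cn.1 hX.closed ⟨y, mem_sdiff.2 ⟨hy, hyX⟩⟩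
  · obtain ⟨a, b, hab, rfl⟩ := card_eq_two.1 hc
    have ha := hT (show a ∈ _ by simp)
    have hb := hT (show b ∈ _ by simp)
    by_cases hadj : G.Adj a b
    · exact h.cut_two_of_adj ha hb hadj hX hY hXY
    · exact h.cut_two_of_not_adj ha hb hab hadj hX hY hXY

end Ctr

end PlanarP5

namespace PlanarP5

open scoped Classical
open Finset

variable {V : Type*} {G : SimpleGraph V} {S X Y Z T : Finset V}

theorem cn_card_le (h : Cn G X) : #X ≤ ecard G X + 1 := by
  have key : ∀ k ≤ #X, ∃ t ⊆ X, #t = k ∧ k ≤ ecard G t + 1 := by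
    intro k
    induction k with
    | zero => exact fun _ => ⟨∅, by simp, by simp, by omega⟩
    | succ k ih =>
      intro hk
      obtain ⟨t, ht, htk, he⟩ := ih (by omega)
      rcases t.eq_empty_or_nonempty with rfl | hne
      · obtain ⟨x, hx⟩ := h.1
        rw [card_empty] at htk
        exact ⟨{x}, by simpa using hx, by simp [← htk], by omega⟩
      · obtain ⟨x, hx, y, hy, hyt, hxy⟩ := h.exists_adj ht hne (by rintro rfl; omega)
        refine ⟨insert y t, insert_subset hy ht, by rw [card_insert_of_notMem hyt, htk], ?_⟩
        rw [ecard_insert hyt]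
        have := card_pos.2 ⟨x, mem_nb.2 ⟨hx, hxy.symm⟩⟩
        omega
  obtain ⟨t, ht, htk, he⟩ := key _ le_rfl
  rwa [eq_of_subset_of_card_le ht htk.ge] at he

theorem Sd.subset_of_mem (hX : Sd G S T X) {W : Finset V} (hW : Cn G W) (hWT : W ⊆ S \ T) {x : V}
    (hxW : x ∈ W) (hxX : x ∈ X) : W ⊆ X := by
  have h1 := hW.2 (W ∩ X) inter_subset_left ⟨x, mem_inter.2 ⟨hxW, hxX⟩⟩ fun u hu v hv huv =>
    mem_inter.2 ⟨hv, hX.closed u (mem_inter.1 hu).2 v (hWT hv) huv⟩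
  rw [← h1]
  exact inter_subset_right

/-- The triangle `a b c` of `G[S]` together with the fact that it does not separate `G[S]`. -/
structure Ns (G : SimpleGraph V) (S : Finset V) (a b c : V) : Prop where
  mem : a ∈ S ∧ b ∈ S ∧ c ∈ S
  ab : G.Adj a b
  ac : G.Adj a c
  bc : G.Adj b c
  cn : Cn G (S \ {a, b, c})

theorem Ns.swap {a b c : V} (h : Ns G S a b c) : Ns G S b a c :=
  ⟨⟨h.mem.2.1, h.mem.1, h.mem.2.2⟩, h.ab.symm, h.bc, h.ac, by
    rw [Finset.insert_comm b a]; exact h.cn⟩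

theorem Ns.swap' {a b c : V} (h : Ns G S a b c) : Ns G S a c b :=
  ⟨⟨h.mem.1, h.mem.2.2, h.mem.2.1⟩, h.ac, h.ab, h.bc.symm, by
    rw [Finset.pair_comm c b]; exact h.cn⟩

/-- A triangle of `G[S]`. -/
structure Tri (G : SimpleGraph V) (S : Finset V) (a b c : V) : Prop where
  mem : a ∈ S ∧ b ∈ S ∧ c ∈ S
  ab : G.Adj a b
  ac : G.Adj a c
  bc : G.Adj b c

theorem Tri.sub {a b c : V} (h : Tri G S a b c) : ({a, b, c} : Finset V) ⊆ S := by
  have := h.mem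
  simp [insert_subset_iff, *]

theorem Tri.card {a b c : V} (h : Tri G S a b c) : #({a, b, c} : Finset V) = 3 :=
  card_eq_three.2 ⟨a, b, c, h.ab.ne, h.ac.ne, h.bc.ne, rfl⟩

namespace Ctr

theorem attach (h : Ctr G S) (hT : T ⊆ S) (hT3 : #T ≤ 3) (hX : Sd G S T X) {v : V} (hv : v ∈ T) :
    ∃ x ∈ X, G.Adj v x := by
  by_contra! hn
  have h1 : Sd G S (T.erase v) X := by
    refine ⟨fun x hx => mem_sdiff.2 ⟨hX.subS hx, fun hh => hX.not_mem hx (mem_of_mem_erase hh)⟩,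
      hX.cn, fun u hu w hw huw => hX.closed u hu w (mem_sdiff.2 ⟨(mem_sdiff.1 hw).1, ?_⟩) huw⟩
    refine fun hwT => (mem_sdiff.1 hw).2 (mem_erase.2 ⟨?_, hwT⟩)
    rintro rfl
    exact hn u hu huw.symm
  have h2 := h.eq_sdiff ((erase_subset _ _).trans hT) (by rw [card_erase_of_mem hv]; omega) h1
  exact hX.not_mem (h2 ▸ mem_sdiff.2 ⟨hT hv, by simp⟩ : v ∈ X) hv

theorem union_eq (h : Ctr G S) (hT : T ⊆ S) (hT3 : #T = 3) (hX : Sd G S T X) (hY : Sd G S T Y)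
    (hXY : Disjoint X Y) : X ∪ Y = S \ T := by
  refine subset_antisymm (union_subset hX.sub hY.sub) fun z hz => ?_
  by_contra hzn
  obtain ⟨Z, hZ, hzZ⟩ := exists_sd (G := G) hz
  have hXZ := (hX.eq_or_disjoint hZ).resolve_left (by rintro rfl; simp [hzZ] at hzn)
  have hYZ := (hY.eq_or_disjoint hZ).resolve_left (by rintro rfl; simp [hzZ] at hzn)
  obtain ⟨a, b, c, hab, hac, hbc, rfl⟩ := card_eq_three.1 hT3
  have hd : ∀ {W v}, Sd G S {a, b, c} W → v ∈ ({a, b, c} : Finset V) → Disjoint {v} W :=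
    fun hW hv => disjoint_singleton_left.2 fun hh => hW.not_mem hh hv
  have ht : ∀ {W v}, Sd G S {a, b, c} W → v ∈ ({a, b, c} : Finset V) → Tc G {v} W := by
    intro W v hW hv
    obtain ⟨w, hw, hvw⟩ := h.attach hT hT3.le hW hv
    exact tc_of_adj hvw (by simp) hw
  have hm := insert_subset_iff.1 hT
  have hm' := insert_subset_iff.1 hm.2
  refine h.kl.pl.no_k33 {a} {b} {c} X Y Z
    ⟨by simpa using hm.1, by simpa using hm'.1, hm'.2, hX.subS, hY.subS, hZ.subS⟩
    ⟨cn_singleton _ _, cn_singleton _ _, cn_singleton _ _, hX.cn, hY.cn, hZ.cn⟩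
    (by simpa [eq_comm] using ⟨hab, hac, hbc⟩) ⟨hXY, hXZ, hYZ⟩
    ⟨hd hX ?_, hd hY ?_, hd hZ ?_, hd hX ?_, hd hY ?_, hd hZ ?_, hd hX ?_, hd hY ?_, hd hZ ?_⟩
    ⟨ht hX ?_, ht hY ?_, ht hZ ?_, ht hX ?_, ht hY ?_, ht hZ ?_, ht hX ?_, ht hY ?_, ht hZ ?_⟩ <;>
    simp

theorem exists_other (hX : Sd G S T X) (hne : X ≠ S \ T) : ∃ Y, Sd G S T Y ∧ Disjoint X Y := by
  obtain ⟨y, hy, hyX⟩ := not_subset.1 fun hh => hne (subset_antisymm hX.sub hh)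
  obtain ⟨Y, hY, hyY⟩ := exists_sd (G := G) hy
  exact ⟨Y, hY, (hX.eq_or_disjoint hY).resolve_left (by rintro rfl; exact hyX hyY)⟩

theorem side_small (h : Ctr G S) {a b c : V} (ht : Tri G S a b c) (hX : Sd G S {a, b, c} X)
    (da : Dm G a X) (db : Dm G b X) :
    #X ≤ 3 ∧ ecard G X + ebt G X (S \ X) ≤ 3 * #X := by
  obtain ⟨ha, hb, hc⟩ := ht.mem
  have hab := ht.ab
  have hac := ht.ac
  have hbc := ht.bc
  have aX : a ∉ X := fun hh => hX.not_mem hh (by simp)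
  have bX : b ∉ X := fun hh => hX.not_mem hh (by simp)
  have cX : c ∉ X := fun hh => hX.not_mem hh (by simp)
  have XS : ∀ {x}, x ∈ X → x ∈ S := fun hx => hX.subS hx
  have h4 := h.kl.card_le_four ha hb hab hX.subS hX.cn da db
  have e1 : ebt G X {a, b, c} = 2 * #X + #(nb G X c) := by
    rw [ebt_insert_right (by simp [hab.ne, hac.ne]), ebt_insert_right (by simp [hbc.ne]),
      ebt_singleton_right, da.nb_eq, db.nb_eq]
    omega
  have hcT : #({a, b, c} : Finset V) = 3 := ht.card
  have hTS := ht.sub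
  have e2 : ecard G {a, b, c} = 3 := by
    rw [ecard_insert (by simp [hab.ne, hac.ne]), ecard_insert (by simp [hbc.ne]), ecard_singleton,
      nb_insert_of_adj hab, nb, nb, filter_singleton, filter_singleton, if_pos hac, if_pos hbc,
      card_pair hbc.ne]
    simp
  have e3 := (h.kl.pl.mono (le_refl G) (union_subset hX.subS hTS)).ecard_le (by
    rw [card_union_of_disjoint hX.disj]; omega)
  rw [card_union_of_disjoint hX.disj, ecard_union hX.disj, e1, e2, hcT] at e3
  rw [hX.ebt_eq hTS, e1]
  refine ⟨?_, by omega⟩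
  by_contra! h4'
  have e4 := cn_card_le hX.cn
  have hc1 : #(nb G X c) ≤ 1 := by omega
  obtain ⟨x, hx, hcx⟩ := h.attach hTS hcT.le hX (v := c) (by simp)
  have huniq : ∀ w ∈ X, G.Adj c w → w = x := fun w hw hcw =>
    card_le_one.1 hc1 w (mem_nb.2 ⟨hw, hcw⟩) x (mem_nb.2 ⟨hx, hcx⟩)
  obtain ⟨x', hx', u, hu, hux, hxu⟩ := hX.cn.exists_adj (t := {x}) (by simpa using hx) (by simp)
    (by rintro rfl; simp at h4')
  obtain rfl := mem_singleton.1 hx'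
  by_cases h2 : ∃ v ∈ X, v ≠ u ∧ G.Adj x' v
  · obtain ⟨v, hv, hvu, hxv⟩ := h2
    exact h.kl.pl.no_k33_vertices (a₁ := a) (a₂ := b) (a₃ := x') (b₁ := u) (b₂ := v) (b₃ := c)
      ⟨ha, hb, XS hx, XS hu, XS hv, hc⟩ ⟨hab.ne, (da _ hx).ne, (db _ hx).ne⟩
      ⟨hvu.symm, by rintro rfl; exact cX hu, by rintro rfl; exact cX hv⟩
      ⟨da _ hu, da _ hv, hac, db _ hu, db _ hv, hbc, hxu, hxv, hcx.symm⟩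
  push Not at h2
  obtain ⟨u', hu', w, hw, hwn, huw⟩ := hX.cn.exists_adj (t := {x', u})
    (by simp [insert_subset_iff, *]) (by simp) (by
      intro hh
      have := card_le_two (a := x') (b := u)
      rw [hh] at this
      omega)
  simp only [mem_insert, mem_singleton, not_or] at hu' hwn
  obtain rfl : u' = u := by
    rcases hu' with rfl | rfl
    · exact absurd huw (h2 w hw hwn.2)
    · rfl
  have hne : X ≠ S \ {a, b, c} := by
    intro hh
    have := card_sdiff_add_card_eq_card hTS
    rw [← hh] at this
    have := h.nine
    omega
  obtain ⟨Y, hY, hXY⟩ := exists_other hX hne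
  obtain ⟨y, hy, hcy⟩ := h.attach hTS hcT.le hY (v := c) (by simp)
  have hyn : ∀ x ∈ X, ¬ G.Adj y x := fun x hx hh => hX.anti hY.sub hXY x hx y hy hh.symm
  have hux' : u' ≠ x' := by simpa using hux
  exact h.kl.p5 y (hY.subS hy) c hc x' (XS hx) u' (XS hu) w (XS hw) hcy.symm hcx hxu huw
    (hyn _ hx) (hyn _ hu) (hyn _ hw) (fun hh => hux' (huniq _ hu hh))
    (fun hh => hwn.1 (huniq _ hw hh)) (h2 w hw hwn.2)

theorem exists_cnb_side (h : Ctr G S) {a b c : V} (ht : Tri G S a b c) (hX : Sd G S {a, b, c} X)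
    (hne : X ≠ S \ {a, b, c}) : ∃ x ∈ X, G.Adj a x ∧ G.Adj b x := by
  by_contra! hno
  obtain ⟨Y, hY, hXY⟩ := exists_other hX hne
  obtain ⟨ha, hb, hc⟩ := ht.mem
  have hun := h.union_eq ht.sub ht.card hX hY hXY
  have att : ∀ {W v}, Sd G S {a, b, c} W → v ∈ ({a, b, c} : Finset V) → ∃ x ∈ W, G.Adj v x :=
    fun hW hv => h.attach ht.sub ht.card.le hW hv
  have dm : ∀ v ∈ ({a, b, c} : Finset V), Dm G v X ∨ Dm G v Y := fun v hv =>
    h.kl.p5.dm_or_dm hX.subS hY.subS hX.cn hY.cn (hX.anti hY.sub hXY) (ht.sub hv) (att hX hv)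
      (att hY hv)
  have hab' : ¬ (Dm G a X ∧ Dm G b X) := fun ⟨d1, d2⟩ => by
    obtain ⟨x, hx⟩ := hX.cn.1
    exact hno x hx (d1 x hx) (d2 x hx)
  have hda : ¬ Dm G a X := fun d => by
    obtain ⟨x, hx, hbx⟩ := att hX (v := b) (by simp)
    exact hno x hx (d x hx) hbx
  have hdb : ¬ Dm G b X := fun d => by
    obtain ⟨x, hx, hax⟩ := att hX (v := a) (by simp)
    exact hno x hx hax (d x hx)
  obtain ⟨h3, hloss⟩ := h.side_small ht hY ((dm a (by simp)).resolve_left hda)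
    ((dm b (by simp)).resolve_left hdb)
  have haY : a ∈ S \ Y := mem_sdiff.2 ⟨ha, fun hh => hY.not_mem hh (by simp)⟩
  have hbY : b ∈ S \ Y := mem_sdiff.2 ⟨hb, fun hh => hY.not_mem hh (by simp)⟩
  have e1 := ecard_sdiff (G := G) hY.subS
  have e2 := ecard_con_edge haY hbY ht.ab
  have e3 := card_common_nb_con haY hbY
  have e4 := card_sdiff_add_card_eq_card hY.subS
  have hcn : cnb G (S \ Y) a b ⊆ {c} := by
    intro v hv
    obtain ⟨hvS, hav, hbv⟩ := mem_cnb.1 hv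
    obtain ⟨hvS, hvY⟩ := mem_sdiff.1 hvS
    by_contra hvc
    have : v ∈ S \ {a, b, c} := by
      refine mem_sdiff.2 ⟨hvS, ?_⟩
      simp only [mem_insert, not_or]
      exact ⟨hav.ne', hbv.ne', hvc⟩
    rw [← hun, mem_union] at this
    exact hno v (this.resolve_right hvY) hav hbv
  have e5 := card_le_card hcn
  rw [card_singleton] at e5
  have e6 := h.nine
  have e7 := h.min _ _ ((h.kl.mono sdiff_subset).con haY (R := {b}) (by simpa using hbY)
    (by simpa using ht.ab.ne) (cn_pair ht.ab)) (by omega) (by omega)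
  have := h.big
  omega

theorem exists_ns_side (h : Ctr G S) {a b c : V} (ht : Tri G S a b c) (hX : Sd G S {a, b, c} X)
    (hne : X ≠ S \ {a, b, c}) : ∃ x ∈ X, Ns G S a b x := by
  induction hn : #X using Nat.strong_induction_on generalizing X c with
  | _ n ih =>
  obtain ⟨c', hc', hac, hbc⟩ := h.exists_cnb_side ht hX hne
  obtain ⟨ha, hb, hc⟩ := ht.mem
  have ht' : Tri G S a b c' := ⟨⟨ha, hb, hX.subS hc'⟩, ht.ab, hac, hbc⟩
  by_cases hns : Cn G (S \ {a, b, c'})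
  · exact ⟨c', hc', ht'.mem, ht.ab, hac, hbc, hns⟩
  obtain ⟨Y, hY, hXY⟩ := exists_other hX hne
  have hcc' : c ≠ c' := by rintro rfl; exact hX.not_mem hc' (by simp)
  have hcT : c ∈ S \ {a, b, c'} := by
    simp only [mem_sdiff, mem_insert, mem_singleton, not_or]
    exact ⟨hc, ht.ac.ne', ht.bc.ne', hcc'⟩
  obtain ⟨W, hW, hcW⟩ := exists_sd (G := G) hcT
  obtain ⟨X', hX', hWX'⟩ := exists_other hW (by rintro rfl; exact hns hW.cn)
  obtain ⟨y, hy, hcy⟩ := h.attach ht.sub ht.card.le hY (v := c) (by simp)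
  have hYT : Y ⊆ S \ {a, b, c'} := by
    intro v hv
    simp only [mem_sdiff, mem_insert, mem_singleton, not_or]
    refine ⟨hY.subS hv, ?_, ?_, ?_⟩ <;> rintro rfl
    exacts [hY.not_mem hv (by simp), hY.not_mem hv (by simp), disjoint_left.1 hXY hc' hv]
  have hYW := hW.subset_of_mem hY.cn hYT hy (hW.closed c hcW y (hYT hy) hcy)
  have hX'X : X' ⊆ X.erase c' := by
    intro v hv
    have h1 := hX'.not_mem hv
    simp only [mem_insert, mem_singleton, not_or] at h1
    refine mem_erase.2 ⟨h1.2.2, ?_⟩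
    have h2 : v ∈ S \ {a, b, c} := by
      simp only [mem_sdiff, mem_insert, mem_singleton, not_or]
      exact ⟨hX'.subS hv, h1.1, h1.2.1, by rintro rfl; exact disjoint_left.1 hWX' hcW hv⟩
    rw [← h.union_eq ht.sub ht.card hX hY hXY, mem_union] at h2
    exact h2.resolve_right fun hh => disjoint_left.1 hWX' (hYW hh) hv
  have hlt : #X' < n := by
    rw [← hn]
    exact card_lt_card (lt_of_le_of_lt hX'X (erase_ssubset hc'))
  obtain ⟨x, hx, hxns⟩ := ih _ hlt ht' hX' (by
    rintro rfl
    exact disjoint_left.1 hWX' hcW hcT) rfl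
  exact ⟨x, mem_of_mem_erase (hX'X hx), hxns⟩

theorem exists_two_ns (h : Ctr G S) {a b : V} (ha : a ∈ S) (hb : b ∈ S) (hab : G.Adj a b) :
    ∃ c d, c ≠ d ∧ Ns G S a b c ∧ Ns G S a b d := by
  obtain ⟨c, hc, d, hd, hcd⟩ := one_lt_card.1 (h.two_le_cnb ha hb hab)
  have main : ∀ c ∈ cnb G S a b, Ns G S a b c ∨ ∃ c d, c ≠ d ∧ Ns G S a b c ∧ Ns G S a b d := by
    intro c hc
    obtain ⟨hcS, hac, hbc⟩ := mem_cnb.1 hc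
    have ht : Tri G S a b c := ⟨⟨ha, hb, hcS⟩, hab, hac, hbc⟩
    by_cases hns : Cn G (S \ {a, b, c})
    · exact Or.inl ⟨ht.mem, hab, hac, hbc, hns⟩
    right
    have h1 := card_sdiff_add_card_eq_card ht.sub
    rw [ht.card] at h1
    have := h.nine
    obtain ⟨x, hx⟩ := card_pos.1 (show 0 < #(S \ {a, b, c}) by omega)
    obtain ⟨X, hX, -⟩ := exists_sd (G := G) hx
    have hXne : X ≠ S \ {a, b, c} := by rintro rfl; exact hns hX.cn
    obtain ⟨Y, hY, hXY⟩ := exists_other hX hXne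
    have hYne : Y ≠ S \ {a, b, c} := by rintro rfl; exact hns hY.cn
    obtain ⟨u, hu, hu'⟩ := h.exists_ns_side ht hX hXne
    obtain ⟨v, hv, hv'⟩ := h.exists_ns_side ht hY hYne
    exact ⟨u, v, by rintro rfl; exact disjoint_left.1 hXY hu hv, hu', hv'⟩
  rcases main c hc with h1 | h1
  · rcases main d hd with h2 | h2
    exacts [⟨c, d, hcd, h1, h2⟩, h2]
  · exact h1

end Ctr

end PlanarP5

namespace PlanarP5

open scoped Classical
open Finset

variable {V : Type*} {G : SimpleGraph V} {S X Y Z T : Finset V}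

/-- `L` connects `c` and `d` outside `T`; it is empty if `c` and `d` are adjacent. -/
def Link (G : SimpleGraph V) (S T : Finset V) (c d : V) (L : Finset V) : Prop :=
  (L = ∅ ∧ G.Adj c d) ∨ (Sd G S T L ∧ (∃ x ∈ L, G.Adj c x) ∧ ∃ x ∈ L, G.Adj d x)

theorem exists_link {a b c₁ c₂ c₃ : V} (h : Cn G (S \ {a, b, c₃}))
    (h1 : c₁ ∈ S \ {a, b, c₃}) (h2 : c₂ ∈ S \ {a, b, c₃}) (h12 : c₁ ≠ c₂)
    (hT : ∀ v, v ∈ T ↔ v = a ∨ v = b ∨ v = c₁ ∨ v = c₂ ∨ v = c₃) : ∃ L, Link G S T c₁ c₂ L := by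
  by_contra! hno
  have hadj : ¬ G.Adj c₁ c₂ := fun hh => hno ∅ (Or.inl ⟨rfl, hh⟩)
  have hK : ∀ K, Sd G S T K → (∃ x ∈ K, G.Adj c₁ x) → ∀ x ∈ K, ¬ G.Adj c₂ x :=
    fun K hK hx x hxK hh =>
    hno K (Or.inr ⟨hK, hx, x, hxK, hh⟩)
  have hmem : ∀ v ∈ S \ {a, b, c₃}, v ≠ c₁ → v ≠ c₂ → v ∈ S \ T := by
    intro v hv h1 h2
    simp only [mem_sdiff, mem_insert, mem_singleton, not_or] at hv
    rw [mem_sdiff, hT]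
    tauto
  have ht := h.2 ((S \ {a, b, c₃}).filter fun v => v = c₁ ∨ ∃ K, Sd G S T K ∧
    (∃ x ∈ K, G.Adj c₁ x) ∧ v ∈ K) (filter_subset _ _) ⟨c₁, mem_filter.2 ⟨h1, Or.inl rfl⟩⟩ (by
      intro x hx y hy hxy
      refine mem_filter.2 ⟨hy, ?_⟩
      by_cases hy1 : y = c₁
      · exact Or.inl hy1
      right
      obtain ⟨hx, rfl | ⟨K, hKS, hcK, hxK⟩⟩ := mem_filter.1 hx
      · obtain ⟨K, hKS, hyK⟩ := exists_sd (G := G)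
          (hmem y hy hy1 (by rintro rfl; exact hadj hxy))
        exact ⟨K, hKS, ⟨y, hyK, hxy⟩, hyK⟩
      · exact ⟨K, hKS, hcK, hKS.closed x hxK y
          (hmem y hy hy1 (by rintro rfl; exact hK K hKS hcK x hxK hxy.symm)) hxy⟩)
  rw [← ht, mem_filter] at h2
  obtain ⟨-, h3 | ⟨K, hKS, -, h3⟩⟩ := h2
  · exact h12 h3.symm
  · exact hKS.not_mem h3 ((hT _).2 (by simp))

theorem Link.subset {c d : V} (h : Link G S T c d X) : X ⊆ S := by
  rcases h with ⟨rfl, -⟩ | ⟨h, -⟩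
  exacts [empty_subset _, h.subS]

theorem Link.disjoint {c d : V} (h : Link G S T c d X) : Disjoint X T := by
  rcases h with ⟨rfl, -⟩ | ⟨h, -⟩
  exacts [disjoint_empty_left _, h.disj]

theorem Link.cn {c d : V} (h : Link G S T c d X) : Cn G (insert c X) := by
  rcases h with ⟨rfl, -⟩ | ⟨h, ⟨x, hx, hcx⟩, -⟩
  exacts [cn_singleton _ _, h.cn.insert hx hcx]

theorem Link.tc {c d : V} (h : Link G S T c d X) : Tc G (insert c X) (insert d Y) := by
  rcases h with ⟨rfl, h⟩ | ⟨h, -, ⟨x, hx, hcx⟩⟩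
  exacts [tc_of_adj h (by simp) (by simp), tc_of_adj hcx.symm (by simp [hx]) (by simp)]

theorem Link.disjoint_link {c d e : V} (h : Link G S T c d X) (h' : Link G S T d e Y)
    (hno : ∀ K, Sd G S T K → (∃ x ∈ K, G.Adj c x) → (∃ x ∈ K, G.Adj d x) →
      (∃ x ∈ K, G.Adj e x) → False) : Disjoint X Y := by
  rcases h with ⟨rfl, -⟩ | ⟨h, hc, hd⟩
  · exact disjoint_empty_left _
  rcases h' with ⟨rfl, -⟩ | ⟨h', hd', he⟩
  · exact disjoint_empty_right _
  refine (h.eq_or_disjoint h').resolve_left ?_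
  rintro rfl
  exact hno _ h hc hd he

theorem Pl.no_three_ns (h : Pl G S) {a b c₁ c₂ c₃ : V} (n1 : Ns G S a b c₁) (n2 : Ns G S a b c₂)
    (n3 : Ns G S a b c₃) (h12 : c₁ ≠ c₂) (h13 : c₁ ≠ c₃) (h23 : c₂ ≠ c₃) : False := by
  have ha := n1.mem.1
  have hb := n1.mem.2.1
  have m1 := n1.mem.2.2
  have m2 := n2.mem.2.2
  have m3 := n3.mem.2.2
  have hab := n1.ab.ne
  have a1 := n1.ac.ne
  have a2 := n2.ac.ne
  have a3 := n3.ac.ne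
  have b1 := n1.bc.ne
  have b2 := n2.bc.ne
  have b3 := n3.bc.ne
  obtain ⟨T, hT⟩ : ∃ T : Finset V, ∀ v, v ∈ T ↔ v = a ∨ v = b ∨ v = c₁ ∨ v = c₂ ∨ v = c₃ :=
    ⟨{a, b, c₁, c₂, c₃}, by simp⟩
  have hno : ∀ K, Sd G S T K → (∃ x ∈ K, G.Adj c₁ x) → (∃ x ∈ K, G.Adj c₂ x) →
      (∃ x ∈ K, G.Adj c₃ x) → False := by
    rintro K hK ⟨x₁, hx₁, e1⟩ ⟨x₂, hx₂, e2⟩ ⟨x₃, hx₃, e3⟩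
    have hd : ∀ v, v ∈ T → Disjoint {v} K := fun v hv =>
      disjoint_singleton_left.2 fun hh => hK.not_mem hh hv
    refine h.no_k33 {a} {b} K {c₁} {c₂} {c₃} ⟨by simpa using ha, by simpa using hb, hK.subS,
        by simpa using m1, by simpa using m2, by simpa using m3⟩
      ⟨cn_singleton _ _, cn_singleton _ _, hK.cn, cn_singleton _ _, cn_singleton _ _,
        cn_singleton _ _⟩ ⟨by simpa using hab, hd _ (by simp [hT]), hd _ (by simp [hT])⟩
      (by simp [*, Ne.symm]) ⟨by simp [*, Ne.symm], by simp [*, Ne.symm], by simp [*, Ne.symm],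
        by simp [*, Ne.symm], by simp [*, Ne.symm], by simp [*, Ne.symm],
        (hd _ (by simp [hT])).symm, (hd _ (by simp [hT])).symm, (hd _ (by simp [hT])).symm⟩
      ⟨tc_of_adj n1.ac (by simp) (by simp), tc_of_adj n2.ac (by simp) (by simp),
        tc_of_adj n3.ac (by simp) (by simp), tc_of_adj n1.bc (by simp) (by simp),
        tc_of_adj n2.bc (by simp) (by simp), tc_of_adj n3.bc (by simp) (by simp),
        tc_of_adj e1.symm hx₁ (by simp), tc_of_adj e2.symm hx₂ (by simp),
        tc_of_adj e3.symm hx₃ (by simp)⟩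
  obtain ⟨L, hL⟩ := exists_link (T := T) n3.cn (c₁ := c₁) (c₂ := c₂) (by simp [*, Ne.symm])
    (by simp [*, Ne.symm]) h12 (by simp only [hT]; tauto)
  obtain ⟨M, hM⟩ := exists_link (T := T) n1.cn (c₁ := c₂) (c₂ := c₃) (by simp [*, Ne.symm])
    (by simp [*, Ne.symm]) h23 (by simp only [hT]; tauto)
  obtain ⟨N, hN⟩ := exists_link (T := T) n2.cn (c₁ := c₃) (c₂ := c₁) (by simp [*, Ne.symm])
    (by simp [*, Ne.symm]) h13.symm (by simp only [hT]; tauto)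
  have dLM := hL.disjoint_link hM hno
  have dMN := hM.disjoint_link hN fun K h1 h2 h3 h4 => hno K h1 h4 h2 h3
  have dNL := hN.disjoint_link hL fun K h1 h2 h3 h4 => hno K h1 h3 h4 h2
  have hd : ∀ {X c d} {v : V}, Link G S T c d X → v ∈ T → v ∉ X :=
    fun hX hv hh => disjoint_left.1 hX.disjoint hh hv
  have ta := (hT a).2 (by simp)
  have tb := (hT b).2 (by simp)
  have t1 := (hT c₁).2 (by simp)
  have t2 := (hT c₂).2 (by simp)
  have t3 := (hT c₃).2 (by simp)
  have hd' : ∀ {X c d} {v : V}, Link G S T c d X → v ∈ T → v ≠ c → Disjoint {v} (insert c X) :=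
    fun hX hv hvc => by simpa using ⟨hvc, hd hX hv⟩
  have hdd : ∀ {X Y : Finset V} {c d c' d' : V}, Link G S T c d X → Link G S T c' d' Y → c ∈ T →
      c' ∈ T → c ≠ c' → Disjoint X Y → Disjoint (insert c X) (insert c' Y) := by
    intro X Y c d c' d' hX hY hc hc' hcc hXY
    rw [disjoint_insert_left, disjoint_insert_right, mem_insert, not_or]
    exact ⟨⟨hcc, hd hY hc⟩, hd hX hc', hXY⟩
  exact h.no_k5 {a} {b} (insert c₁ L) (insert c₂ M) (insert c₃ N)
    ⟨by simpa using ha, by simpa using hb, insert_subset m1 hL.subset, insert_subset m2 hM.subset,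
      insert_subset m3 hN.subset⟩
    ⟨cn_singleton _ _, cn_singleton _ _, hL.cn, hM.cn, hN.cn⟩
    ⟨by simpa using hab, hd' hL ta a1, hd' hM ta a2, hd' hN ta a3, hd' hL tb b1, hd' hM tb b2,
      hd' hN tb b3, hdd hL hM t1 t2 h12 dLM, hdd hL hN t1 t3 h13 dNL.symm,
      hdd hM hN t2 t3 h23 dMN⟩
    ⟨tc_of_adj n1.ab (by simp) (by simp), tc_of_adj n1.ac (by simp) (by simp),
      tc_of_adj n2.ac (by simp) (by simp), tc_of_adj n3.ac (by simp) (by simp),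
      tc_of_adj n1.bc (by simp) (by simp), tc_of_adj n2.bc (by simp) (by simp),
      tc_of_adj n3.bc (by simp) (by simp), hL.tc, hN.tc.symm, hM.tc⟩

end PlanarP5

namespace PlanarP5

open scoped Classical
open Finset

variable {V : Type*}

/-- Every nonempty subset of `T` has a vertex of degree one. -/
def Fo (T : Finset (Finset V)) : Prop := ∀ D ⊆ T, D.Nonempty → ∃ v, #{e ∈ D | v ∈ e} = 1

theorem exists_spanning_forest {E : Finset (Finset V)} {W : Finset V} (hW : W.Nonempty)
    (h : ∀ U ⊆ W, U.Nonempty → U ≠ W → ∃ x ∈ U, ∃ y ∈ W, y ∉ U ∧ {x, y} ∈ E) :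
    ∃ T ⊆ E, Fo T ∧ #T + 1 = #W := by
  have key : ∀ k, k + 1 ≤ #W → ∃ U ⊆ W, #U = k + 1 ∧ ∃ T ⊆ E, (∀ e ∈ T, e ⊆ U) ∧ Fo T ∧ #T = k := by
    intro k
    induction k with
    | zero =>
      intro _
      obtain ⟨x, hx⟩ := hW
      exact ⟨{x}, by simpa using hx, by simp, ∅, by simp, by simp, fun D hD hne => by
        simp [subset_empty.1 hD] at hne, by simp⟩
    | succ k ih =>
      intro hk
      obtain ⟨U, hU, hUk, T, hT, hTU, hF, hTk⟩ := ih (by omega)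
      obtain ⟨x, hx, y, hy, hyU, hxy⟩ := h U hU (card_pos.1 (by omega)) (by rintro rfl; omega)
      have hn : ({x, y} : Finset V) ∉ T := fun hh => hyU (hTU _ hh (by simp))
      refine ⟨insert y U, insert_subset hy hU, by rw [card_insert_of_notMem hyU, hUk],
        insert {x, y} T, insert_subset hxy hT, ?_, ?_, by rw [card_insert_of_notMem hn, hTk]⟩
      · intro e he
        rcases mem_insert.1 he with rfl | he
        · simp [insert_subset_iff, hx]
        · exact (hTU e he).trans (subset_insert _ _)
      · intro D hD hne
        by_cases hD' : ({x, y} : Finset V) ∈ D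
        · refine ⟨y, card_eq_one.2 ⟨{x, y}, ?_⟩⟩
          ext e
          rw [mem_filter, mem_singleton]
          constructor
          · rintro ⟨h1, h2⟩
            rcases mem_insert.1 (hD h1) with h3 | h3
            exacts [h3, absurd (hTU e h3 h2) hyU]
          · rintro rfl
            exact ⟨hD', by simp⟩
        · refine hF D (fun e he => ?_) hne
          rcases mem_insert.1 (hD he) with rfl | h3
          exacts [absurd he hD', h3]
  have h1 := card_pos.2 hW
  obtain ⟨U, -, -, T, hT, -, hF, hTk⟩ := key (#W - 1) (by omega)
  exact ⟨T, hT, hF, by omega⟩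

/-- Adjacency of triangles across a common edge. -/
def dual (V : Type*) : SimpleGraph (Finset V) where
  Adj s t := s ≠ t ∧ #(s ∩ t) = 2
  symm := ⟨fun s t h => ⟨h.1.symm, by rw [inter_comm]; exact h.2⟩⟩
  loopless := ⟨fun s h => h.1 rfl⟩

/-- A connected family of triangles in which every edge is covered exactly twice. -/
structure Surf (C : Finset (Finset V)) : Prop where
  three : ∀ t ∈ C, #t = 3
  two : ∀ t ∈ C, ∀ e ⊆ t, #e = 2 → #{t ∈ C | e ⊆ t} = 2
  cn : Cn (dual V) C

/-- The edges of a family of triangles. -/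
noncomputable def edges (C : Finset (Finset V)) : Finset (Finset V) := C.biUnion (powersetCard 2)

theorem mem_edges {C : Finset (Finset V)} {e : Finset V} :
    e ∈ edges C ↔ ∃ t ∈ C, e ⊆ t ∧ #e = 2 := by simp [edges]

namespace Surf

variable {C : Finset (Finset V)}

theorem card_filter (h : Surf C) {e : Finset V} (he : e ∈ edges C) : #{t ∈ C | e ⊆ t} = 2 := by
  obtain ⟨t, ht, het, he2⟩ := mem_edges.1 he
  exact h.two t ht e het he2

theorem three_mul_card (h : Surf C) : 3 * #C = 2 * #(edges C) := by
  have h1 := sum_card_bipartiteAbove_eq_sum_card_bipartiteBelow (s := C) (t := edges C)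
    (fun t e => e ⊆ t)
  have h2 : ∀ e ∈ edges C, #(bipartiteBelow (fun t e => e ⊆ t) C e) = 2 := fun e he =>
    h.card_filter he
  have h3 : ∀ t ∈ C, #(bipartiteAbove (fun t e => e ⊆ t) (edges C) t) = 3 := by
    intro t ht
    have : bipartiteAbove (fun t e => e ⊆ t) (edges C) t = powersetCard 2 t := by
      ext e
      simp only [bipartiteAbove, mem_filter, mem_powersetCard, mem_edges]
      exact ⟨fun ⟨⟨_, _, _, h1⟩, h2⟩ => ⟨h2, h1⟩, fun ⟨h1, h2⟩ => ⟨⟨t, ht, h1, h2⟩, h1⟩⟩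
    rw [this, card_powersetCard, h.three t ht]
    rfl
  rw [sum_congr rfl h2, sum_congr rfl h3] at h1
  simpa [mul_comm] using h1

theorem even_boundary (h : Surf C) {A : Finset (Finset V)} (hA : A ⊆ C) (v : V) :
    Even #{e ∈ {e ∈ edges C | #{t ∈ A | e ⊆ t} = 1} | v ∈ e} := by
  have h1 := sum_card_bipartiteAbove_eq_sum_card_bipartiteBelow (s := A)
    (t := {e ∈ edges C | v ∈ e}) (fun t e => e ⊆ t)
  have h2 : Even (∑ t ∈ A, #(bipartiteAbove (fun t e => e ⊆ t) {e ∈ edges C | v ∈ e} t)) := by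
    refine even_sum _ fun t ht => ?_
    by_cases hv : v ∈ t
    · have : bipartiteAbove (fun t e => e ⊆ t) {e ∈ edges C | v ∈ e} t =
          (t.erase v).image fun y => {v, y} := by
        ext e
        simp only [bipartiteAbove, mem_filter, mem_image, mem_erase, mem_edges]
        constructor
        · rintro ⟨⟨⟨_, _, _, h1⟩, h2⟩, h3⟩
          obtain ⟨y, hy⟩ := card_eq_one.1 (show #(e.erase v) = 1 by rw [card_erase_of_mem h2, h1])
          have hy' : y ∈ e.erase v := by simp [hy]
          exact ⟨y, ⟨(mem_erase.1 hy').1, h3 (mem_erase.1 hy').2⟩, by rw [← insert_erase h2, hy]⟩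
        · rintro ⟨y, ⟨hyv, hy⟩, rfl⟩
          have : ({v, y} : Finset V) ⊆ t := by simp [insert_subset_iff, hv, hy]
          exact ⟨⟨⟨t, hA ht, this, card_pair hyv.symm⟩, by simp⟩, this⟩
      rw [this, card_image_of_injOn, card_erase_of_mem hv, h.three t (hA ht)]
      · decide
      · intro y hy z hz hyz
        have : y ∈ ({v, z} : Finset V) := by rw [← show ({v, y} : Finset V) = {v, z} from hyz]; simp
        simpa [(mem_erase.1 hy).1] using this
    · have : bipartiteAbove (fun t e => e ⊆ t) {e ∈ edges C | v ∈ e} t = ∅ := by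
        refine filter_eq_empty_iff.2 fun e he hh => hv (hh (mem_filter.1 he).2)
      rw [this]; simp
  rw [h1, even_sum_iff_even_card_odd] at h2
  convert h2 using 2
  ext e
  simp only [mem_filter, bipartiteBelow]
  constructor
  · rintro ⟨⟨h1, h2⟩, h3⟩
    exact ⟨⟨h1, h3⟩, by rw [h2]; decide⟩
  · rintro ⟨⟨h1, h3⟩, h4⟩
    refine ⟨⟨h1, ?_⟩, h3⟩
    have h5 := card_le_card (filter_subset_filter (fun t => e ⊆ t) hA)
    rw [h.card_filter h1] at h5
    obtain ⟨m, hm⟩ := h4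
    omega

theorem exists_boundary (h : Surf C) {A T : Finset (Finset V)} (hA : A ⊆ C) (hne : A.Nonempty)
    (hAC : A ≠ C) (hT : Fo T) : ∃ e ∈ edges C, e ∉ T ∧ #{t ∈ A | e ⊆ t} = 1 := by
  by_contra! hno
  have hsub : {e ∈ edges C | #{t ∈ A | e ⊆ t} = 1} ⊆ T := by
    intro e he
    by_contra heT
    exact hno e (mem_filter.1 he).1 heT (mem_filter.1 he).2
  obtain ⟨v, hv⟩ := hT _ hsub (by
    obtain ⟨t, ht, t', ht', htA, htt, h2⟩ := h.cn.exists_adj hA hne hAC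
    have he : t ∩ t' ∈ edges C := mem_edges.2 ⟨t, hA ht, inter_subset_left, h2⟩
    refine ⟨t ∩ t', mem_filter.2 ⟨he, ?_⟩⟩
    have h3 : ({u ∈ A | t ∩ t' ⊆ u}) ⊂ {u ∈ C | t ∩ t' ⊆ u} := by
      refine ⟨filter_subset_filter _ hA, fun hh => htA ?_⟩
      exact (mem_filter.1 (hh (mem_filter.2 ⟨ht', inter_subset_right⟩))).1
    have h4 := card_lt_card h3
    rw [h.card_filter he] at h4
    have h5 : 0 < #{u ∈ A | t ∩ t' ⊆ u} := card_pos.2 ⟨t, mem_filter.2 ⟨ht, inter_subset_left⟩⟩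
    omega)
  have := h.even_boundary hA v
  rw [hv] at this
  revert this
  decide

theorem exists_cotree (h : Surf C) {T : Finset (Finset V)} (hT : Fo T) :
    ∃ R ⊆ edges C, Disjoint R T ∧ #R + 1 = #C := by
  have key : ∀ k, k + 1 ≤ #C → ∃ A ⊆ C, #A = k + 1 ∧ ∃ R ⊆ edges C, Disjoint R T ∧ #R = k ∧
      ∀ e ∈ R, ∀ t ∈ C, e ⊆ t → t ∈ A := by
    intro k
    induction k with
    | zero =>
      intro _
      obtain ⟨x, hx⟩ := h.cn.1
      exact ⟨{x}, by simpa using hx, by simp, ∅, by simp, by simp, by simp, by simp⟩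
    | succ k ih =>
      intro hk
      obtain ⟨A, hA, hAk, R, hR, hRT, hRk, hcl⟩ := ih (by omega)
      obtain ⟨e, he, heT, he1⟩ := h.exists_boundary hA (card_pos.1 (by omega))
        (by rintro rfl; omega) hT
      have h2 := h.card_filter he
      obtain ⟨t, ht, htA⟩ : ∃ t ∈ ({t ∈ C | e ⊆ t} : Finset _),
          t ∉ ({t ∈ A | e ⊆ t} : Finset _) := by
        by_contra! hh
        have := card_le_card hh
        omega
      obtain ⟨htC, het⟩ := mem_filter.1 ht
      have htA' : t ∉ A := fun hh => htA (mem_filter.2 ⟨hh, het⟩)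
      have heR : e ∉ R := fun hh => htA' (hcl e hh t htC het)
      refine ⟨insert t A, insert_subset htC hA, by rw [card_insert_of_notMem htA', hAk],
        insert e R, insert_subset he hR, disjoint_insert_left.2 ⟨heT, hRT⟩,
        by rw [card_insert_of_notMem heR, hRk], ?_⟩
      intro f hf u hu hfu
      rcases mem_insert.1 hf with rfl | hf
      · have h3 : insert t {t ∈ A | f ⊆ t} = {t ∈ C | f ⊆ t} := by
          refine eq_of_subset_of_card_le (insert_subset ht (filter_subset_filter _ hA)) ?_
          rw [card_insert_of_notMem htA, he1, h2]
        have h4 : u ∈ insert t {t ∈ A | f ⊆ t} := by rw [h3]; exact mem_filter.2 ⟨hu, hfu⟩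
        rcases mem_insert.1 h4 with rfl | h4
        exacts [mem_insert_self _ _, mem_insert_of_mem (mem_filter.1 h4).1]
      · exact mem_insert_of_mem (hcl f hf u hu hfu)
  have h1 := card_pos.2 h.cn.1
  obtain ⟨A, -, -, R, hR, hRT, hRk, -⟩ := key (#C - 1) (by omega)
  exact ⟨R, hR, hRT, by omega⟩

theorem exists_edge_leaving (h : Surf C) {U : Finset V} (hU : U ⊆ C.biUnion id) (hne : U.Nonempty)
    (hUC : U ≠ C.biUnion id) : ∃ x ∈ U, ∃ y ∈ C.biUnion id, y ∉ U ∧ {x, y} ∈ edges C := by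
  by_contra! hno
  have hin : ∀ t ∈ C, ∀ x ∈ t, x ∈ U → t ⊆ U := by
    intro t ht x hx hxU y hy
    by_contra hyU
    exact hno x hxU y (mem_biUnion.2 ⟨t, ht, hy⟩) hyU
      (mem_edges.2 ⟨t, ht, by simp [insert_subset_iff, hx, hy],
        card_pair (by rintro rfl; exact hyU hxU)⟩)
  obtain ⟨x, hx⟩ := hne
  obtain ⟨t, ht, hxt⟩ := mem_biUnion.1 (hU hx)
  have h1 := h.cn.2 {t ∈ C | t ⊆ U} (filter_subset _ _)
    ⟨t, mem_filter.2 ⟨ht, hin t ht x hxt hx⟩⟩ (by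
    rintro s hs s' hs' ⟨-, h2⟩
    obtain ⟨y, hy⟩ := card_pos.1 (show 0 < #(s ∩ s') by omega)
    exact mem_filter.2 ⟨hs', hin s' hs' y (mem_inter.1 hy).2
      ((mem_filter.1 hs).2 (mem_inter.1 hy).1)⟩)
  refine hUC (subset_antisymm hU fun y hy => ?_)
  obtain ⟨s, hs, hys⟩ := mem_biUnion.1 hy
  rw [← h1] at hs
  exact (mem_filter.1 hs).2 hys

theorem three_mul_card_le (h : Surf C) : 3 * #(C.biUnion id) ≤ #(edges C) + 6 := by
  have hne : (C.biUnion id).Nonempty := by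
    obtain ⟨t, ht⟩ := h.cn.1
    obtain ⟨x, hx⟩ := card_pos.1 (show 0 < #t by rw [h.three t ht]; omega)
    exact ⟨x, mem_biUnion.2 ⟨t, ht, hx⟩⟩
  obtain ⟨T, hT, hF, hTc⟩ := exists_spanning_forest hne fun U => h.exists_edge_leaving
  obtain ⟨R, hR, hRT, hRc⟩ := h.exists_cotree hF
  have h1 := card_le_card (union_subset hR hT)
  rw [card_union_of_disjoint hRT] at h1
  have := h.three_mul_card
  omega

end Surf

end PlanarP5

namespace PlanarP5

open scoped Classical
open Finset

variable {V : Type*} {G : SimpleGraph V} {S W X Y Z T : Finset V}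

theorem card_le_ecard {E : Finset (Finset V)}
    (h : ∀ e ∈ E, ∃ a ∈ W, ∃ b ∈ W, G.Adj a b ∧ e = {a, b}) : #E ≤ ecard G W := by
  have h1 := sum_card_bipartiteAbove_eq_sum_card_bipartiteBelow (s := E) (t := W)
    (fun e x => x ∈ e)
  have h2 : ∀ e ∈ E, #(bipartiteAbove (fun e x => x ∈ e) W e) = 2 := by
    intro e he
    obtain ⟨a, ha, b, hb, hab, rfl⟩ := h e he
    rw [← card_pair hab.ne]
    congr 1
    ext x
    simp only [bipartiteAbove, mem_filter, mem_insert, mem_singleton]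
    exact ⟨fun hx => hx.2, fun hx => ⟨by rcases hx with rfl | rfl <;> assumption, hx⟩⟩
  have h3 : ∀ x ∈ W, #(bipartiteBelow (fun e x => x ∈ e) E x) ≤ #(nb G W x) := by
    intro x hx
    refine (card_le_card (t := (nb G W x).image fun y => {x, y}) fun e he => ?_).trans
      card_image_le
    obtain ⟨he, hxe⟩ := mem_filter.1 he
    obtain ⟨a, ha, b, hb, hab, rfl⟩ := h e he
    rw [mem_insert, mem_singleton] at hxe
    rcases hxe with rfl | rfl
    · exact mem_image.2 ⟨b, mem_nb.2 ⟨hb, hab⟩, rfl⟩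
    · exact mem_image.2 ⟨a, mem_nb.2 ⟨ha, hab.symm⟩, pair_comm _ _⟩
  have h4 := sum_le_sum h3
  rw [← h1, sum_congr rfl h2, sum_card_nb] at h4
  rw [sum_const, smul_eq_mul] at h4
  omega

theorem Ns.exists_third {a b x y z : V} (h : Ns G S x y z) (ha : a ∈ ({x, y, z} : Finset V))
    (hb : b ∈ ({x, y, z} : Finset V)) (hab : a ≠ b) :
    ∃ c, ({x, y, z} : Finset V) = {a, b, c} ∧ Ns G S a b c := by
  simp only [mem_insert, mem_singleton] at ha hb
  rcases ha with rfl | rfl | rfl <;> rcases hb with rfl | rfl | rfl <;>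
    first
      | exact absurd rfl hab
      | exact ⟨_, rfl, h⟩
      | exact ⟨_, by ext; simp; tauto, h.swap⟩
      | exact ⟨_, by ext; simp; tauto, h.swap'⟩
      | exact ⟨_, by ext; simp; tauto, h.swap'.swap⟩
      | exact ⟨_, by ext; simp; tauto, h.swap.swap'⟩
      | exact ⟨_, by ext; simp; tauto, h.swap.swap'.swap⟩

theorem Ns.tri {a b c : V} (h : Ns G S a b c) : Tri G S a b c := ⟨h.mem, h.ab, h.ac, h.bc⟩

namespace Ctr

theorem exists_surf (h : Ctr G S) : ∃ C : Finset (Finset V), Surf C ∧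
    (∀ t ∈ C, ∃ a b c, t = {a, b, c} ∧ Ns G S a b c) ∧
    ∀ a b c, Ns G S a b c → {a, b} ∈ edges C → {a, b, c} ∈ C := by
  set F := {t ∈ S.powerset | ∃ a b c, t = {a, b, c} ∧ Ns G S a b c} with hF
  have hFm : ∀ {a b c}, Ns G S a b c → {a, b, c} ∈ F := fun hn =>
    mem_filter.2 ⟨mem_powerset.2 hn.tri.sub, _, _, _, rfl, hn⟩
  obtain ⟨v, hv⟩ := card_pos.1 (show 0 < #S by have := h.nine; omega)
  obtain ⟨w, hw⟩ := card_pos.1 (show 0 < #(nb G S v) by have := h.three_le hv; omega)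
  obtain ⟨hw, hvw⟩ := mem_nb.1 hw
  obtain ⟨c, -, -, hn, -⟩ := h.exists_two_ns hv hw hvw
  obtain ⟨C, hCF, -, hC, hcl⟩ := exists_comp (dual V) (hFm hn)
  have hCn : ∀ t ∈ C, ∃ a b c, t = {a, b, c} ∧ Ns G S a b c := fun t ht =>
    (mem_filter.1 (hCF ht)).2
  have h3 : ∀ t ∈ C, #t = 3 := by
    intro t ht
    obtain ⟨a, b, c, rfl, hn⟩ := hCn t ht
    exact hn.tri.card
  have hcl' : ∀ a b c, Ns G S a b c → ∀ t ∈ C, {a, b} ⊆ t → {a, b, c} ∈ C := by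
    intro a b c hn t ht hab
    by_cases hne : t = {a, b, c}
    · exact hne ▸ ht
    refine hcl t ht _ (hFm hn) ⟨hne, le_antisymm ?_ ?_⟩
    · by_contra! hlt
      have e1 := eq_of_subset_of_card_le (inter_subset_left (s₁ := t) (s₂ := {a, b, c}))
        (by rw [h3 t ht]; omega)
      have e2 := eq_of_subset_of_card_le (inter_subset_right (s₁ := t) (s₂ := {a, b, c}))
        (by rw [hn.tri.card]; omega)
      exact hne (e1.symm.trans e2)
    · rw [← card_pair hn.ab.ne]
      exact card_le_card (subset_inter hab (by simp [insert_subset_iff]))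
  refine ⟨C, ⟨h3, ?_, hC⟩, hCn, fun a b c hn he => ?_⟩
  · intro t ht e het he2
    obtain ⟨a, b, hab, rfl⟩ := card_eq_two.1 he2
    have hthird : ∀ t ∈ C, {a, b} ⊆ t → ∃ c, t = {a, b, c} ∧ Ns G S a b c := by
      intro t ht hab'
      obtain ⟨x, y, z, rfl, hn⟩ := hCn t ht
      exact hn.exists_third (hab' (by simp)) (hab' (by simp)) hab
    obtain ⟨c, d, hcd, hc, hd⟩ : ∃ c d, c ≠ d ∧ Ns G S a b c ∧ Ns G S a b d := by
      obtain ⟨c, _, hc⟩ := hthird t ht het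
      exact h.exists_two_ns hc.mem.1 hc.mem.2.1 hc.ab
    refine card_eq_two.2 ⟨{a, b, c}, {a, b, d}, ?_, ?_⟩
    · intro hh
      have : c ∈ ({a, b, d} : Finset V) := by rw [← hh]; simp
      simp only [mem_insert, mem_singleton] at this
      rcases this with h' | h' | h'
      exacts [hc.ac.ne' h', hc.bc.ne' h', hcd h']
    · ext s
      simp only [mem_filter, mem_insert, mem_singleton]
      constructor
      · rintro ⟨hs, hab'⟩
        obtain ⟨x, rfl, hx⟩ := hthird s hs hab'
        by_contra! hno
        exact h.kl.pl.no_three_ns hc hd hx hcd (by rintro rfl; exact hno.1 rfl)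
          (by rintro rfl; exact hno.2 rfl)
      · rintro (rfl | rfl)
        exacts [⟨hcl' _ _ _ hc t ht het, by simp [insert_subset_iff]⟩,
          ⟨hcl' _ _ _ hd t ht het, by simp [insert_subset_iff]⟩]
  · obtain ⟨t, ht, het, -⟩ := mem_edges.1 he
    exact hcl' a b c hn t ht het

/-- A minimal counterexample is a triangulation. -/
theorem three_mul_le (h : Ctr G S) : 3 * #S ≤ ecard G S + 6 := by
  obtain ⟨C, hC, hCn, hcl⟩ := h.exists_surf
  have h1 := hC.three_mul_card_le
  set W := C.biUnion id with hWdef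
  have hWS : W ⊆ S := by
    intro v hv
    obtain ⟨t, ht, hvt⟩ := mem_biUnion.1 hv
    obtain ⟨a, b, c, rfl, hn⟩ := hCn t ht
    exact hn.tri.sub hvt
  have hE : ∀ e ∈ edges C, ∃ a ∈ W, ∃ b ∈ W, G.Adj a b ∧ e = {a, b} := by
    intro e he
    obtain ⟨t, ht, het, he2⟩ := mem_edges.1 he
    obtain ⟨a, b, hab, rfl⟩ := card_eq_two.1 he2
    obtain ⟨x, y, z, rfl, hn⟩ := hCn t ht
    obtain ⟨c, -, hn'⟩ := hn.exists_third (het (by simp)) (het (by simp)) hab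
    exact ⟨a, mem_biUnion.2 ⟨_, ht, het (by simp)⟩, b, mem_biUnion.2 ⟨_, ht, het (by simp)⟩, hn'.ab,
      rfl⟩
  have hW4 : 4 ≤ #W := by
    obtain ⟨t, ht⟩ := hC.cn.1
    have ht3 := hC.three t ht
    have htW : t ⊆ W := fun v hv => mem_biUnion.2 ⟨t, ht, hv⟩
    by_contra! hlt
    have hW : W = t := (eq_of_subset_of_card_le htW (by omega)).symm
    obtain ⟨e, he, he2⟩ := exists_subset_card_eq (show 2 ≤ #t by omega)
    have h2 := hC.two t ht e he he2
    have h3 : {s ∈ C | e ⊆ s} ⊆ {t} := by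
      intro s hs
      have hs' := (mem_filter.1 hs).1
      rw [mem_singleton]
      refine eq_of_subset_of_card_le (hW ▸ fun v hv => mem_biUnion.2 ⟨s, hs', hv⟩) ?_
      rw [ht3, hC.three s hs']
    have h4 := card_le_card h3
    rw [h2, card_singleton] at h4
    omega
  have h2 := card_le_ecard hE
  have hpW := h.kl.pl.mono (le_refl G) hWS
  have h3 := hpW.ecard_le (by omega)
  have hall : ∀ a ∈ W, ∀ b ∈ W, G.Adj a b → {a, b} ∈ edges C := by
    intro a ha b hb hab
    by_contra hn
    have h4 := card_le_ecard (G := G.deleteEdges {s(a, b)}) (W := W) (E := edges C) (by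
      intro e he
      obtain ⟨x, hx, y, hy, hxy, rfl⟩ := hE e he
      refine ⟨x, hx, y, hy, ?_, rfl⟩
      rw [deleteEdges_adj]
      refine ⟨hxy, fun hh => hn ?_⟩
      rw [Set.mem_singleton_iff, Sym2.eq_iff] at hh
      rcases hh with ⟨rfl, rfl⟩ | ⟨rfl, rfl⟩
      exacts [he, pair_comm x y ▸ he])
    have h5 := ecard_deleteEdge ha hb hab
    omega
  by_cases hWS' : W = S
  · rw [← hWS']; omega
  exfalso
  obtain ⟨x, hxS, hxW⟩ := not_subset.1 fun hh => hWS' (subset_antisymm hWS hh)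
  obtain ⟨K, hK, hxK⟩ := exists_sd (G := G) (mem_sdiff.2 ⟨hxS, hxW⟩)
  set N := {v ∈ W | ∃ z ∈ K, G.Adj z v} with hN
  have hNW : N ⊆ W := filter_subset _ _
  have hKN : Sd G S N K := by
    refine ⟨fun v hv => mem_sdiff.2 ⟨hK.subS hv, fun hh => hK.not_mem hv (hNW hh)⟩, hK.cn,
      fun u hu v hv huv => ?_⟩
    obtain ⟨hvS, hvN⟩ := mem_sdiff.1 hv
    exact hK.closed u hu v
      (mem_sdiff.2 ⟨hvS, fun hvW => hvN (mem_filter.2 ⟨hvW, u, hu, huv⟩)⟩) huv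
  have hKNe : #N < #W → K ≠ S \ N := by
    intro hlt hh
    obtain ⟨w, hw, hwN⟩ := exists_mem_notMem_of_card_lt_card hlt
    exact hK.not_mem (hh ▸ mem_sdiff.2 ⟨hWS hw, hwN⟩ : w ∈ K) hw
  have hN3 : #N = 3 := by
    apply le_antisymm
    · have e1 := ecard_con (G := G) (a := x) (R := K.erase x) hxW
      rw [insert_erase hxK, ← hN] at e1
      have e2 := ((h.kl.pl.con (a := x) (R := K.erase x) ((erase_subset _ _).trans hK.subS)
        (by simp) (by rw [insert_erase hxK]; exact hK.cn)).mono le_rfl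
        (S' := insert x W) (by
          refine insert_subset (mem_sdiff.2 ⟨hxS, by simp⟩) fun v hv => mem_sdiff.2 ⟨hWS hv, ?_⟩
          exact fun hh => hK.not_mem (mem_of_mem_erase hh) hv)).ecard_le (by
          rw [card_insert_of_notMem hxW]; omega)
      rw [card_insert_of_notMem hxW] at e2
      omega
    · by_contra! hlt
      exact hKNe (by omega) (h.eq_sdiff (hNW.trans hWS) (by omega) hKN)
  have hclq : ∀ p ∈ N, ∀ q ∈ N, p ≠ q → G.Adj p q := by
    intro p hp q hq hpq
    by_contra hno
    obtain ⟨hpW, z, hz, hzp⟩ := mem_filter.1 hp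
    obtain ⟨hqW, z', hz', hzq⟩ := mem_filter.1 hq
    have hpK : p ∉ K := fun hh => hK.not_mem hh hpW
    have e1 : (con G p K).Adj p q := ⟨hpq, Or.inr (Or.inl ⟨rfl, z', hz', hzq⟩)⟩
    have e2 := ecard_add_one_le (G := G) (W := W) (fun _ _ _ _ hh => le_con G p K hh) hpW hqW e1 hno
    have e3 := ((h.kl.pl.con (a := p) (R := K) hK.subS hpK (hK.cn.insert hz hzp.symm)).mono le_rfl
      (S' := W) (fun v hv => mem_sdiff.2 ⟨hWS hv, fun hh => hK.not_mem hh hv⟩)).ecard_le (by omega)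
    omega
  obtain ⟨p, q, r, hpq, hpr, hqr, hNe⟩ := card_eq_three.1 hN3
  have mp : p ∈ N := by simp [hNe]
  have mq : q ∈ N := by simp [hNe]
  have mr : r ∈ N := by simp [hNe]
  have hne := hKNe (by omega)
  rw [hNe] at hKN hne
  obtain ⟨c, hc, hn⟩ := h.exists_ns_side ⟨⟨hWS (hNW mp), hWS (hNW mq), hWS (hNW mr)⟩,
    hclq p mp q mq hpq, hclq p mp r mr hpr, hclq q mq r mr hqr⟩ hKN hne
  have := hcl p q c hn (hall p (hNW mp) q (hNW mq) hn.ab)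
  exact hK.not_mem hc (mem_biUnion.2 ⟨_, this, by simp⟩)

end Ctr

end PlanarP5

namespace PlanarP5

open scoped Classical
open Finset

variable {V : Type*} {G : SimpleGraph V} {S X Y Z T : Finset V}

/-- The entry of an adjacency table whose rows are bit masks. -/
def bit (R : List ℕ) (i j : ℕ) : Bool := (R.getD i 0).testBit j

/-- Boolean existential quantification over `{0, …, n - 1}`. -/
def exB : ℕ → (ℕ → Bool) → Bool
  | 0, _ => false
  | n + 1, p => p n || exB n p

/-- Boolean universal quantification over `{0, …, n - 1}`. -/
def allB : ℕ → (ℕ → Bool) → Bool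
  | 0, _ => true
  | n + 1, p => p n && allB n p

/-- Add a vertex `m` with neighbourhood `N` to the adjacency table `F`. -/
def ext (m : ℕ) (F : ℕ → ℕ → Bool) (N : ℕ → Bool) (i j : ℕ) : Bool :=
  bif Nat.beq i m then (bif Nat.beq j m then false else N j)
  else bif Nat.beq j m then N i else F i j

/-- Whether the table `F` contains an induced path on five vertices. -/
def hasPath (m : ℕ) (F : ℕ → ℕ → Bool) : Bool :=
  exB m fun a => exB m fun b => F a b && exB m fun c => (F b c && !F a c) &&
    exB m fun d => (F c d && !F a d && !F b d) && exB m fun e =>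
      F d e && !F a e && !F b e && !F c e

/-- Whether `u` differs from all of `x`, `y`, `a`, `b`, `c`. -/
def offB (a b c x y u : ℕ) : Bool :=
  !Nat.beq u x && !Nat.beq u y && !Nat.beq u a && !Nat.beq u b && !Nat.beq u c

/-- Whether contracting at most one edge of the table `F` yields a graph containing `K₃,₃`. -/
def hasK33 (m : ℕ) (F : ℕ → ℕ → Bool) : Bool :=
  exB m fun a => exB a fun b => exB b fun c =>
    exB m fun x => (F a x && F b x && F c x) && exB x fun y => (F a y && F b y && F c y) &&
      exB m fun u => offB a b c x y u && exB m fun v =>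
        (Nat.beq u v || F u v) && offB a b c x y v &&
          (F a u || F a v) && (F b u || F b v) && (F c u || F c v)

/-- The degree of `v` in the table `F`. -/
def degB (m : ℕ) (F : ℕ → ℕ → Bool) (v : ℕ) : ℕ :=
  Nat.rec 0 (fun j d => bif F v j then d + 1 else d) m

/-- Extend the partial isomorphism `s`, defined below `k`, to one defined below `n + k`. -/
def search (F : ℕ → ℕ → Bool) (R : List ℕ) (m : ℕ) : ℕ → ℕ → (ℕ → ℕ) → Bool
  | 0, _, _ => true
  | n + 1, k, s => exB m fun v => Nat.beq (degB m F v) (degB m (bit R) k) &&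
      allB k (fun i => !Nat.beq (s i) v && (F (s i) v == bit R i k)) &&
        search F R m n (k + 1) fun i => bif Nat.beq i k then v else s i

/-- Whether the table `F` is symmetric and irreflexive. -/
def symB (m : ℕ) (F : ℕ → ℕ → Bool) : Bool :=
  allB m fun i => !F i i && allB i fun j => F i j == F j i

/-- Whether the table `F` has a forbidden configuration or is isomorphic to one of the tables in
`L`. -/
def good (m : ℕ) (F : ℕ → ℕ → Bool) (L : List (List ℕ)) : Bool :=
  hasPath m F || hasK33 m F || L.any fun R => search F R m m 0 (fun _ => 0) && symB m (bit R)

/-- Whether adding a vertex of degree three to the table `R` yields only good tables. -/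
def check3 (m : ℕ) (R : List ℕ) (L : List (List ℕ)) : Bool :=
  allB m fun p => allB p fun q => !bit R p q || allB q fun r => !(bit R p r && bit R q r) ||
    good (m + 1) (ext m (bit R) fun j => Nat.beq j p || Nat.beq j q || Nat.beq j r) L

/-- Whether replacing an edge of the table `R` by a vertex of degree four yields only good
tables. -/
def check4 (m : ℕ) (R : List ℕ) (L : List (List ℕ)) : Bool :=
  allB m fun p => allB p fun r => !bit R p r || allB m fun q => !(bit R p q && bit R r q) ||
    allB q fun s => !(bit R p s && bit R r s) ||
    good (m + 1) (ext m (fun i j => bit R i j &&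
      !((Nat.beq i p && Nat.beq j r) || (Nat.beq i r && Nat.beq j p)))
      fun j => Nat.beq j p || Nat.beq j r || Nat.beq j q || Nat.beq j s) L

/-- Whether both ways of adding a vertex to a table in `L` yield only graphs that are forbidden
or listed in the second family of tables. -/
def check (m : ℕ) (L L' : List (List ℕ)) : Bool :=
  L.all fun R => check3 m R L' && check4 m R L'

end PlanarP5

namespace PlanarP5

open scoped Classical
open Finset

variable {V : Type*} {G : SimpleGraph V} {S X Y Z T : Finset V}

theorem natBeq_eq_decide (i j : ℕ) : Nat.beq i j = decide (i = j) := by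
  by_cases h : i = j
  · simp [h]
  · rw [decide_eq_false h, ← Bool.not_eq_true]
    exact fun hh => h (Nat.eq_of_beq_eq_true hh)

theorem exB_iff {n : ℕ} {p : ℕ → Bool} : exB n p = true ↔ ∃ i < n, p i = true := by
  induction n with
  | zero => simp [exB]
  | succ n ih =>
    rw [exB, Bool.or_eq_true, ih]
    constructor
    · rintro (h | ⟨i, hi, h⟩)
      exacts [⟨n, by omega, h⟩, ⟨i, by omega, h⟩]
    · rintro ⟨i, hi, h⟩
      rcases Nat.lt_succ_iff_lt_or_eq.1 hi with hi | rfl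
      exacts [Or.inr ⟨i, hi, h⟩, Or.inl h]

theorem allB_iff {n : ℕ} {p : ℕ → Bool} : allB n p = true ↔ ∀ i < n, p i = true := by
  induction n with
  | zero => simp [allB]
  | succ n ih =>
    rw [allB, Bool.and_eq_true, ih]
    constructor
    · rintro ⟨h, h'⟩ i hi
      rcases Nat.lt_succ_iff_lt_or_eq.1 hi with hi | rfl
      exacts [h' i hi, h]
    · exact fun h => ⟨h n (by omega), fun i hi => h i (by omega)⟩

/-- `f` enumerates `S`, and the table `F` describes adjacency. -/
structure Tbl (G : SimpleGraph V) (S : Finset V) (m : ℕ) (F : ℕ → ℕ → Bool) (f : ℕ → V) :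
    Prop where
  mem : ∀ i < m, f i ∈ S
  surj : ∀ v ∈ S, ∃ i < m, f i = v
  inj : ∀ i < m, ∀ j < m, f i = f j → i = j
  adj : ∀ i < m, ∀ j < m, G.Adj (f i) (f j) ↔ F i j = true

theorem search_spec {F : ℕ → ℕ → Bool} {R : List ℕ} {m n k : ℕ} {s : ℕ → ℕ}
    (h : search F R m n k s = true) (hs : ∀ i < k, s i < m)
    (ha : ∀ j < k, ∀ i < j, s i ≠ s j ∧ F (s i) (s j) = bit R i j) :
    ∃ s' : ℕ → ℕ, (∀ i < n + k, s' i < m) ∧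
      ∀ j < n + k, ∀ i < j, s' i ≠ s' j ∧ F (s' i) (s' j) = bit R i j := by
  induction n generalizing k s with
  | zero => exact ⟨s, by simpa using hs, by simpa using ha⟩
  | succ n ih =>
    rw [search, exB_iff] at h
    obtain ⟨v, hv, h⟩ := h
    simp only [Bool.and_eq_true, allB_iff] at h
    obtain ⟨⟨-, h1⟩, h2⟩ := h
    rw [show n + 1 + k = n + (k + 1) by ring]
    refine ih h2 (fun i hi => ?_) fun j hj i hi => ?_
    · by_cases hik : i = k
      · simpa [natBeq_eq_decide, hik] using hv
      · simpa [natBeq_eq_decide, hik] using hs i (by omega)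
    · rcases Nat.lt_succ_iff_lt_or_eq.1 hj with hj | rfl
      · simpa [natBeq_eq_decide, show i ≠ k by omega, hj.ne] using ha j hj i hi
      · simpa [natBeq_eq_decide, hi.ne] using h1 i hi

namespace Tbl

variable {m : ℕ} {F : ℕ → ℕ → Bool} {f : ℕ → V}

theorem ne (h : Tbl G S m F f) {i j : ℕ} (hi : i < m) (hj : j < m) (hij : i ≠ j) : f i ≠ f j :=
  fun hh => hij (h.inj i hi j hj hh)

theorem not_hasPath (h : Tbl G S m F f) (hp : NoP5 G S) : hasPath m F = false := by
  by_contra hh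
  rw [Bool.not_eq_false] at hh
  simp only [hasPath, exB_iff, Bool.and_eq_true, Bool.not_eq_true'] at hh
  obtain ⟨a, ha, b, hb, hab, c, hc, ⟨hbc, hac⟩, d, hd, ⟨⟨hcd, had⟩, hbd⟩, e, he, ⟨⟨hde, hae⟩, hbe⟩,
    hce⟩ := hh
  apply hp _ (h.mem a ha) _ (h.mem b hb) _ (h.mem c hc) _ (h.mem d hd) _ (h.mem e he) <;>
    rw [h.adj] <;> first | assumption | simp [*]

theorem not_hasK33 (h : Tbl G S m F f) (hp : Pl G S) : hasK33 m F = false := by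
  by_contra hh
  rw [Bool.not_eq_false] at hh
  simp only [hasK33, offB, exB_iff, Bool.and_eq_true, Bool.or_eq_true, Bool.not_eq_true',
    natBeq_eq_decide, decide_eq_true_iff, decide_eq_false_iff_not, ← ne_eq] at hh
  obtain ⟨a, ha, b, hb, c, hc, x, hx, ⟨⟨hax, hbx⟩, hcx⟩, y, hy, ⟨⟨hay, hby⟩, hcy⟩, u, hu,
    ⟨⟨⟨⟨hux, huy⟩, hua⟩, hub⟩, huc⟩, v, hv, ⟨⟨⟨huv, ⟨⟨⟨⟨hvx, hvy⟩, hva⟩, hvb⟩, hvc⟩⟩, hau⟩, hbu⟩,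
    hcu⟩ := hh
  have hb' : b < m := by omega
  have hc' : c < m := by omega
  have hy' : y < m := by omega
  rw [← h.adj _ (by assumption) _ (by assumption)] at hax hbx hcx hay hby hcy huv
  rw [← h.adj _ (by assumption) _ (by assumption), ← h.adj _ (by assumption) _ (by assumption)]
    at hau hbu hcu
  refine hp.no_k33 {f a} {f b} {f c} {f x} {f y} {f u, f v} ?_ ⟨cn_singleton G _, cn_singleton G _,
    cn_singleton G _, cn_singleton G _, cn_singleton G _, ?_⟩ ?_ ?_ ?_ ?_
  · simp [insert_subset_iff, h.mem, *]
  · rcases huv with rfl | huv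
    · simp [cn_singleton]
    · exact cn_pair huv
  · simp only [disjoint_singleton]
    refine ⟨?_, ?_, ?_⟩ <;> apply h.ne <;> first | assumption | omega
  · simp only [disjoint_singleton, disjoint_insert_right, mem_singleton]
    refine ⟨?_, ⟨?_, ?_⟩, ?_, ?_⟩ <;> apply h.ne <;> first | assumption | omega
  · simp only [disjoint_singleton, disjoint_insert_right, mem_singleton]
    refine ⟨hax.ne, hay.ne, ⟨?_, ?_⟩, hbx.ne, hby.ne, ⟨?_, ?_⟩, hcx.ne, hcy.ne, ?_, ?_⟩ <;>
      apply h.ne <;> first | assumption | omega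
  · simp [Tc, *]

theorem of_search (h : Tbl G S m F f) (hS : #S = m) {R : List ℕ}
    (hs : search F R m m 0 (fun _ => 0) = true) (hR : symB m (bit R) = true) :
    ∃ f', Tbl G S m (bit R) f' := by
  obtain ⟨s, h1, h2⟩ := search_spec hs (by simp) (by simp)
  simp only [add_zero] at h1 h2
  have hne : ∀ i < m, ∀ j < m, i ≠ j → s i ≠ s j := by
    intro i hi j hj hij
    rcases lt_or_gt_of_ne hij with hij | hij
    · exact (h2 j hj i hij).1
    · exact (h2 i hi j hij).1.symm
  have hinj : ∀ i < m, ∀ j < m, f (s i) = f (s j) → i = j := fun i hi j hj hh => by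
    by_contra hij
    exact hne i hi j hj hij (h.inj _ (h1 i hi) _ (h1 j hj) hh)
  simp only [symB, allB_iff, Bool.and_eq_true, Bool.not_eq_true', beq_iff_eq] at hR
  refine ⟨f ∘ s, fun i hi => h.mem _ (h1 i hi), fun v hv => ?_, hinj, fun i hi j hj => ?_⟩
  · have : (range m).image (f ∘ s) = S := by
      refine eq_of_subset_of_card_le (fun x hx => ?_) ?_
      · obtain ⟨i, hi, rfl⟩ := mem_image.1 hx
        exact h.mem _ (h1 i (mem_range.1 hi))
      · rw [card_image_of_injOn, card_range, hS]
        intro i hi j hj hij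
        exact hinj i (by simpa using hi) j (by simpa using hj) hij
    rw [← this] at hv
    obtain ⟨i, hi, rfl⟩ := mem_image.1 hv
    exact ⟨i, mem_range.1 hi, rfl⟩
  · rcases lt_trichotomy i j with hij | rfl | hij
    · rw [← (h2 j hj i hij).2]
      exact h.adj _ (h1 i hi) _ (h1 j hj)
    · simp [(hR i hi).1]
    · rw [(hR i hi).2 j hij, ← (h2 i hi j hij).2, G.adj_comm]
      exact h.adj _ (h1 j hj) _ (h1 i hi)

theorem of_good (h : Tbl G S m F f) (hS : #S = m) (hk : Kl G S) {L : List (List ℕ)}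
    (hg : good m F L = true) : ∃ R ∈ L, ∃ f', Tbl G S m (bit R) f' := by
  rw [good, h.not_hasPath hk.p5, h.not_hasK33 hk.pl] at hg
  simp only [Bool.false_or, List.any_eq_true, Bool.and_eq_true] at hg
  obtain ⟨R, hR, h1, h2⟩ := hg
  exact ⟨R, hR, h.of_search hS h1 h2⟩

theorem ext {y : V} (hy : y ∈ S) {N : ℕ → Bool} (h : Tbl G (S.erase y) m F f)
    (hN : ∀ i < m, G.Adj y (f i) ↔ N i = true) :
    Tbl G S (m + 1) (ext m F N) fun i => if i = m then y else f i := by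
  have hne : ∀ i < m, f i ≠ y := fun i hi => (mem_erase.1 (h.mem i hi)).1
  refine ⟨fun i hi => ?_, fun v hv => ?_, fun i hi j hj hij => ?_, fun i hi j hj => ?_⟩
  · split_ifs with him
    · exact hy
    · exact (mem_erase.1 (h.mem i (by omega))).2
  · by_cases hvy : v = y
    · exact ⟨m, by omega, by simp [hvy]⟩
    · obtain ⟨i, hi, rfl⟩ := h.surj v (mem_erase.2 ⟨hvy, hv⟩)
      exact ⟨i, by omega, by simp [hi.ne]⟩
  · rcases Nat.lt_succ_iff_lt_or_eq.1 hi with hi | rfl <;>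
      rcases Nat.lt_succ_iff_lt_or_eq.1 hj with hj | rfl
    · exact h.inj i hi j hj (by simpa [hi.ne, hj.ne] using hij)
    · exact absurd (by simpa [hi.ne] using hij) (hne i hi)
    · exact absurd (by simpa [hj.ne] using hij.symm) (hne j hj)
    · rfl
  · rcases Nat.lt_succ_iff_lt_or_eq.1 hi with hi | rfl <;>
      rcases Nat.lt_succ_iff_lt_or_eq.1 hj with hj | rfl
    · simpa [PlanarP5.ext, natBeq_eq_decide, hi.ne, hj.ne] using h.adj i hi j hj
    · simpa [PlanarP5.ext, natBeq_eq_decide, hi.ne, G.adj_comm] using hN i hi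
    · simpa [PlanarP5.ext, natBeq_eq_decide, hj.ne] using hN j hj
    · simp [PlanarP5.ext]

end Tbl

/-- Triangulations among the plane `P₅`-free graphs. -/
structure Mt (G : SimpleGraph V) (S : Finset V) : Prop where
  kl : Kl G S
  tri : 3 * #S ≤ ecard G S + 6

namespace Mt

theorem three_le (h : Mt G S) (h4 : 4 ≤ #S) {y : V} (hy : y ∈ S) : 3 ≤ #(nb G S y) := by
  have h1 := ecard_erase (G := G) hy
  have h2 := card_erase_of_mem hy
  have h3 := (h.kl.mono (erase_subset y S)).pl.ecard_le (by omega)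
  have := h.tri
  omega

theorem two_le_cnb (h : Mt G S) (h4 : 4 ≤ #S) {a b : V} (ha : a ∈ S) (hb : b ∈ S)
    (hab : G.Adj a b) : 2 ≤ #(cnb G S a b) := by
  have h1 := ecard_con_edge ha hb hab
  have h2 := card_erase_of_mem hb
  rw [← sdiff_singleton_eq_erase] at h2
  have h3 := (h.kl.con ha (singleton_subset_iff.2 hb) (by simpa using hab.ne)
    (cn_pair hab)).pl.ecard_le (by omega)
  have := h.tri
  omega

theorem exists_le_four (h : Mt G S) (h3 : 3 ≤ #S) (h9 : #S < 12) : ∃ y ∈ S, #(nb G S y) ≤ 4 := by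
  by_contra! hh
  have h1 := card_nsmul_le_sum S (fun y => #(nb G S y)) 5 fun y hy => hh y hy
  rw [sum_card_nb, smul_eq_mul] at h1
  have := h.kl.pl.ecard_le h3
  omega

end Mt

end PlanarP5

namespace PlanarP5

open scoped Classical
open Finset

variable {V : Type*} {G : SimpleGraph V} {S X Y Z T : Finset V}

theorem exists_gt_of_card_eq_two {I : Finset ℕ} (h : #I = 2) : ∃ p q, q < p ∧ I = {p, q} := by
  obtain ⟨a, b, hab, rfl⟩ := card_eq_two.1 h
  rcases lt_or_gt_of_ne hab with hab | hab
  exacts [⟨b, a, hab, pair_comm _ _⟩, ⟨a, b, hab, rfl⟩]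

theorem exists_gt_of_card_eq_three {I : Finset ℕ} (h : #I = 3) :
    ∃ p q r, q < p ∧ r < q ∧ I = {p, q, r} := by
  have hI : I.Nonempty := card_pos.1 (by omega)
  have hp := max'_mem I hI
  obtain ⟨q, r, hrq, hI'⟩ := exists_gt_of_card_eq_two (I := I.erase (I.max' hI))
    (by rw [card_erase_of_mem hp, h])
  have hq : q ∈ I.erase (I.max' hI) := by simp [hI']
  exact ⟨I.max' hI, q, r, lt_max'_of_mem_erase_max' _ _ hq, hrq, by rw [← hI', insert_erase hp]⟩

namespace Mt

theorem deg_three (h : Mt G S) (h4 : 4 ≤ #S) {y : V} (hy : y ∈ S) (h3 : #(nb G S y) = 3) :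
    Mt G (S.erase y) ∧ ∀ p ∈ nb G S y, ∀ q ∈ nb G S y, p ≠ q → G.Adj p q := by
  refine ⟨⟨h.kl.mono (erase_subset y S), ?_⟩, fun p hp q hq hpq => ?_⟩
  · have h1 := ecard_erase (G := G) hy
    have h2 := card_erase_of_mem hy
    have := h.tri
    omega
  · obtain ⟨hpS, hyp⟩ := mem_nb.1 hp
    have h1 := h.two_le_cnb h4 hy hpS hyp
    have h2 : cnb G S y p ⊆ (nb G S y).erase p := fun x hx => by
      rw [mem_cnb] at hx
      exact mem_erase.2 ⟨hx.2.2.ne', mem_nb.2 ⟨hx.1, hx.2.1⟩⟩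
    have h3 := eq_of_subset_of_card_le h2 (by rw [card_erase_of_mem hp]; omega)
    have : q ∈ cnb G S y p := h3 ▸ mem_erase.2 ⟨hpq.symm, hq⟩
    exact (mem_cnb.1 this).2.2

theorem deg_four (h : Mt G S) (h4 : 4 ≤ #S) {y : V} (hy : y ∈ S) (hd : #(nb G S y) = 4) :
    ∃ a ∈ nb G S y, ∃ b ∈ nb G S y, a ≠ b ∧ ¬ G.Adj a b ∧
      (∀ c ∈ nb G S y, c ≠ a → c ≠ b → G.Adj a c ∧ G.Adj b c) ∧
      Mt (con G a {y}) (S.erase y) ∧ ∀ u ∈ S.erase y, ∀ v ∈ S.erase y,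
        ((con G a {y}).Adj u v ↔ G.Adj u v ∨ (u = a ∧ v = b) ∨ (u = b ∧ v = a)) := by
  obtain ⟨a, ha, b, hb, hab, nab⟩ := h.kl.pl.no_k4_nb hy Subset.rfl (by omega)
  have key : ∀ a b : V, a ∈ nb G S y → b ∈ nb G S y → a ≠ b → ¬ G.Adj a b →
      cnb G S y a = ((nb G S y).erase a).erase b := fun a b ha hb hab nab => by
    refine eq_of_subset_of_card_le (fun x hx => ?_) ?_
    · rw [mem_cnb] at hx
      exact mem_erase.2 ⟨by rintro rfl; exact nab hx.2.2,
        mem_erase.2 ⟨hx.2.2.ne', mem_nb.2 ⟨hx.1, hx.2.1⟩⟩⟩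
    · rw [card_erase_of_mem (mem_erase.2 ⟨hab.symm, hb⟩), card_erase_of_mem ha, hd]
      exact h.two_le_cnb h4 hy (mem_nb.1 ha).1 (mem_nb.1 ha).2
  have hca := key a b ha hb hab nab
  have hcb := key b a hb ha hab.symm fun hh => nab hh.symm
  have hadj : ∀ c ∈ nb G S y, c ≠ a → c ≠ b → G.Adj a c ∧ G.Adj b c := fun c hc h1 h2 => by
    have h3 : c ∈ cnb G S y a := hca ▸ mem_erase.2 ⟨h2, mem_erase.2 ⟨h1, hc⟩⟩
    have h4 : c ∈ cnb G S y b := hcb ▸ mem_erase.2 ⟨h1, mem_erase.2 ⟨h2, hc⟩⟩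
    exact ⟨(mem_cnb.1 h3).2.2, (mem_cnb.1 h4).2.2⟩
  obtain ⟨haS, hya⟩ := mem_nb.1 ha
  have hadj' : ∀ v ∈ S.erase y, v ≠ a → ((con G a {y}).Adj a v ↔ G.Adj a v ∨ v = b) := by
    intro v hv hva
    rw [con_adj_left hva]
    constructor
    · rintro ⟨z, hz, hzv⟩
      rcases mem_insert.1 hz with rfl | hz
      · exact Or.inl hzv
      · rw [mem_singleton.1 hz] at hzv
        by_cases hvb : v = b
        · exact Or.inr hvb
        · exact Or.inl (hadj v (mem_nb.2 ⟨(mem_erase.1 hv).2, hzv⟩) hva hvb).1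
    · rintro (hv | rfl)
      exacts [⟨a, by simp, hv⟩, ⟨y, by simp, (mem_nb.1 hb).2⟩]
  refine ⟨a, ha, b, hb, hab, nab, hadj, ⟨?_, ?_⟩, fun u hu v hv => ?_⟩
  · rw [← sdiff_singleton_eq_erase]
    exact h.kl.con haS (by simpa using hy) (by simpa using hya.ne') (cn_pair hya.symm)
  · have h1 := ecard_con_edge haS hy hya.symm
    have h2 := card_erase_of_mem hy
    have h3 : #(cnb G S a y) = 2 := by
      rw [cnb_comm, hca, card_erase_of_mem (mem_erase.2 ⟨hab.symm, hb⟩), card_erase_of_mem ha, hd]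
    rw [sdiff_singleton_eq_erase] at h1
    have := h.tri
    omega
  · by_cases hua : u = a
    · subst hua
      by_cases hvu : v = u
      · subst hvu
        simp [hab]
      · rw [hadj' v hv hvu]
        simp [hab, hvu]
    · by_cases hva : v = a
      · subst hva
        rw [SimpleGraph.adj_comm, hadj' u hu hua, G.adj_comm]
        simp [hua]
      · rw [con_adj_of_ne hua hva]
        simp [hua, hva]

theorem step {m : ℕ} {L L' : List (List ℕ)} (h4 : 4 ≤ m) (h9 : m < 9)
    (hc : check m L L' = true)
    (hL : ∀ (G : SimpleGraph V) (S : Finset V), Mt G S → #S = m →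
      ∃ R ∈ L, ∃ f, Tbl G S m (bit R) f) (h : Mt G S) (hS : #S = m + 1) :
    ∃ R ∈ L', ∃ f, Tbl G S (m + 1) (bit R) f := by
  obtain ⟨y, hy, hd⟩ := h.exists_le_four (by omega) (by omega)
  have hd' := h.three_le (by omega) hy
  have hSy : #(S.erase y) = m := by rw [card_erase_of_mem hy]; omega
  have hI : ∀ f F (G' : SimpleGraph V), Tbl G' (S.erase y) m F f →
      #{i ∈ range m | G.Adj y (f i)} = #(nb G S y) := fun f F G' hf => by
    rw [← card_image_of_injOn (f := f)]
    · congr 1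
      ext x
      simp only [mem_image, mem_filter, mem_range, mem_nb]
      constructor
      · rintro ⟨i, ⟨hi, h1⟩, rfl⟩
        exact ⟨(mem_erase.1 (hf.mem i hi)).2, h1⟩
      · rintro ⟨h1, h2⟩
        obtain ⟨i, hi, rfl⟩ := hf.surj x (mem_erase.2 ⟨h2.ne', h1⟩)
        exact ⟨i, ⟨hi, h2⟩, rfl⟩
    · intro i hi j hj hij
      simp only [coe_filter, mem_range, Set.mem_ofPred_eq] at hi hj
      exact hf.inj i hi.1 j hj.1 hij
  simp only [check, List.all_eq_true, Bool.and_eq_true] at hc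
  rcases Nat.lt_or_ge 3 #(nb G S y) with hd3 | hd3
  · obtain ⟨a, ha, b, hb, hab, nab, hadj, hM, hcon⟩ := h.deg_four (by omega) hy (by omega)
    obtain ⟨R, hR, f, hf⟩ := hL _ _ hM hSy
    have hIc := hI f _ _ hf
    set I := {i ∈ range m | G.Adj y (f i)} with hIdef
    have hImem : ∀ i, i ∈ I ↔ i < m ∧ G.Adj y (f i) := fun i => by simp [hIdef]
    have hmem : ∀ i < m, f i ∈ S := fun i hi => (mem_erase.1 (hf.mem i hi)).2
    obtain ⟨p, hpm, rfl⟩ := hf.surj a (mem_erase.2 ⟨(mem_nb.1 ha).2.ne', (mem_nb.1 ha).1⟩)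
    obtain ⟨r, hrm, rfl⟩ := hf.surj b (mem_erase.2 ⟨(mem_nb.1 hb).2.ne', (mem_nb.1 hb).1⟩)
    have hpI := (hImem p).2 ⟨hpm, (mem_nb.1 ha).2⟩
    have hrI := (hImem r).2 ⟨hrm, (mem_nb.1 hb).2⟩
    have hadjI : ∀ c ∈ I, c ≠ p → c ≠ r → G.Adj (f p) (f c) ∧ G.Adj (f r) (f c) := by
      intro c hc hcp hcr
      obtain ⟨hcm, hyc⟩ := (hImem c).1 hc
      exact hadj _ (mem_nb.2 ⟨hmem c hcm, hyc⟩) (hf.ne hcm hpm hcp) (hf.ne hcm hrm hcr)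
    have htab : ∀ i < m, ∀ j < m,
        bit R i j = true ↔ G.Adj (f i) (f j) ∨ (i = p ∧ j = r) ∨ (i = r ∧ j = p) := by
      intro i hi j hj
      have inj : ∀ i < m, ∀ j < m, f i = f j ↔ i = j := fun i hi j hj =>
        ⟨hf.inj i hi j hj, fun h => h ▸ rfl⟩
      rw [← hf.adj i hi j hj, hcon _ (hf.mem i hi) _ (hf.mem j hj), inj i hi p hpm,
        inj i hi r hrm, inj j hj p hpm, inj j hj r hrm]
    have hpr : p ≠ r := fun hh => hab (hh ▸ rfl)
    clear hadj hcon hab ha hb hM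
    obtain ⟨p, r, hrp, hpm, hrm, hpI, hrI, nab, hadjI, htab⟩ : ∃ p r, r < p ∧ p < m ∧ r < m ∧
        p ∈ I ∧ r ∈ I ∧ ¬ G.Adj (f p) (f r) ∧
        (∀ c ∈ I, c ≠ p → c ≠ r → G.Adj (f p) (f c) ∧ G.Adj (f r) (f c)) ∧
        ∀ i < m, ∀ j < m,
          bit R i j = true ↔ G.Adj (f i) (f j) ∨ (i = p ∧ j = r) ∨ (i = r ∧ j = p) := by
      rcases lt_or_gt_of_ne hpr with hlt | hlt
      · exact ⟨r, p, hlt, hrm, hpm, hrI, hpI, fun hh => nab hh.symm,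
          fun c hc h1 h2 => (hadjI c hc h2 h1).symm, fun i hi j hj => by
            rw [htab i hi j hj, or_comm (a := i = p ∧ j = r)]⟩
      · exact ⟨p, r, hlt, hpm, hrm, hpI, hrI, nab, hadjI, htab⟩
    have hcard : #((I.erase p).erase r) = 2 := by
      rw [card_erase_of_mem (mem_erase.2 ⟨hrp.ne, hrI⟩), card_erase_of_mem hpI]
      omega
    obtain ⟨q, s, hsq, hqs⟩ := exists_gt_of_card_eq_two hcard
    have hmI : ∀ i, i ∈ I ↔ i = p ∨ i = r ∨ i = q ∨ i = s := fun i => by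
      rw [← insert_erase hpI, ← insert_erase (mem_erase.2 ⟨hrp.ne, hrI⟩), hqs]
      simp
    have hq : q ∈ (I.erase p).erase r := by simp [hqs]
    have hs : s ∈ (I.erase p).erase r := by simp [hqs]
    simp only [mem_erase] at hq hs
    have hqm := ((hImem q).1 hq.2.2).1
    have hsm := ((hImem s).1 hs.2.2).1
    have hq' := hadjI q hq.2.2 hq.2.1 hq.1
    have hs' := hadjI s hs.2.2 hs.2.1 hs.1
    have hg := (hc R hR).2
    simp only [check4, allB_iff, Bool.or_eq_true, Bool.not_eq_true', Bool.and_eq_false_iff] at hg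
    have hg := hg p hpm r hrp
    rw [(htab p hpm r hrm).2 (by simp)] at hg
    have hg := (hg.resolve_left (by simp)) q hqm
    rw [(htab p hpm q hqm).2 (Or.inl hq'.1), (htab r hrm q hqm).2 (Or.inl hq'.2)] at hg
    have hg := (hg.resolve_left (by simp)) s hsq
    rw [(htab p hpm s hsm).2 (Or.inl hs'.1), (htab r hrm s hsm).2 (Or.inl hs'.2)] at hg
    refine Tbl.of_good (Tbl.ext (f := f) hy ⟨hf.mem, hf.surj, hf.inj, fun i hi j hj => ?_⟩
      fun i hi => ?_) hS h.kl (hg.resolve_left (by simp))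
    · rw [Bool.and_eq_true, htab i hi j hj]
      simp only [natBeq_eq_decide, Bool.not_eq_true', Bool.or_eq_false_iff,
        Bool.and_eq_false_iff, decide_eq_false_iff_not]
      have nab' : ¬ G.Adj (f r) (f p) := fun hh => nab hh.symm
      constructor
      · intro hh
        refine ⟨Or.inl hh, ?_, ?_⟩ <;> by_contra! h' <;> obtain ⟨rfl, rfl⟩ := h'
        exacts [nab hh, nab' hh]
      · rintro ⟨hh | hh | hh, h2, h3⟩
        exacts [hh, (h2.elim (· hh.1) (· hh.2)).elim, (h3.elim (· hh.1) (· hh.2)).elim]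
    · rw [← and_iff_right (a := i < m) (b := G.Adj y (f i)) hi, ← hImem, hmI]
      simp only [natBeq_eq_decide, Bool.or_eq_true, decide_eq_true_iff, or_assoc]
  · obtain ⟨hM, hadj⟩ := h.deg_three (by omega) hy (by omega)
    obtain ⟨R, hR, f, hf⟩ := hL _ _ hM hSy
    have hIc := hI f _ _ hf
    set I := {i ∈ range m | G.Adj y (f i)} with hIdef
    have hImem : ∀ i, i ∈ I ↔ i < m ∧ G.Adj y (f i) := fun i => by simp [hIdef]
    have hbit : ∀ i ∈ I, ∀ j ∈ I, i ≠ j → bit R i j = true := by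
      intro i hi j hj hij
      rw [hImem] at hi hj
      rw [← hf.adj i hi.1 j hj.1]
      exact hadj _ (mem_nb.2 ⟨(mem_erase.1 (hf.mem i hi.1)).2, hi.2⟩) _
        (mem_nb.2 ⟨(mem_erase.1 (hf.mem j hj.1)).2, hj.2⟩) (hf.ne hi.1 hj.1 hij)
    obtain ⟨p, q, r, hqp, hrq, hI3⟩ := exists_gt_of_card_eq_three (I := I) (by omega)
    have hp : p ∈ I := by simp [hI3]
    have hq : q ∈ I := by simp [hI3]
    have hr : r ∈ I := by simp [hI3]
    have hg := (hc R hR).1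
    simp only [check3, allB_iff, Bool.or_eq_true, Bool.not_eq_true', Bool.and_eq_false_iff] at hg
    have hg := hg p ((hImem p).1 hp).1 q hqp
    rw [hbit p hp q hq hqp.ne'] at hg
    have hg := (hg.resolve_left (by simp)) r hrq
    rw [hbit p hp r hr (by omega), hbit q hq r hr hrq.ne'] at hg
    refine Tbl.of_good (hf.ext hy fun i hi => ?_) hS h.kl (hg.resolve_left (by simp))
    rw [← and_iff_right (a := i < m) (b := G.Adj y (f i)) hi, ← hImem, hI3]
    simp only [mem_insert, mem_singleton, natBeq_eq_decide, Bool.or_eq_true, decide_eq_true_iff,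
      or_assoc]

end Mt

end PlanarP5

namespace PlanarP5

open scoped Classical
open Finset

variable {V : Type*} {G : SimpleGraph V} {S X Y Z T : Finset V}

/-- The adjacency tables of the plane `P₅`-free triangulations on `m` vertices, `4 ≤ m`. -/
def tables : ℕ → List (List ℕ)
  | 4 => [[14, 13, 11, 7]]
  | 5 => [[30, 29, 27, 7, 7]]
  | 6 => [[62, 61, 27, 39, 7, 11], [60, 60, 27, 39, 39, 27]]
  | 7 => [[126, 61, 91, 103, 7, 11, 13], [126, 61, 91, 39, 71, 11, 21],
      [124, 124, 27, 39, 71, 75, 51], [122, 61, 90, 103, 71, 11, 29]]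
  | 8 => [[126, 189, 219, 231, 7, 11, 13, 14], [126, 189, 219, 103, 135, 11, 13, 22],
      [126, 189, 91, 167, 71, 139, 21, 42], [248, 124, 154, 167, 199, 75, 51, 29],
      [122, 61, 218, 103, 199, 11, 157, 84]]
  | _ => []

theorem check_four : check 4 (tables 4) (tables 5) = true := by decide +kernel

theorem check_five : check 5 (tables 5) (tables 6) = true := by decide +kernel

theorem check_six : check 6 (tables 6) (tables 7) = true := by decide +kernel

theorem check_seven : check 7 (tables 7) (tables 8) = true := by decide +kernel

theorem check_eight : check 8 (tables 8) (tables 9) = true := by decide +kernel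

namespace Mt

theorem exists_tbl_four (h : Mt G S) (hS : #S = 4) :
    ∃ R ∈ tables 4, ∃ f, Tbl G S 4 (bit R) f := by
  have hadj : ∀ a ∈ S, ∀ b ∈ S, a ≠ b → G.Adj a b := by
    intro a ha b hb hab
    have h1 : nb G S a ⊆ S.erase a := fun x hx =>
      mem_erase.2 ⟨(mem_nb.1 hx).2.ne', (mem_nb.1 hx).1⟩
    have h2 := eq_of_subset_of_card_le h1 (by
      rw [card_erase_of_mem ha, hS]; exact h.three_le hS.ge ha)
    exact (mem_nb.1 (h2 ▸ mem_erase.2 ⟨hab.symm, hb⟩ : b ∈ nb G S a)).2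
  obtain ⟨a, T, haT, rfl, hT⟩ := card_eq_succ.1 hS
  obtain ⟨b, c, d, hbc, hbd, hcd, rfl⟩ := card_eq_three.1 hT
  simp only [mem_insert, mem_singleton, not_or] at haT
  obtain ⟨hab, hac, had⟩ := haT
  refine ⟨[14, 13, 11, 7], List.mem_singleton.2 rfl,
    fun i => if i = 0 then a else if i = 1 then b else if i = 2 then c else d,
    fun i hi => ?_, fun v hv => ?_, fun i hi j hj => ?_, fun i hi j hj => ?_⟩
  · interval_cases i <;> simp
  · simp only [mem_insert, mem_singleton] at hv
    rcases hv with rfl | rfl | rfl | rfl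
    exacts [⟨0, by simp⟩, ⟨1, by simp⟩, ⟨2, by simp⟩, ⟨3, by simp⟩]
  · interval_cases i <;> interval_cases j <;> grind
  · interval_cases i <;> interval_cases j <;> simp [bit, Nat.testBit] <;> apply hadj <;>
      first | simp; done | assumption | (apply Ne.symm; assumption)

theorem card_ne_nine (h : Mt G S) : #S ≠ 9 := by
  intro hS
  obtain ⟨R, hR, -⟩ := h.step (by norm_num) (by norm_num) check_eight
    (fun G S h hS => h.step (by norm_num) (by norm_num) check_seven
    (fun G S h hS => h.step (by norm_num) (by norm_num) check_six
    (fun G S h hS => h.step (by norm_num) (by norm_num) check_five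
    (fun G S h hS => h.step (by norm_num) (by norm_num) check_four
    (fun G S h hS => h.exists_tbl_four hS) hS) hS) hS) hS) hS
  exact List.not_mem_nil hR

end Mt

theorem Kl.not_ctr : ¬ Ctr G S := by
  intro h
  have h1 := h.three_mul_le
  obtain ⟨v, hv, hd⟩ : ∃ v ∈ S, #(nb G S v) ≤ 5 := by
    by_contra! hh
    have h1 := card_nsmul_le_sum S (fun y => #(nb G S y)) 6 fun y hy => hh y hy
    rw [sum_card_nb, smul_eq_mul] at h1
    have := h.kl.pl.ecard_le (by have := h.nine; omega)
    have := h.nine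
    omega
  obtain ⟨u, hu, hc⟩ := h.kl.pl.exists_card_cnb_le_two hv
    (card_pos.1 (by have := h.three_le hv; omega)) hd
  obtain ⟨huS, hvu⟩ := mem_nb.1 hu
  have h2 := ecard_con_edge hv huS hvu
  have h3 := card_erase_of_mem huS
  have h9 := h.nine
  rw [← sdiff_singleton_eq_erase] at h3
  have h4 := h.min _ _ (h.kl.con hv (singleton_subset_iff.2 huS) (by simpa using hvu.ne)
    (cn_pair hvu)) (by omega) (by omega)
  exact (Mt.mk h.kl h1).card_ne_nine (by omega)

theorem Kl.four_mul_ecard_le (h : Kl G S) (h2 : 2 ≤ #S) : 4 * ecard G S + 16 ≤ 11 * #S := by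
  induction hn : #S using Nat.strong_induction_on generalizing G S with
  | _ n ih =>
    subst hn
    by_contra hh
    exact Kl.not_ctr ⟨h, h2, by omega, fun G' S' h' h2' hlt => ih _ hlt h' h2' rfl⟩

end PlanarP5

namespace PlanarP5

open scoped Classical
open Finset

variable {V ι : Type*} {G : SimpleGraph V} {A Q : Finset V} {I : Finset ι} {c : V} {x : ι → V}

theorem Cn.exists_path (h : Cn G A) {a b : V} (ha : a ∈ A) (hb : b ∈ A) :
    ∃ p : G.Walk a b, p.IsPath ∧ ∀ v ∈ p.support, v ∈ A := by
  have key : {y ∈ A | ∃ p : G.Walk a y, ∀ v ∈ p.support, v ∈ A} = A := by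
    refine h.2 _ (filter_subset _ _) ⟨a, mem_filter.2 ⟨ha, .nil, by simpa using ha⟩⟩ ?_
    intro u hu v hv huv
    obtain ⟨-, p, hp⟩ := mem_filter.1 hu
    refine mem_filter.2 ⟨hv, p.concat huv, fun w hw => ?_⟩
    rw [SimpleGraph.Walk.support_concat, List.mem_append,
      List.mem_singleton] at hw
    rcases hw with hw | rfl
    exacts [hp w hw, hv]
  rw [← key] at hb
  obtain ⟨-, p, hp⟩ := mem_filter.1 hb
  exact ⟨p.bypass, p.bypass_isPath, fun v hv => hp v (p.support_bypass_subset_support hv)⟩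

/-- `A` is a minimal connected set containing `a` and `b`. -/
def Mn (G : SimpleGraph V) (A : Finset V) (a b : V) : Prop :=
  ∀ B ⊆ A, Cn G B → a ∈ B → b ∈ B → B = A

theorem Cn.exists_mn (h : Cn G A) {a b : V} (ha : a ∈ A) (hb : b ∈ A) :
    ∃ B ⊆ A, Cn G B ∧ a ∈ B ∧ b ∈ B ∧ Mn G B a b := by
  obtain ⟨B, hB, hmin⟩ := exists_min_image {B ∈ A.powerset | Cn G B ∧ a ∈ B ∧ b ∈ B} card
    ⟨A, by simp [h, ha, hb]⟩
  simp only [mem_filter, mem_powerset] at hB hmin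
  exact ⟨B, hB.1, hB.2.1, hB.2.2.1, hB.2.2.2, fun C hC h1 h2 h3 =>
    eq_of_subset_of_card_le hC (hmin C ⟨hC.trans hB.1, h1, h2, h3⟩)⟩

theorem Cn.exists_split (h : Cn G Q) {c d y : V} (hc : c ∈ Q) (hd : d ∈ Q)
    (hdc : d ≠ c) (hm : Mn G Q c y) : ∃ W ⊆ Q, Cn G W ∧ c ∈ W ∧ d ∉ W ∧ y ∉ W ∧
      Cn G (Q \ W) ∧ ∃ z ∈ W, G.Adj d z := by
  obtain ⟨W, hW, hcW, hWc, hcl⟩ := exists_comp G (mem_erase.2 ⟨hdc.symm, hc⟩)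
  have hWQ : W ⊆ Q := hW.trans (erase_subset _ _)
  have hdW : d ∉ W := fun hh => (mem_erase.1 (hW hh)).1 rfl
  have hclosed : ∀ t ⊆ Q \ W, t.Nonempty → (∀ u ∈ t, ∀ v ∈ Q \ W, G.Adj u v → v ∈ t) → d ∈ t := by
    intro t ht hne hct
    by_contra hdt
    have : t = Q := h.2 t (ht.trans sdiff_subset) hne fun u hu v hv huv => by
      refine hct u hu v (mem_sdiff.2 ⟨hv, fun hvW => ?_⟩) huv
      obtain ⟨huQ, huW⟩ := mem_sdiff.1 (ht hu)
      exact huW (hcl v hvW u (mem_erase.2 ⟨by rintro rfl; exact hdt hu, huQ⟩) huv.symm)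
    exact hdt (this ▸ hd)
  refine ⟨W, hWQ, hWc, hcW, hdW, fun hyW => ?_, ⟨⟨d, mem_sdiff.2 ⟨hd, hdW⟩⟩, ?_⟩, ?_⟩
  · exact hdW (hm W hWQ hWc hcW hyW ▸ hd)
  · intro t ht hne hct
    have hdt := hclosed t ht hne hct
    by_contra hne'
    have := hclosed ((Q \ W) \ t) sdiff_subset
      (sdiff_nonempty.2 fun hh => hne' (subset_antisymm ht hh)) fun u hu v hv huv => by
        obtain ⟨huQ, hut⟩ := mem_sdiff.1 hu
        exact mem_sdiff.2 ⟨hv, fun hvt => hut (hct v hvt u huQ huv.symm)⟩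
    exact (mem_sdiff.1 this).2 hdt
  · obtain ⟨z, hz, v, hv, hvW, hzv⟩ := h.exists_adj hWQ ⟨c, hcW⟩ fun hh => hdW (hh ▸ hd)
    refine ⟨z, hz, ?_⟩
    rcases eq_or_ne v d with rfl | hvd
    · exact hzv.symm
    · exact absurd (hcl z hz v (mem_erase.2 ⟨hvd, hv⟩) hzv) hvW

theorem Cn.exists_attach (h : Cn G A) {B : Finset V} (hB : B ⊆ A) (hne : B.Nonempty) {y : V}
    (hy : y ∈ A) : ∃ d ∈ B, ∃ R ⊆ A, Cn G R ∧ d ∈ R ∧ y ∈ R ∧ ∀ v ∈ R, v ∈ B → v = d := by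
  by_cases hyB : y ∈ B
  · exact ⟨y, hyB, {y}, by simpa using hy, cn_singleton G y, by simp, by simp, by simp⟩
  obtain ⟨C, hC, hyC, hCc, hcl⟩ := exists_comp G (mem_sdiff.2 ⟨hy, hyB⟩)
  have hCA : C ⊆ A := hC.trans sdiff_subset
  have hCB : ∀ v ∈ C, v ∉ B := fun v hv => (mem_sdiff.1 (hC hv)).2
  obtain ⟨b, hb⟩ := hne
  obtain ⟨z, hz, d, hd, hdC, hzd⟩ := h.exists_adj hCA ⟨y, hyC⟩ fun hh =>
    hCB b (hh ▸ hB hb) hb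
  have hdB : d ∈ B := by
    by_contra hdB
    exact hdC (hcl z hz d (mem_sdiff.2 ⟨hd, hdB⟩) hzd)
  refine ⟨d, hdB, Insert.insert d C, insert_subset hd hCA, hCc.insert hz hzd.symm, by simp,
    by simp [hyC], fun v hv hvB => ?_⟩
  rcases mem_insert.1 hv with rfl | hv
  exacts [rfl, absurd hvB (hCB v hv)]

/-- Connected subsets `Q i` of `A` joining `c` to `x i` and meeting pairwise in `c` only. -/
structure Star (G : SimpleGraph V) (A : Finset V) (c : V) (I : Finset ι) (x : ι → V)
    (Q : ι → Finset V) : Prop where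
  sub : ∀ i ∈ I, Q i ⊆ A
  cn : ∀ i ∈ I, Cn G (Q i)
  center : ∀ i ∈ I, c ∈ Q i
  mem : ∀ i ∈ I, x i ∈ Q i
  inter : ∀ i ∈ I, ∀ j ∈ I, i ≠ j → ∀ v ∈ Q i, v ∈ Q j → v = c

theorem Star.exists_mn {Q : ι → Finset V} (h : Star G A c I x Q) :
    ∃ Q', Star G A c I x Q' ∧ ∀ i ∈ I, Mn G (Q' i) c (x i) := by
  choose! Q' h1 h2 h3 h4 h5 using fun i (hi : i ∈ I) =>
    (h.cn i hi).exists_mn (h.center i hi) (h.mem i hi)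
  exact ⟨Q', ⟨fun i hi => (h1 i hi).trans (h.sub i hi), h2, h3, h4,
    fun i hi j hj hij v hv hv' => h.inter i hi j hj hij v (h1 i hi hv) (h1 j hj hv')⟩, h5⟩

/-- A star that cannot be extended by `y` at its centre: the set joining `y` to the star meets it
in a vertex `d` of the leg `Q i`, which falls into a part `W` near `c` and a part around `d`. -/
structure Tangent (G : SimpleGraph V) (A : Finset V) (c : V) (I : Finset ι) (x : ι → V)
    (Q : ι → Finset V) (y : V) (i : ι) (d : V) (W R : Finset V) : Prop where
  sub : W ⊆ Q i
  cn : Cn G W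
  cn' : Cn G (Q i \ W)
  c_mem : c ∈ W
  d_mem : d ∈ Q i \ W
  x_mem : x i ∈ Q i \ W
  adj : ∃ z ∈ W, G.Adj d z
  subR : R ⊆ A
  cnR : Cn G R
  dR : d ∈ R
  yR : y ∈ R
  inter : ∀ j ∈ I, ∀ v ∈ R, v ∈ Q j → v = d

theorem Star.extend {Q : ι → Finset V} (hA : Cn G A) (hc : c ∈ A) (h : Star G A c I x Q) {j : ι}
    (hj : j ∉ I) (hxj : x j ∈ A) : (∃ Q', Star G A c (insert j I) x Q') ∨
      ∃ Q', Star G A c I x Q' ∧ ∃ i ∈ I, ∃ d W R, Tangent G A c I x Q' (x j) i d W R := by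
  obtain ⟨Q, h, hm⟩ := h.exists_mn
  obtain ⟨d, hd, R, hRA, hRc, hdR, hyR, hint⟩ := hA.exists_attach (B := insert c (I.biUnion Q))
    (insert_subset hc (biUnion_subset.2 h.sub)) ⟨c, by simp⟩ hxj
  have hint' : ∀ i ∈ I, ∀ v ∈ R, v ∈ Q i → v = d := fun i hi v hv hvQ =>
    hint v hv (mem_insert_of_mem (mem_biUnion.2 ⟨i, hi, hvQ⟩))
  rcases eq_or_ne d c with rfl | hdc
  · left
    have hne : ∀ i ∈ I, i ≠ j := fun i hi hh => hj (hh ▸ hi)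
    have key : ∀ i ∈ insert j I, Function.update Q j R i ⊆ A ∧ Cn G (Function.update Q j R i) ∧
        d ∈ Function.update Q j R i ∧ x i ∈ Function.update Q j R i := by
      intro i hi
      rcases mem_insert.1 hi with rfl | hi
      · simpa using ⟨hRA, hRc, hdR, hyR⟩
      · rw [Function.update_of_ne (hne i hi)]
        exact ⟨h.sub i hi, h.cn i hi, h.center i hi, h.mem i hi⟩
    refine ⟨Function.update Q j R, fun i hi => (key i hi).1, fun i hi => (key i hi).2.1,
      fun i hi => (key i hi).2.2.1, fun i hi => (key i hi).2.2.2, fun i hi k hk hik v hv hv' => ?_⟩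
    by_cases hij : i = j <;> by_cases hkj : k = j
    · exact absurd (hij.trans hkj.symm) hik
    · rw [hij, Function.update_self] at hv
      rw [Function.update_of_ne hkj] at hv'
      exact hint' k ((mem_insert.1 hk).resolve_left hkj) v hv hv'
    · rw [hkj, Function.update_self] at hv'
      rw [Function.update_of_ne hij] at hv
      exact hint' i ((mem_insert.1 hi).resolve_left hij) v hv' hv
    · rw [Function.update_of_ne hij] at hv
      rw [Function.update_of_ne hkj] at hv'
      exact h.inter i ((mem_insert.1 hi).resolve_left hij) k ((mem_insert.1 hk).resolve_left hkj)
        hik v hv hv'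
  · right
    rcases mem_insert.1 hd with hd | hd
    · exact absurd hd hdc
    obtain ⟨i, hi, hd⟩ := mem_biUnion.1 hd
    obtain ⟨W, h1, h2, h3, h4, h5, h6, h7⟩ := (h.cn i hi).exists_split (h.center i hi) hd
      hdc (hm i hi)
    exact ⟨Q, h, i, hi, d, W, R, h1, h2, h6, h3, mem_sdiff.2 ⟨hd, h4⟩,
      mem_sdiff.2 ⟨h.mem i hi, h5⟩, h7, hRA, hRc, hdR, hyR, hint'⟩

theorem exists_star_pair (hA : Cn G A) (hx : ∀ i ∈ I, x i ∈ A) (hI : #I = 2) :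
    ∃ c ∈ A, ∃ Q, Star G A c I x Q := by
  obtain ⟨i, j, hij, rfl⟩ := card_eq_two.1 hI
  have hi := hx i (by simp)
  have hj := hx j (by simp)
  have hi' : Function.update (fun _ => A) i {x i} i = {x i} := by simp
  have hj' : Function.update (fun _ => A) i {x i} j = A := by simp [hij.symm]
  refine ⟨x i, hi, Function.update (fun _ => A) i {x i}, ?_, ?_, ?_, ?_, ?_⟩ <;>
    simp only [forall_mem_insert, mem_singleton, forall_eq, hi', hj']
  · simpa using hi
  · exact ⟨cn_singleton G _, hA⟩
  · simpa using hi
  · simpa using hj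
  · simp

theorem exists_star_triple (hA : Cn G A) (hx : ∀ i ∈ I, x i ∈ A) (hI : #I = 3) :
    ∃ c ∈ A, ∃ Q, Star G A c I x Q := by
  obtain ⟨j, I, hj, rfl, hI'⟩ := card_eq_succ.1 hI
  obtain ⟨c, hc, Q, h⟩ := exists_star_pair hA (fun i hi => hx i (mem_insert_of_mem hi)) hI'
  obtain ⟨Q, h⟩ | ⟨Q, h, i, hi, d, W, R, ht⟩ := h.extend hA hc hj (hx j (by simp))
  · exact ⟨c, hc, Q, h⟩
  obtain ⟨k, hk⟩ : ∃ k, I.erase i = {k} := card_eq_one.1 (by rw [card_erase_of_mem hi, hI'])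
  have hkI : k ∈ I.erase i := by simp [hk]
  obtain ⟨hki, hkI⟩ := mem_erase.1 hkI
  obtain rfl : I = {i, k} := by rw [← hk, insert_erase hi]
  obtain ⟨hdQ, hdW⟩ := mem_sdiff.1 ht.d_mem
  have hjk : j ≠ k := fun hh => hj (by simp [hh])
  have hji : j ≠ i := fun hh => hj (by simp [hh])
  obtain ⟨z, hz, hdz⟩ := ht.adj
  have hdc : d ≠ c := fun hh => hdW (hh ▸ ht.c_mem)
  have hdk : d ∉ Q k := fun hh => hdc (h.inter i (by simp) k (by simp) hki.symm d hdQ hh)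
  have hint := h.inter i (by simp) k (by simp) hki.symm
  set L : Finset V := insert d (W ∪ Q k) with hL
  have hLc : Cn G L := (ht.cn.union (h.cn k (by simp))
    (Or.inr (not_disjoint_iff.2 ⟨c, ht.c_mem, h.center k (by simp)⟩))).insert
      (mem_union_left _ hz) hdz
  have hdA := h.sub i (by simp) hdQ
  have e1 : ∀ v ∈ Q i \ W, v ∈ L → v = d := fun v hv hv' => by
    obtain ⟨hvQ, hvW⟩ := mem_sdiff.1 hv
    simp only [hL, mem_insert, mem_union] at hv'
    rcases hv' with hv' | hv' | hv'
    · exact hv'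
    · exact absurd hv' hvW
    · exact absurd (hint v hvQ hv' ▸ ht.c_mem) hvW
  have e2 : ∀ v ∈ R, v ∈ L → v = d := fun v hv hv' => by
    simp only [hL, mem_insert, mem_union] at hv'
    rcases hv' with hv' | hv' | hv'
    · exact hv'
    · exact ht.inter i (by simp) v hv (ht.sub hv')
    · exact ht.inter k (by simp) v hv hv'
  have e3 : ∀ v ∈ R, v ∈ Q i \ W → v = d := fun v hv hv' =>
    ht.inter i (by simp) v hv (mem_sdiff.1 hv').1
  refine ⟨d, hdA, fun l => if l = i then Q i \ W else if l = j then R else L, ?_⟩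
  have v1 : (fun l => if l = i then Q i \ W else if l = j then R else L) i = Q i \ W := by simp
  have v2 : (fun l => if l = i then Q i \ W else if l = j then R else L) j = R := by simp [hji]
  have v3 : (fun l => if l = i then Q i \ W else if l = j then R else L) k = L := by
    simp [hki, hjk.symm]
  generalize (fun l => if l = i then Q i \ W else if l = j then R else L) = Q' at v1 v2 v3
  constructor
  · simp only [forall_mem_insert, mem_singleton, forall_eq, v1, v2, v3]
    exact ⟨ht.subR, sdiff_subset.trans (h.sub i (by simp)), insert_subset hdA (union_subset
      (ht.sub.trans (h.sub i (by simp))) (h.sub k (by simp)))⟩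
  · simp only [forall_mem_insert, mem_singleton, forall_eq, v1, v2, v3]
    exact ⟨ht.cnR, ht.cn', hLc⟩
  · simp only [forall_mem_insert, mem_singleton, forall_eq, v1, v2, v3]
    exact ⟨ht.dR, ht.d_mem, by simp [hL]⟩
  · simp only [forall_mem_insert, mem_singleton, forall_eq, v1, v2, v3]
    exact ⟨ht.yR, ht.x_mem, by simp [hL, h.mem k (by simp)]⟩
  · simp only [forall_mem_insert, mem_singleton, forall_eq, v1, v2, v3, ne_eq, not_true_eq_false,
      false_imp_iff, true_and, and_true]
    exact ⟨⟨fun _ => e3, fun _ => e2⟩, ⟨fun _ v a b => e3 v b a, fun _ => e1⟩,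
      fun _ v a b => e2 v b a, fun _ v a b => e1 v b a⟩

theorem exists_star_or_split (hA : Cn G A) (hx : ∀ i ∈ I, x i ∈ A) (hI : #I = 4) :
    (∃ c ∈ A, ∃ Q, Star G A c I x Q) ∨ ∃ i j k l, I = {i, j, k, l} ∧
      ∃ U ⊆ A, ∃ W ⊆ A, Cn G U ∧ Cn G W ∧ Disjoint U W ∧ Tc G U W ∧ x i ∈ U ∧ x j ∈ U ∧
        x k ∈ W ∧ x l ∈ W := by
  obtain ⟨j, I, hj, rfl, hI'⟩ := card_eq_succ.1 hI
  obtain ⟨c, hc, Q, h⟩ := exists_star_triple hA (fun i hi => hx i (mem_insert_of_mem hi)) hI'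
  obtain ⟨Q, h⟩ | ⟨Q, h, i, hi, d, W, R, ht⟩ := h.extend hA hc hj (hx j (by simp))
  · exact Or.inl ⟨c, hc, Q, h⟩
  right
  obtain ⟨k, l, hkl, hk⟩ : ∃ k l, k ≠ l ∧ I.erase i = {k, l} :=
    card_eq_two.1 (by rw [card_erase_of_mem hi, hI'])
  obtain ⟨hki, hkI⟩ := mem_erase.1 (show k ∈ I.erase i by simp [hk])
  obtain ⟨hli, hlI⟩ := mem_erase.1 (show l ∈ I.erase i by simp [hk])
  obtain ⟨hdQ, hdW⟩ := mem_sdiff.1 ht.d_mem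
  have hdc : d ≠ c := fun hh => hdW (hh ▸ ht.c_mem)
  obtain ⟨z, hz, hdz⟩ := ht.adj
  refine ⟨j, i, k, l, by rw [← insert_erase hi, hk], (Q i \ W) ∪ R,
    union_subset (sdiff_subset.trans (h.sub i hi)) ht.subR, W ∪ Q k ∪ Q l,
    union_subset (union_subset (ht.sub.trans (h.sub i hi)) (h.sub k hkI)) (h.sub l hlI),
    ht.cn'.union ht.cnR (Or.inr (not_disjoint_iff.2 ⟨d, ht.d_mem, ht.dR⟩)),
    (ht.cn.union (h.cn k hkI) (Or.inr (not_disjoint_iff.2 ⟨c, ht.c_mem, h.center k hkI⟩))).union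
      (h.cn l hlI) (Or.inr (not_disjoint_iff.2 ⟨c, mem_union_left _ ht.c_mem, h.center l hlI⟩)),
    ?_, tc_of_adj hdz (mem_union_right _ ht.dR) (by simp [hz]), mem_union_right _ ht.yR,
    mem_union_left _ ht.x_mem, by simp [h.mem k hkI], by simp [h.mem l hlI]⟩
  have key : ∀ m ∈ I, m ≠ i → ∀ v ∈ Q m, v ∉ (Q i \ W) ∪ R := by
    intro m hm hmi v hv hv'
    have hvi : v ∉ Q i \ W := fun hh => by
      obtain ⟨h1, h2⟩ := mem_sdiff.1 hh
      exact h2 (h.inter m hm i hi hmi v hv h1 ▸ ht.c_mem)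
    rcases mem_union.1 hv' with hv' | hv'
    · exact hvi hv'
    · exact hvi (ht.inter m hm v hv' hv ▸ ht.d_mem)
  refine disjoint_right.2 fun v hv => ?_
  simp only [mem_union] at hv
  rcases hv with (hv | hv) | hv
  · intro hv'
    rcases mem_union.1 hv' with hv' | hv'
    · exact (mem_sdiff.1 hv').2 hv
    · exact hdW (ht.inter i hi v hv' (ht.sub hv) ▸ hv)
  · exact key k hkI hki v hv
  · exact key l hlI hli v hv

end PlanarP5

namespace PlanarP5

open scoped Classical
open Finset

variable {V W : Type*} {G : SimpleGraph V} {S : Finset V}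

theorem containsSubdivision_of_star {H : SimpleGraph W} {β : W → Finset V}
    (hβ : ∀ w w', w ≠ w' → Disjoint (β w) (β w')) {I : W → Finset W}
    (hI : ∀ w w', H.Adj w w' → w' ∈ I w) {x : W → W → V}
    (hx : ∀ w w', H.Adj w w' → G.Adj (x w w') (x w' w))
    (h : ∀ w, ∃ c ∈ β w, ∃ Q, Star G (β w) c (I w) (x w) Q) : ContainsSubdivision H G := by
  choose c hc Q hQ using h
  have hinj : ∀ {a b v}, v ∈ β a → v ∈ β b → a = b := fun {a b v} ha hb => by
    by_contra hab
    exact disjoint_left.1 (hβ a b hab) ha hb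
  choose p hp hpQ using fun a b (hab : H.Adj a b) =>
    ((hQ a).cn b (hI a b hab)).exists_path ((hQ a).center b (hI a b hab))
      ((hQ a).mem b (hI a b hab))
  have hpβ : ∀ a b (hab : H.Adj a b), ∀ v ∈ (p a b hab).support, v ∈ β a := fun a b hab v hv =>
    (hQ a).sub b (hI a b hab) (hpQ a b hab v hv)
  let q : ∀ ⦃a b : W⦄, H.Adj a b → G.Walk (c a) (c b) := fun a b hab =>
    (p a b hab).append (.cons (hx a b hab) (p b a hab.symm).reverse)
  have hsupp : ∀ a b (hab : H.Adj a b), (q hab).support =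
      (p a b hab).support ++ (p b a hab.symm).support.reverse := fun a b hab => by
    simp [q, Walk.support_append, Walk.support_reverse]
  have hmem : ∀ a b (hab : H.Adj a b), ∀ v ∈ (q hab).support,
      v ∈ (p a b hab).support ∨ v ∈ (p b a hab.symm).support := fun a b hab v hv => by
    simpa [hsupp] using hv
  have same : ∀ a b b' (hab : H.Adj a b) (hab' : H.Adj a b'), b ≠ b' →
      ∀ v ∈ (p a b hab).support, v ∈ (p a b' hab').support → v = c a :=
    fun a b b' hab hab' hne v hv hv' => (hQ a).inter b (hI a b hab) b' (hI a b' hab')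
      hne v (hpQ a b hab v hv) (hpQ a b' hab' v hv')
  have cross : ∀ a b a' b' (hab : H.Adj a b) (hab' : H.Adj a' b'), s(a, b) ≠ s(a', b') →
      ∀ v ∈ (p a b hab).support, v ∈ (p a' b' hab').support → v = c a ∧ a = a' := by
    intro a b a' b' hab hab' hne v hv hv'
    obtain rfl := hinj (hpβ a b hab v hv) (hpβ a' b' hab' v hv')
    exact ⟨same a b b' hab hab' (fun hh => hne (by rw [hh])) v hv hv', rfl⟩
  refine ⟨⟨c, fun a b hab => hinj (hc a) (hab ▸ hc b)⟩, q, fun a b hab => ?_,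
    fun a b hab w hw => ?_, fun a b a' b' hab hab' hne v hv hv' => ?_⟩
  · rw [Walk.isPath_def, hsupp, List.nodup_append]
    refine ⟨(hp a b hab).support_nodup, List.nodup_reverse.2 (hp b a hab.symm).support_nodup, ?_⟩
    rintro v hv _ hv' rfl
    exact hab.ne (hinj (hpβ a b hab v hv) (hpβ b a hab.symm v (List.mem_reverse.1 hv')))
  · rcases hmem a b hab _ hw with hw | hw
    exacts [Or.inl (hinj (hc w) (hpβ a b hab _ hw)), Or.inr (hinj (hc w) (hpβ b a hab.symm _ hw))]
  · change (v = c a ∨ v = c b) ∧ (v = c a' ∨ v = c b')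
    rcases hmem a b hab v hv with h1 | h1 <;> rcases hmem a' b' hab' v hv' with h2 | h2
    · obtain ⟨rfl, rfl⟩ := cross a b a' b' hab hab' hne v h1 h2
      simp
    · obtain ⟨rfl, rfl⟩ := cross a b b' a' hab hab'.symm (by rwa [Sym2.eq_swap (a := b')]) v h1 h2
      simp
    · obtain ⟨rfl, rfl⟩ := cross b a a' b' hab.symm hab' (by rwa [Sym2.eq_swap (a := b)]) v h1 h2
      simp
    · obtain ⟨rfl, rfl⟩ := cross b a b' a' hab.symm hab'.symm
        (by rwa [Sym2.eq_swap (a := b), Sym2.eq_swap (a := b')]) v h1 h2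
      simp

theorem Model.exists_terminal {H : SimpleGraph W} {β : W → Finset V}
    (h : ∀ w w', H.Adj w w' → Tc G (β w) (β w')) (hne : ∀ w, (β w).Nonempty) :
    ∃ x : W → W → V, (∀ w w', x w w' ∈ β w) ∧
      ∀ w w', H.Adj w w' → G.Adj (x w w') (x w' w) := by
  choose a ha using hne
  choose x hx y hy hxy using h
  obtain ⟨r⟩ : Nonempty (LinearOrder W) := ⟨WellOrderingRel.isWellOrder.linearOrder⟩
  refine ⟨fun w w' => if h : H.Adj w w' then if w < w' then x w w' h else y w' w h.symm else a w,
    fun w w' => ?_, fun w w' h => ?_⟩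
  · dsimp only
    split_ifs
    exacts [hx _ _ _, hy _ _ _, ha _]
  · simp only [h, h.symm, dif_pos]
    rcases lt_or_gt_of_ne h.ne with hlt | hlt
    · simpa [hlt, hlt.not_gt] using hxy w w' h
    · simpa [hlt, hlt.not_gt] using (hxy w' w h.symm).symm

theorem Model.containsSubdivision_k33
    (h : Model (completeBipartiteGraph (Fin 3) (Fin 3)) G S) :
    ContainsSubdivision (completeBipartiteGraph (Fin 3) (Fin 3)) G := by
  obtain ⟨β, h1, h2, h3⟩ := h
  obtain ⟨x, hx, hx'⟩ := Model.exists_terminal h3 fun w => (h1 w).2.1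
  refine containsSubdivision_of_star h2
    (I := fun w => {w' | (completeBipartiteGraph (Fin 3) (Fin 3)).Adj w w'}) (by simp) hx' fun w =>
      exists_star_triple (h1 w).2 (fun i _ => hx w i) ?_
  rcases w with w | w
  · have : ({w' | (completeBipartiteGraph (Fin 3) (Fin 3)).Adj (.inl w) w'} : Finset _) =
      univ.map ⟨Sum.inr, Sum.inr_injective⟩ := by ext (w' | w') <;> simp
    rw [this, card_map, card_univ, Fintype.card_fin]
  · have : ({w' | (completeBipartiteGraph (Fin 3) (Fin 3)).Adj (.inr w) w'} : Finset _) =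
      univ.map ⟨Sum.inl, Sum.inl_injective⟩ := by ext (w' | w') <;> simp
    rw [this, card_map, card_univ, Fintype.card_fin]

theorem Model.k33_or_containsSubdivision_k5 (h : Model (completeGraph (Fin 5)) G S) :
    Model (completeBipartiteGraph (Fin 3) (Fin 3)) G S ∨
      ContainsSubdivision (completeGraph (Fin 5)) G := by
  obtain ⟨β, h1, h2, h3⟩ := h
  obtain ⟨x, hx, hx'⟩ := Model.exists_terminal h3 fun w => (h1 w).2.1
  by_cases hall : ∀ w, ∃ c ∈ β w, ∃ Q, Star G (β w) c (univ.erase w) (x w) Q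
  · exact Or.inr (containsSubdivision_of_star h2 (I := fun w => univ.erase w)
      (fun w w' hw => by simpa using hw.ne') hx' hall)
  left
  push Not at hall
  obtain ⟨w, hw⟩ := hall
  obtain ⟨c, hc, Q, hQ⟩ | ⟨i, j, k, l, hI, U, hU, X, hX, hUc, hXc, hUX, ht, hi, hj, hk, hl⟩ :=
    exists_star_or_split (I := univ.erase w) (h1 w).2 (fun i _ => hx w i) (by simp)
  · exact absurd hQ (hw c hc Q)
  replace hI : univ.erase w = {i, j, k, l} := by
    ext m
    simpa using Finset.ext_iff.1 hI m
  have hc4 : #({i, j, k, l} : Finset (Fin 5)) = 4 := by rw [← hI]; simp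
  have hwi : ∀ m ∈ ({i, j, k, l} : Finset (Fin 5)), w ≠ m := fun m hm => by
    rw [← hI] at hm
    exact (ne_of_mem_erase hm).symm
  simp only [forall_mem_insert, mem_singleton, forall_eq] at hwi
  obtain ⟨wi, wj, wk, wl⟩ := hwi
  have hne : i ≠ j ∧ i ≠ k ∧ i ≠ l ∧ j ≠ k ∧ j ≠ l ∧ k ≠ l := by
    clear hI wi wj wk wl hi hj hk hl
    revert i j k l
    decide
  obtain ⟨ij, ik, il, jk, jl, kl⟩ := hne
  have tc : ∀ {m Y}, w ≠ m → x w m ∈ Y → Tc G Y (β m) := fun {m Y} hwm hm =>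
    tc_of_adj (hx' w m hwm) hm (hx m w)
  have dU : ∀ {m}, w ≠ m → Disjoint U (β m) := fun hm => (h2 w _ hm).mono_left hU
  have dX : ∀ {m}, w ≠ m → Disjoint X (β m) := fun hm => (h2 w _ hm).mono_left hX
  exact model_k33 U (β k) (β l) X (β i) (β j)
    ⟨hU.trans (h1 w).1, (h1 k).1, (h1 l).1, hX.trans (h1 w).1, (h1 i).1, (h1 j).1⟩
    ⟨hUc, (h1 k).2, (h1 l).2, hXc, (h1 i).2, (h1 j).2⟩
    ⟨dU wk, dU wl, h2 k l kl⟩ ⟨dX wi, dX wj, h2 i j ij⟩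
    ⟨hUX, dU wi, dU wj, (dX wk).symm, h2 k i ik.symm, h2 k j jk.symm, (dX wl).symm,
      h2 l i il.symm, h2 l j jl.symm⟩
    ⟨ht, tc wi hi, tc wj hj, (tc wk hk).symm, h3 k i ik.symm, h3 k j jk.symm, (tc wl hl).symm,
      h3 l i il.symm, h3 l j jl.symm⟩

theorem pl_of_isPlanar (h : IsPlanar G) : Pl G S :=
  ⟨fun hh => hh.k33_or_containsSubdivision_k5.elim (fun hm => h.2 hm.containsSubdivision_k33) h.1,
    fun hh => h.2 hh.containsSubdivision_k33⟩

theorem noP5_of_not_containsInduced (h : ¬ ContainsInduced (pathGraph 5) G) : NoP5 G S := by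
  intro x₀ _ x₁ _ x₂ _ x₃ _ x₄ _ e01 e12 e23 e34 n02 n03 n04 n13 n14 n24
  have hadj : ∀ i j, G.Adj (![x₀, x₁, x₂, x₃, x₄] i) (![x₀, x₁, x₂, x₃, x₄] j) ↔
      (pathGraph 5).Adj i j := by
    intro i j
    rw [pathGraph_adj]
    fin_cases i <;> fin_cases j <;> simp [*, G.adj_comm]
  have hinj : Function.Injective ![x₀, x₁, x₂, x₃, x₄] := by
    intro i j hij
    by_contra hne
    have key : ∀ i j : Fin 5, i ≠ j → ∃ k : Fin 5, ¬ ((i.val + 1 = k.val ∨ k.val + 1 = i.val) ↔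
        (j.val + 1 = k.val ∨ k.val + 1 = j.val)) := by decide
    obtain ⟨k, hk⟩ := key i j hne
    refine hk ?_
    rw [← pathGraph_adj, ← pathGraph_adj, ← hadj, ← hadj, hij]
  exact h ⟨Set.range ![x₀, x₁, x₂, x₃, x₄], ⟨⟨Equiv.ofInjective _ hinj, fun {i j} => hadj i j⟩⟩⟩

theorem ncard_edgeSet_eq_ecard [Fintype V] (G : SimpleGraph V) :
    G.edgeSet.ncard = ecard G univ := by
  have h1 := sum_card_nb G univ
  have h2 := G.sum_degrees_eq_twice_card_edges
  have h3 : ∑ v, G.degree v = ∑ v, #(nb G univ v) :=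
    sum_congr rfl fun v _ => by rw [← card_neighborFinset_eq_degree, neighborFinset_eq_filter]; rfl
  rw [← coe_edgeFinset, Set.ncard_coe_finset]
  omega

end PlanarP5

theorem stmt_18 (n : ℕ) (hn : 9 ≤ n) (G : SimpleGraph (Fin n))
    (hP : IsPlanar G) (hF : ¬ ContainsInduced (pathGraph 5) G) :
    G.edgeSet.ncard ≤ 11 * n / 4 - 4 := by
  have h := PlanarP5.Kl.four_mul_ecard_le (G := G) (S := Finset.univ)
    ⟨PlanarP5.pl_of_isPlanar hP, PlanarP5.noP5_of_not_containsInduced hF⟩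
    (by rw [Finset.card_univ, Fintype.card_fin]; omega)
  rw [Finset.card_univ, Fintype.card_fin] at h
  rw [PlanarP5.ncard_edgeSet_eq_ecard]
  omega
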